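/- Asymptotic speed law: for every Λ₀ > 0 and every ε > 0 there exists 𝔭₀(Λ₀, ε) > 0 such that, if u satisfies the quasi-minimizer hypotheses with momentum 𝔭 ≥ 𝔭₀(Λ₀, ε) and speed c, then |c·𝔭 − 2π| ≤ ε; equivalently, |(1/2)∫_{ℝ²}(1 − |u|²)² dx − 2π| ≤ ε. -/

import Mathlib

open MeasureTheory Filter Metric

noncomputable section

/-- First partial derivative (direction `x₁`), identifying `ℝ²` with `ℂ`. -/
def pd1 (u : ℂ → ℂ) (z : ℂ) : ℂ := fderiv ℝ u z 1

/-- Second partial derivative (direction `x₂`). -/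
def pd2 (u : ℂ → ℂ) (z : ℂ) : ℂ := fderiv ℝ u z Complex.I

/-- Laplacian `Δu`. -/
def lap (u : ℂ → ℂ) (z : ℂ) : ℂ := fderiv ℝ (pd1 u) z 1 + fderiv ℝ (pd2 u) z Complex.I

/-- `|∇u|²`. -/
def gradSq (u : ℂ → ℂ) (z : ℂ) : ℝ := ‖pd1 u z‖ ^ 2 + ‖pd2 u z‖ ^ 2

/-- Ginzburg–Landau energy density. -/
def energyDensity (u : ℂ → ℂ) (z : ℂ) : ℝ :=
  (1 / 2) * gradSq u z + (1 / 4) * (1 - ‖u z‖ ^ 2) ^ 2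

/-- Ginzburg–Landau energy, valued in `[0,∞]`. -/
def energy (u : ℂ → ℂ) : ENNReal := ∫⁻ z : ℂ, ENNReal.ofReal (energyDensity u z)

/-- `E(u)`, real valued. -/
def Efun (u : ℂ → ℂ) : ℝ := (energy u).toReal

/-- The energy space `ℰ`: (smooth) maps with finite Ginzburg–Landau energy. -/
def memE (u : ℂ → ℂ) : Prop := ContDiff ℝ (⊤ : ℕ∞) u ∧ energy u < ⊤

/-- Momentum density `Re(i ∂₂u (conj u − 1))`. -/
def momDensity (u : ℂ → ℂ) (z : ℂ) : ℝ :=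
  (Complex.I * pd2 u z * ((starRingEnd ℂ) (u z) - 1)).re

/-- Integrability of the momentum density. -/
def momInt (u : ℂ → ℂ) : Prop := Integrable (momDensity u)

/-- The momentum `P₂(u)`. -/
def P2 (u : ℂ → ℂ) : ℝ := (1 / 2) * ∫ z : ℂ, momDensity u z

/-- `(TW_c)(u) = 0`: the travelling wave equation `−ic∂₂u − Δu − (1−|u|²)u = 0`. -/
def TW (c : ℝ) (u : ℂ → ℂ) : Prop :=
  ∀ z : ℂ, -(Complex.I * (c : ℂ) * pd2 u z) - lap u z - ((1 - ‖u z‖ ^ 2 : ℝ) : ℂ) * u z = 0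

/-- `E_min(p)`. -/
def Emin (p : ℝ) : ℝ := sInf (Efun '' {u : ℂ → ℂ | memE u ∧ P2 u = p})

/-- Evenness in `x₁`: `u(−x₁, x₂) = u(x₁, x₂)`. -/
def evenX1 (u : ℂ → ℂ) : Prop := ∀ z : ℂ, u (-((starRingEnd ℂ) z)) = u z

/-- Quasi-minimizer hypotheses (with symmetry), momentum `p` and speed `c`. -/
def QuasiMin (Λ₀ : ℝ) (u : ℂ → ℂ) (p c : ℝ) : Prop :=
  memE u ∧ evenX1 u ∧ 0 < c ∧ TW c u ∧ momInt u ∧ P2 u = p ∧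
  Efun u ≤ 2 * Real.pi * Real.log p + Λ₀

/-- `V1` is the degree-one vortex with (increasing) modulus profile `ρ`. -/
def IsVortex (V1 : ℂ → ℂ) (ρ : ℝ → ℝ) : Prop :=
  ContDiff ℝ (⊤ : ℕ∞) V1 ∧
  (∀ z : ℂ, lap V1 z + V1 z * ((1 - ‖V1 z‖ ^ 2 : ℝ) : ℂ) = 0) ∧
  V1 0 = 0 ∧
  (∀ z : ℂ, z ≠ 0 → V1 z = ((ρ ‖z‖ : ℝ) : ℂ) * (z / (‖z‖ : ℂ))) ∧
  ρ 0 = 0 ∧ StrictMonoOn ρ (Set.Ici 0) ∧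
  (∀ r : ℝ, 0 ≤ r → 0 ≤ ρ r ∧ ρ r < 1) ∧
  Filter.Tendsto ρ Filter.atTop (nhds 1)

namespace GinzburgLandau

open scoped ContDiff Topology

section DirectionalDerivative

variable {E : Type*} [NormedAddCommGroup E] [NormedSpace ℝ E]

/-- Derivative of a real function in the direction `v`. -/
def dd (v : E) (f : E → ℝ) (x : E) : ℝ := fderiv ℝ f x v

variable {f g : E → ℝ} {v v' : E}

theorem smooth_differentiable (hf : ContDiff ℝ ∞ f) : Differentiable ℝ f :=
  hf.differentiable (by simp)

@[fun_prop]
theorem contDiff_dd (hf : ContDiff ℝ ∞ f) : ContDiff ℝ ∞ (dd v f) := by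
  have h : ContDiff ℝ ∞ (fderiv ℝ f) := hf.fderiv_right (by simp)
  exact h.clm_apply contDiff_const

theorem dd_comm (hf : ContDiff ℝ ∞ f) : dd v (dd v' f) = dd v' (dd v f) := by
  funext x
  have h : ContDiff ℝ ∞ (fderiv ℝ f) := hf.fderiv_right (by simp)
  have hd : DifferentiableAt ℝ (fderiv ℝ f) x := h.differentiable (by simp) x
  have key : ∀ p q : E, dd p (dd q f) x = fderiv ℝ (fderiv ℝ f) x p q := by
    intro p q
    have := (hd.hasFDerivAt.clm_apply (hasFDerivAt_const q x)).fderiv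
    change fderiv ℝ (fun y => fderiv ℝ f y q) x p = _
    rw [this]; simp
  rw [key, key]
  exact (hf.contDiffAt.isSymmSndFDerivAt (by simpa using WithTop.coe_le_coe.2 (le_top : (2 : ℕ∞) ≤ ⊤))) v v'

theorem dd_add (hf : ContDiff ℝ ∞ f) (hg : ContDiff ℝ ∞ g) :
    dd v (fun x => f x + g x) = fun x => dd v f x + dd v g x := by
  funext x
  have := ((smooth_differentiable hf x).hasFDerivAt.add (smooth_differentiable hg x).hasFDerivAt).fderiv
  simp only [dd]
  erw [this]; rfl

theorem dd_mul (hf : ContDiff ℝ ∞ f) (hg : ContDiff ℝ ∞ g) :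
    dd v (fun x => f x * g x) = fun x => dd v f x * g x + f x * dd v g x := by
  funext x
  have := ((smooth_differentiable hf x).hasFDerivAt.mul (smooth_differentiable hg x).hasFDerivAt).fderiv
  simp only [dd]
  erw [this]; simp; ring

theorem dd_const (r : ℝ) : dd v (fun _ : E => r) = fun _ => 0 := by
  funext x; simp [dd]

/-- The restriction of a smooth function to a line is differentiable. -/
theorem hasDerivAt_line (hf : ContDiff ℝ ∞ f) (x : E) :
    HasDerivAt (fun r : ℝ => f (x + r • v)) (dd v f x) 0 := by
  have h1 : HasDerivAt (fun r : ℝ => x + r • v) v 0 := by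
    simpa using ((hasDerivAt_id (0:ℝ)).smul_const v).const_add x
  have h2 : HasFDerivAt f (fderiv ℝ f x) (x + (0:ℝ) • v) := by
    simpa using (smooth_differentiable hf x).hasFDerivAt
  exact h2.comp_hasDerivAt (0:ℝ) h1

theorem dd_eq_of_hasDerivAt (hf : ContDiff ℝ ∞ f) {x : E} {y : ℝ}
    (h : HasDerivAt (fun r : ℝ => f (x + r • v)) y 0) : dd v f x = y :=
  (hasDerivAt_line hf x).unique h

end DirectionalDerivative

/-- Differentiation of a parametrised integral over one period. -/
theorem hasDerivAt_integral_period {F F' : ℝ → ℝ → ℝ} {U : Set ℝ} (hU : IsOpen U) {s₀ : ℝ}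
    (hs : s₀ ∈ U) (hF : ∀ s ∈ U, Continuous (F s))
    (hF' : ContinuousOn (Function.uncurry F') (U ×ˢ Set.univ))
    (hd : ∀ s ∈ U, ∀ t, HasDerivAt (fun s => F s t) (F' s t) s) (T : ℝ) :
    HasDerivAt (fun s => ∫ t in (0:ℝ)..T, F s t) (∫ t in (0:ℝ)..T, F' s₀ t) s₀ := by
  obtain ⟨r, hr, hrU⟩ := Metric.isOpen_iff.1 hU s₀ hs
  have hsub : closedBall s₀ (r/2) ⊆ U := (closedBall_subset_ball (by linarith)).trans hrU
  have hK : IsCompact (closedBall s₀ (r/2) ×ˢ Set.uIcc 0 T) :=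
    (isCompact_closedBall _ _).prod isCompact_uIcc
  obtain ⟨M, hM⟩ := hK.exists_bound_of_continuousOn (hF'.mono (Set.prod_mono hsub (Set.subset_univ _)))
  have hF's : Continuous (F' s₀) := by
    rw [← continuousOn_univ]
    exact hF'.comp (f := fun t => (s₀, t)) (by fun_prop) (fun t _ => ⟨hs, trivial⟩)
  refine (intervalIntegral.hasDerivAt_integral_of_dominated_loc_of_deriv_le
    (F := F) (F' := F') (bound := fun _ => M)
    (closedBall_mem_nhds s₀ (by linarith : 0 < r/2)) ?_ ?_ ?_ ?_ ?_ ?_).2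
  · filter_upwards [hU.mem_nhds hs] with s h
    exact (hF s h).aestronglyMeasurable
  · exact (hF s₀ hs).intervalIntegrable _ _
  · exact hF's.aestronglyMeasurable
  · refine Eventually.of_forall fun t ht s hs' => hM (s, t) ⟨hs', Set.uIoc_subset_uIcc ht⟩
  · simp
  · exact Eventually.of_forall fun t _ s hs' => hd s (hsub hs') t

section Strip

/-- Partial derivative in the first variable on the strip. -/
abbrev Ds (f : ℝ × ℝ → ℝ) : ℝ × ℝ → ℝ := dd ((1 : ℝ), (0 : ℝ)) f

/-- Partial derivative in the second variable on the strip. -/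
abbrev Dt (f : ℝ × ℝ → ℝ) : ℝ × ℝ → ℝ := dd ((0 : ℝ), (1 : ℝ)) f

theorem hasDerivAt_Ds {f : ℝ × ℝ → ℝ} (hf : ContDiff ℝ ∞ f) (s t : ℝ) :
    HasDerivAt (fun s => f (s, t)) (Ds f (s, t)) s := by
  have h2 := (smooth_differentiable hf (s, t)).hasFDerivAt
  have h1 : HasDerivAt (fun s : ℝ => (s, t)) ((1 : ℝ), (0 : ℝ)) s :=
    (hasDerivAt_id s).prodMk (hasDerivAt_const s t)
  exact h2.comp_hasDerivAt s h1

theorem hasDerivAt_Dt {f : ℝ × ℝ → ℝ} (hf : ContDiff ℝ ∞ f) (s t : ℝ) :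
    HasDerivAt (fun t => f (s, t)) (Dt f (s, t)) t := by
  have h2 := (smooth_differentiable hf (s, t)).hasFDerivAt
  have h1 : HasDerivAt (fun t : ℝ => (s, t)) ((0 : ℝ), (1 : ℝ)) t :=
    (hasDerivAt_const t s).prodMk (hasDerivAt_id t)
  exact h2.comp_hasDerivAt t h1

theorem integral_eq_zero_of_hasDerivAt_periodic {G G' : ℝ → ℝ} {T : ℝ}
    (h : ∀ t, HasDerivAt G (G' t) t) (hc : Continuous G') (hp : G T = G 0) :
    ∫ t in (0:ℝ)..T, G' t = 0 := by
  rw [intervalIntegral.integral_eq_sub_of_hasDerivAt (fun t _ => h t) (hc.intervalIntegrable _ _),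
    hp, sub_self]

theorem sq_integral_le {f : ℝ → ℝ} (hf : Continuous f) {T : ℝ} (hT : 0 < T) :
    (∫ t in (0:ℝ)..T, f t) ^ 2 ≤ T * ∫ t in (0:ℝ)..T, f t ^ 2 := by
  set m := (∫ t in (0:ℝ)..T, f t) / T with hm
  have h0 : 0 ≤ ∫ t in (0:ℝ)..T, (f t - m) ^ 2 :=
    intervalIntegral.integral_nonneg hT.le (fun t _ => sq_nonneg _)
  have h1 : ∫ t in (0:ℝ)..T, (f t - m) ^ 2
      = (∫ t in (0:ℝ)..T, f t ^ 2) - 2 * m * (∫ t in (0:ℝ)..T, f t) + T * m ^ 2 := by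
    have : ∀ t, (f t - m) ^ 2 = f t ^ 2 - 2 * m * f t + m ^ 2 := fun t => by ring
    simp_rw [this]
    rw [intervalIntegral.integral_add, intervalIntegral.integral_sub,
      intervalIntegral.integral_const_mul]
    · simp
    all_goals exact Continuous.intervalIntegrable (by fun_prop) _ _
  rw [h1] at h0
  have h2 : ∫ t in (0:ℝ)..T, f t = m * T := by rw [hm]; field_simp
  rw [h2] at h0 ⊢
  nlinarith

/-- A travelling wave written in logarithmic polar coordinates. -/
structure StripSol (c : ℝ) (a b : ℝ × ℝ → ℝ) : Prop where
  smooth_a : ContDiff ℝ ∞ a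
  smooth_b : ContDiff ℝ ∞ b
  per_a : ∀ s t, a (s, t + 2 * Real.pi) = a (s, t)
  per_b : ∀ s t, b (s, t + 2 * Real.pi) = b (s, t)
  eq_a : ∀ s t, Ds (Ds a) (s, t) + Dt (Dt a) (s, t) =
    c * Real.exp s * (Real.sin t * Ds b (s, t) + Real.cos t * Dt b (s, t))
      - Real.exp s ^ 2 * (1 - (a (s, t) ^ 2 + b (s, t) ^ 2)) * a (s, t)
  eq_b : ∀ s t, Ds (Ds b) (s, t) + Dt (Dt b) (s, t) =
    -(c * Real.exp s * (Real.sin t * Ds a (s, t) + Real.cos t * Dt a (s, t)))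
      - Real.exp s ^ 2 * (1 - (a (s, t) ^ 2 + b (s, t) ^ 2)) * b (s, t)
  bound : ∃ M, ∀ s ≤ 0, ∀ t, |a (s, t)| ≤ M ∧ |b (s, t)| ≤ M ∧
    |Ds a (s, t)| ≤ M * Real.exp s ∧ |Dt a (s, t)| ≤ M * Real.exp s ∧
    |Ds b (s, t)| ≤ M * Real.exp s ∧ |Dt b (s, t)| ≤ M * Real.exp s

variable (a b : ℝ × ℝ → ℝ)

/-- `1 - |g|²`. -/
def sW (x : ℝ × ℝ) : ℝ := 1 - (a x ^ 2 + b x ^ 2)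

/-- Energy density on the strip. -/
def sE (x : ℝ × ℝ) : ℝ :=
  1 / 2 * (Ds a x ^ 2 + Ds b x ^ 2 + Dt a x ^ 2 + Dt b x ^ 2)
    + 1 / 4 * Real.exp x.1 ^ 2 * sW a b x ^ 2

/-- Radial component of the stress tensor on the strip. -/
def sA (x : ℝ × ℝ) : ℝ :=
  1 / 2 * (Dt a x ^ 2 + Dt b x ^ 2) - 1 / 2 * (Ds a x ^ 2 + Ds b x ^ 2)
    + 1 / 4 * Real.exp x.1 ^ 2 * sW a b x ^ 2

/-- Circle energy. -/
def circE (s : ℝ) : ℝ := ∫ t in (0:ℝ)..2 * Real.pi, sE a b (s, t)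

/-- Circle integral of the stress tensor. -/
def circA (s : ℝ) : ℝ := ∫ t in (0:ℝ)..2 * Real.pi, sA a b (s, t)

/-- Circle integral of the potential. -/
def circV (s : ℝ) : ℝ := ∫ t in (0:ℝ)..2 * Real.pi, 1 / 2 * Real.exp s ^ 2 * sW a b (s, t) ^ 2

/-- Winding number density. -/
def sPsi (x : ℝ × ℝ) : ℝ := (a x * Dt b x - b x * Dt a x) / (a x ^ 2 + b x ^ 2)

/-- Radial derivative of the phase. -/
def sChi (x : ℝ × ℝ) : ℝ := (a x * Ds b x - b x * Ds a x) / (a x ^ 2 + b x ^ 2)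

/-- The total phase increment along a circle. -/
def circWind (s : ℝ) : ℝ := ∫ t in (0:ℝ)..2 * Real.pi, sPsi a b (s, t)

/-- Radial flux density. -/
def sF (c : ℝ) (x : ℝ × ℝ) : ℝ :=
  a x * Ds b x - b x * Ds a x - c / 2 * Real.exp x.1 * sW a b x * Real.sin x.2

/-- Angular flux density. -/
def sG (c : ℝ) (x : ℝ × ℝ) : ℝ :=
  a x * Dt b x - b x * Dt a x - c / 2 * Real.exp x.1 * sW a b x * Real.cos x.2

variable {a b} {c : ℝ}

theorem continuous_sE (ha : ContDiff ℝ ∞ a) (hb : ContDiff ℝ ∞ b) : Continuous (sE a b) := by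
  have := ha.continuous
  have := hb.continuous
  have := (contDiff_dd (v := ((1:ℝ),(0:ℝ))) ha).continuous
  have := (contDiff_dd (v := ((1:ℝ),(0:ℝ))) hb).continuous
  have := (contDiff_dd (v := ((0:ℝ),(1:ℝ))) ha).continuous
  have := (contDiff_dd (v := ((0:ℝ),(1:ℝ))) hb).continuous
  unfold sE sW
  fun_prop

theorem continuous_circE (ha : ContDiff ℝ ∞ a) (hb : ContDiff ℝ ∞ b) : Continuous (circE a b) := by
  have := continuous_sE ha hb
  unfold circE
  exact intervalIntegral.continuous_parametric_intervalIntegral_of_continuous' (by fun_prop) _ _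

theorem continuous_circV (ha : ContDiff ℝ ∞ a) (hb : ContDiff ℝ ∞ b) : Continuous (circV a b) := by
  have := ha.continuous
  have := hb.continuous
  unfold circV sW
  exact intervalIntegral.continuous_parametric_intervalIntegral_of_continuous' (by fun_prop) _ _

theorem sE_nonneg (x : ℝ × ℝ) : 0 ≤ sE a b x := by unfold sE; positivity

theorem circE_nonneg (s : ℝ) : 0 ≤ circE a b s :=
  intervalIntegral.integral_nonneg (by positivity) fun _ _ => sE_nonneg _

theorem dd_periodic {f : ℝ × ℝ → ℝ} {v : ℝ × ℝ} {T : ℝ} (h : ∀ s t, f (s, t + T) = f (s, t))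
    (s t : ℝ) : dd v f (s, t + T) = dd v f (s, t) := by
  have h1 : (fun x : ℝ × ℝ => f (x + (0, T))) = f := by
    funext ⟨s, t⟩; simpa using h s t
  have h2 := fderiv_comp_add_right (𝕜 := ℝ) (f := f) (x := (s, t)) ((0, T) : ℝ × ℝ)
  rw [h1] at h2
  simp [dd, h2]

theorem StripSol.circA_deriv (h : StripSol c a b) (s : ℝ) :
    ∃ k, HasDerivAt (circA a b) (circV a b s + c * k) s ∧ |k| ≤ Real.exp s * circE a b s := by
  have ha := h.smooth_a
  have hb := h.smooth_b
  have ha1 : ContDiff ℝ ∞ (Ds a) := contDiff_dd ha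
  have hb1 : ContDiff ℝ ∞ (Ds b) := contDiff_dd hb
  have ha2 : ContDiff ℝ ∞ (Dt a) := contDiff_dd ha
  have hb2 : ContDiff ℝ ∞ (Dt b) := contDiff_dd hb
  have ha21 : ContDiff ℝ ∞ (Ds (Dt a)) := contDiff_dd ha2
  have hb21 : ContDiff ℝ ∞ (Ds (Dt b)) := contDiff_dd hb2
  have ha11 : ContDiff ℝ ∞ (Ds (Ds a)) := contDiff_dd ha1
  have hb11 : ContDiff ℝ ∞ (Ds (Ds b)) := contDiff_dd hb1
  have ha22 : ContDiff ℝ ∞ (Dt (Dt a)) := contDiff_dd ha2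
  have hb22 : ContDiff ℝ ∞ (Dt (Dt b)) := contDiff_dd hb2
  have hca : Dt (Ds a) = Ds (Dt a) := dd_comm ha
  have hcb : Dt (Ds b) = Ds (Dt b) := dd_comm hb
  have ca := ha.continuous
  have cb := hb.continuous
  have ca1 := ha1.continuous
  have cb1 := hb1.continuous
  have ca2 := ha2.continuous
  have cb2 := hb2.continuous
  have ca11 := ha11.continuous
  have cb11 := hb11.continuous
  have ca22 := ha22.continuous
  have cb22 := hb22.continuous
  have ca21 := ha21.continuous
  have cb21 := hb21.continuous
  set A' : ℝ × ℝ → ℝ := fun x => Dt a x * Ds (Dt a) x + Dt b x * Ds (Dt b) x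
    - (Ds a x * Ds (Ds a) x + Ds b x * Ds (Ds b) x)
    + 1 / 2 * Real.exp x.1 ^ 2 * sW a b x ^ 2
    - Real.exp x.1 ^ 2 * sW a b x * (a x * Ds a x + b x * Ds b x) with hA'
  have h1 : HasDerivAt (circA a b) (∫ t in (0:ℝ)..2 * Real.pi, A' (s, t)) s := by
    refine hasDerivAt_integral_period (F := fun s t => sA a b (s, t))
      (F' := fun s t => A' (s, t)) isOpen_univ (Set.mem_univ s) ?_ ?_ ?_ _
    · intro s _; unfold sA sW; fun_prop
    · refine Continuous.continuousOn ?_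
      unfold Function.uncurry
      simp only [hA', sW]; fun_prop
    · intro s _ t
      unfold sA sW
      have e1 := (((hasDerivAt_Ds ha2 s t).pow 2).add ((hasDerivAt_Ds hb2 s t).pow 2)).const_mul (1/2)
      have e2 := (((hasDerivAt_Ds ha1 s t).pow 2).add ((hasDerivAt_Ds hb1 s t).pow 2)).const_mul (1/2)
      have e3 := (((hasDerivAt_Ds ha s t).pow 2).add ((hasDerivAt_Ds hb s t).pow 2)).const_sub 1
      have e4 := (((Real.hasDerivAt_exp s).pow 2).const_mul (1/4)).mul (e3.pow 2)
      refine ((e1.sub e2).add e4).congr_deriv ?_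
      simp only [hA', sW, Pi.pow_apply, Pi.add_apply]
      ring
  set k : ℝ → ℝ := fun t => -(Real.exp s * Real.cos t * (Ds a (s,t) * Dt b (s,t) - Ds b (s,t) * Dt a (s,t)))
    with hk
  have ck : Continuous k := by simp only [hk]; fun_prop
  set G' : ℝ → ℝ := fun t => Ds (Dt a) (s, t) * Dt a (s, t) + Ds a (s, t) * Dt (Dt a) (s, t)
    + (Ds (Dt b) (s, t) * Dt b (s, t) + Ds b (s, t) * Dt (Dt b) (s, t)) with hG'
  have hG : ∫ t in (0:ℝ)..2 * Real.pi, G' t = 0 := by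
    refine integral_eq_zero_of_hasDerivAt_periodic
      (G := fun t => Ds a (s, t) * Dt a (s, t) + Ds b (s, t) * Dt b (s, t)) ?_ ?_ ?_
    · intro t
      have := ((hasDerivAt_Dt ha1 s t).mul (hasDerivAt_Dt ha2 s t)).add
        ((hasDerivAt_Dt hb1 s t).mul (hasDerivAt_Dt hb2 s t))
      rw [hca, hcb] at this
      exact this
    · simp only [hG']; fun_prop
    · have p := fun v => dd_periodic (v := v) h.per_a s 0
      have q := fun v => dd_periodic (v := v) h.per_b s 0
      simp only [zero_add] at p q
      simp [p, q]
  have key : ∀ t, A' (s, t) = G' t + (1 / 2 * Real.exp s ^ 2 * sW a b (s, t) ^ 2 + c * k t) := by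
    intro t
    have e1 := h.eq_a s t
    have e2 := h.eq_b s t
    simp only [hA', hG', hk, sW]
    linear_combination (-Ds a (s,t)) * e1 - (Ds b (s,t)) * e2
  have hkey : ∫ t in (0:ℝ)..2 * Real.pi, A' (s, t)
      = circV a b s + c * ∫ t in (0:ℝ)..2 * Real.pi, k t := by
    simp_rw [key]
    rw [intervalIntegral.integral_add, hG, intervalIntegral.integral_add,
      intervalIntegral.integral_const_mul c, zero_add]
    · rfl
    all_goals
      refine Continuous.intervalIntegrable ?_ _ _
      try simp only [hG', sW]
      fun_prop
  refine ⟨∫ t in (0:ℝ)..2 * Real.pi, k t, hkey ▸ h1, ?_⟩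
  have hE := continuous_sE ha hb
  unfold circE
  rw [← intervalIntegral.integral_const_mul]
  refine (intervalIntegral.abs_integral_le_integral_abs (by positivity)).trans ?_
  refine intervalIntegral.integral_mono_on (by positivity) (ck.abs.intervalIntegrable _ _)
    (Continuous.intervalIntegrable (by fun_prop) _ _) ?_
  intro t _
  simp only [hk, abs_neg, abs_mul, Real.abs_exp, mul_assoc]
  refine mul_le_mul_of_nonneg_left ?_ (Real.exp_pos s).le
  have : |Real.cos t| ≤ 1 := Real.abs_cos_le_one t
  refine (mul_le_of_le_one_left (abs_nonneg _) this).trans ?_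
  have h4 : 0 ≤ 1 / 4 * Real.exp s ^ 2 * sW a b (s, t) ^ 2 := by positivity
  unfold sE
  rw [abs_le]
  constructor <;>
  nlinarith [sq_nonneg (Ds a (s,t) + Dt b (s,t)), sq_nonneg (Ds a (s,t) - Dt b (s,t)),
    sq_nonneg (Ds b (s,t) + Dt a (s,t)), sq_nonneg (Ds b (s,t) - Dt a (s,t))]

end Strip

section Strip

variable {a b : ℝ × ℝ → ℝ} {c : ℝ}

theorem StripSol.pohozaev (h : StripSol c a b) (hc : 0 ≤ c) {S' S E : ℝ} (hS : S' ≤ S)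
    (hE : ∫ s in S'..S, circE a b s ≤ E) :
    |circA a b S - circA a b S' - ∫ s in S'..S, circV a b s| ≤ c * Real.exp S * E := by
  have cE := continuous_circE h.smooth_a h.smooth_b
  have cV := continuous_circV h.smooth_a h.smooth_b
  choose k hk hk' using h.circA_deriv
  have dV : ∀ s, HasDerivAt (fun s => ∫ x in S'..s, circV a b x) (circV a b s) s := fun s =>
    cV.integral_hasStrictDerivAt S' s |>.hasDerivAt
  have dE : ∀ s, HasDerivAt (fun s => ∫ x in S'..s, circE a b x) (circE a b s) s := fun s =>
    cE.integral_hasStrictDerivAt S' s |>.hasDerivAt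
  have key : ∀ σ : ℝ, |σ| ≤ 1 →
      σ * (circA a b S - circA a b S' - ∫ s in S'..S, circV a b s) ≤ c * Real.exp S * E := by
    intro σ hσ
    set Φ : ℝ → ℝ := fun s => σ * (circA a b s - circA a b S' - ∫ x in S'..s, circV a b x)
      - c * Real.exp S * ∫ x in S'..s, circE a b x with hΦ
    have dΦ : ∀ s, HasDerivAt Φ (σ * (c * k s) - c * Real.exp S * circE a b s) s := by
      intro s
      refine (((((hk s).sub_const _).sub (dV s)).const_mul σ).sub ((dE s).const_mul _)).congr_deriv ?_
      ring
    have anti : AntitoneOn Φ (Set.Icc S' S) := by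
      refine antitoneOn_of_deriv_nonpos (convex_Icc _ _)
        (fun s _ => (dΦ s).continuousAt.continuousWithinAt)
        (fun s _ => (dΦ s).differentiableAt.differentiableWithinAt) ?_
      intro s hs
      rw [interior_Icc] at hs
      rw [(dΦ s).deriv]
      have h1 : |σ * (c * k s)| ≤ c * (Real.exp S * circE a b s) := by
        rw [abs_mul, abs_mul, abs_of_nonneg hc]
        have h2 : c * |k s| ≤ c * (Real.exp S * circE a b s) := by
          refine mul_le_mul_of_nonneg_left ((hk' s).trans ?_) hc
          exact mul_le_mul_of_nonneg_right (Real.exp_le_exp.2 hs.2.le) (circE_nonneg s)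
        exact (mul_le_of_le_one_left (by positivity) hσ).trans h2
      linarith [le_abs_self (σ * (c * k s))]
    have := anti (Set.left_mem_Icc.2 hS) (Set.right_mem_Icc.2 hS) hS
    simp only [hΦ, intervalIntegral.integral_same, sub_self, mul_zero] at this
    have h3 : c * Real.exp S * ∫ x in S'..S, circE a b x ≤ c * Real.exp S * E :=
      mul_le_mul_of_nonneg_left hE (by positivity)
    linarith
  rw [abs_le]
  constructor
  · linarith [key (-1) (by simp)]
  · linarith [key 1 (by simp)]

theorem StripSol.tendsto_circA (h : StripSol c a b) : Tendsto (circA a b) atBot (𝓝 0) := by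
  obtain ⟨M, hM⟩ := h.bound
  have lim : Tendsto (fun s : ℝ => 2 * Real.pi * ((2 * M ^ 2 + (1 + 2 * M ^ 2) ^ 2) * (Real.exp s * Real.exp s)))
      atBot (𝓝 0) := by
    have := ((Real.tendsto_exp_atBot.mul Real.tendsto_exp_atBot).const_mul
      (2 * M ^ 2 + (1 + 2 * M ^ 2) ^ 2)).const_mul (2 * Real.pi)
    simpa using this
  refine squeeze_zero_norm' ?_ lim
  filter_upwards [eventually_le_atBot 0] with s hs
  have : ∀ t ∈ Set.uIoc (0:ℝ) (2 * Real.pi), ‖sA a b (s, t)‖ ≤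
      (2 * M ^ 2 + (1 + 2 * M ^ 2) ^ 2) * (Real.exp s * Real.exp s) := by
    intro t _
    obtain ⟨h1, h2, h3, h4, h5, h6⟩ := hM s hs t
    have e1 := sq_le_sq' (by linarith [abs_le.1 h1]) (abs_le.1 h1).2
    have e2 := sq_le_sq' (by linarith [abs_le.1 h2]) (abs_le.1 h2).2
    have e3 := sq_le_sq' (by linarith [abs_le.1 h3]) (abs_le.1 h3).2
    have e4 := sq_le_sq' (by linarith [abs_le.1 h4]) (abs_le.1 h4).2
    have e5 := sq_le_sq' (by linarith [abs_le.1 h5]) (abs_le.1 h5).2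
    have e6 := sq_le_sq' (by linarith [abs_le.1 h6]) (abs_le.1 h6).2
    have e7 : sW a b (s, t) ^ 2 ≤ (1 + 2 * M ^ 2) ^ 2 := by
      refine sq_le_sq' ?_ ?_ <;> unfold sW <;> nlinarith [sq_nonneg (a (s,t)), sq_nonneg (b (s,t))]
    have e8 := mul_le_mul_of_nonneg_left e7 (sq_nonneg (Real.exp s))
    have e9 : 0 ≤ Real.exp s ^ 2 * sW a b (s, t) ^ 2 := by positivity
    rw [Real.norm_eq_abs, abs_le]
    unfold sA
    constructor <;> nlinarith [sq_nonneg (Ds a (s,t)), sq_nonneg (Ds b (s,t)),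
      sq_nonneg (Dt a (s,t)), sq_nonneg (Dt b (s,t))]
  have := intervalIntegral.norm_integral_le_of_norm_le_const this
  refine this.trans (le_of_eq ?_)
  rw [sub_zero, abs_of_pos (by positivity : (0:ℝ) < 2 * Real.pi)]
  ring

theorem smooth_continuous {f : ℝ × ℝ → ℝ} (hf : ContDiff ℝ ∞ f) :
    Continuous f ∧ Continuous (Ds f) ∧ Continuous (Dt f) ∧ Continuous (Ds (Ds f)) ∧
      Continuous (Ds (Dt f)) ∧ Continuous (Dt (Dt f)) :=
  ⟨hf.continuous, (contDiff_dd hf).continuous, (contDiff_dd hf).continuous,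
    (contDiff_dd (contDiff_dd hf)).continuous, (contDiff_dd (contDiff_dd hf)).continuous,
    (contDiff_dd (contDiff_dd hf)).continuous⟩

theorem dd_zero_periodic {f : ℝ × ℝ → ℝ} {T : ℝ} (h : ∀ s t, f (s, t + T) = f (s, t)) (s : ℝ) :
    f (s, T) = f (s, 0) ∧ Ds f (s, T) = Ds f (s, 0) ∧ Dt f (s, T) = Dt f (s, 0) := by
  have p := fun v => dd_periodic (v := v) h s 0
  have q := h s 0
  simp only [zero_add] at p q
  exact ⟨q, p _, p _⟩

/-- Conservation of the flux in divergence form. -/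
theorem StripSol.flux_deriv (h : StripSol c a b) (s t : ℝ) :
    ∃ y, HasDerivAt (fun s => sF a b c (s, t)) (-y) s ∧ HasDerivAt (fun t => sG a b c (s, t)) y t ∧
      y = a (s, t) * Dt (Dt b) (s, t) - b (s, t) * Dt (Dt a) (s, t)
        + c * Real.exp s * (a (s, t) * Dt a (s, t) + b (s, t) * Dt b (s, t)) * Real.cos t
        + c / 2 * Real.exp s * sW a b (s, t) * Real.sin t := by
  have ha := h.smooth_a
  have hb := h.smooth_b
  refine ⟨_, ?_, ?_, rfl⟩
  · have e1 := ((hasDerivAt_Ds ha s t).mul (hasDerivAt_Ds (contDiff_dd (v := ((1:ℝ),(0:ℝ))) hb) s t)).sub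
      ((hasDerivAt_Ds hb s t).mul (hasDerivAt_Ds (contDiff_dd (v := ((1:ℝ),(0:ℝ))) ha) s t))
    have e3 := (((hasDerivAt_Ds ha s t).pow 2).add ((hasDerivAt_Ds hb s t).pow 2)).const_sub 1
    have e4 := (((Real.hasDerivAt_exp s).const_mul (c/2)).mul e3).mul_const (Real.sin t)
    refine (e1.sub e4).congr_deriv ?_
    have q1 := h.eq_a s t
    have q2 := h.eq_b s t
    simp only [sW, Pi.pow_apply, Pi.add_apply]
    push_cast
    linear_combination a (s,t) * q2 - b (s,t) * q1
  · have e1 := ((hasDerivAt_Dt ha s t).mul (hasDerivAt_Dt (contDiff_dd (v := ((0:ℝ),(1:ℝ))) hb) s t)).sub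
      ((hasDerivAt_Dt hb s t).mul (hasDerivAt_Dt (contDiff_dd (v := ((0:ℝ),(1:ℝ))) ha) s t))
    have e3 := (((hasDerivAt_Dt ha s t).pow 2).add ((hasDerivAt_Dt hb s t).pow 2)).const_sub 1
    have e4 := ((e3.const_mul (c / 2 * Real.exp s))).mul (Real.hasDerivAt_cos t)
    refine (e1.sub e4).congr_deriv ?_
    simp only [sW, Pi.pow_apply, Pi.add_apply]
    push_cast
    ring

theorem StripSol.flux_zero (h : StripSol c a b) (s : ℝ) :
    ∫ t in (0:ℝ)..2 * Real.pi, sF a b c (s, t) = 0 := by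
  have ha := h.smooth_a
  have hb := h.smooth_b
  obtain ⟨ca, ca1, ca2, ca11, ca21, ca22⟩ := smooth_continuous ha
  obtain ⟨cb, cb1, cb2, cb11, cb21, cb22⟩ := smooth_continuous hb
  choose y hF hG hy using h.flux_deriv
  have cy : Continuous (Function.uncurry y) := by
    unfold Function.uncurry
    simp only [hy, sW]
    fun_prop
  have d0 : ∀ s, HasDerivAt (fun s => ∫ t in (0:ℝ)..2 * Real.pi, sF a b c (s, t)) 0 s := by
    intro s
    have h1 := hasDerivAt_integral_period (F := fun s t => sF a b c (s, t))
      (F' := fun s t => -y s t) isOpen_univ (Set.mem_univ s)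
      (by intro s _; unfold sF sW; fun_prop) cy.neg.continuousOn (fun s _ t => hF s t) (2 * Real.pi)
    refine h1.congr_deriv ?_
    rw [intervalIntegral.integral_neg, neg_eq_zero]
    refine integral_eq_zero_of_hasDerivAt_periodic (fun t => hG s t) (cy.comp (by fun_prop : Continuous fun t : ℝ => (s, t))) ?_
    obtain ⟨p1, -, p3⟩ := dd_zero_periodic h.per_a s
    obtain ⟨q1, -, q3⟩ := dd_zero_periodic h.per_b s
    simp [sG, sW, p1, p3, q1, q3]
  have hconst : ∀ x, ∫ t in (0:ℝ)..2 * Real.pi, sF a b c (x, t) = ∫ t in (0:ℝ)..2 * Real.pi, sF a b c (s, t) := fun x =>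
    is_const_of_deriv_eq_zero (fun x => (d0 x).differentiableAt) (fun x => (d0 x).deriv) x s
  obtain ⟨M, hM⟩ := h.bound
  have lim : Tendsto (fun s : ℝ => 2 * Real.pi * ((2 * M ^ 2 + |c| / 2 * (1 + 2 * M ^ 2)) * Real.exp s))
      atBot (𝓝 0) := by
    have := (Real.tendsto_exp_atBot.const_mul
      (2 * M ^ 2 + |c| / 2 * (1 + 2 * M ^ 2))).const_mul (2 * Real.pi)
    simpa using this
  have lim0 : Tendsto (fun x => ∫ t in (0:ℝ)..2 * Real.pi, sF a b c (x, t)) atBot (𝓝 0) := by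
    refine squeeze_zero_norm' ?_ lim
    filter_upwards [eventually_le_atBot 0] with s hs
    have : ∀ t ∈ Set.uIoc (0:ℝ) (2 * Real.pi), ‖sF a b c (s, t)‖ ≤
        (2 * M ^ 2 + |c| / 2 * (1 + 2 * M ^ 2)) * Real.exp s := by
      intro t _
      obtain ⟨h1, h2, h3, h4, h5, h6⟩ := hM s hs t
      have hM0 : 0 ≤ M := (abs_nonneg _).trans h1
      have e1 := sq_le_sq' (by linarith [abs_le.1 h1]) (abs_le.1 h1).2
      have e2 := sq_le_sq' (by linarith [abs_le.1 h2]) (abs_le.1 h2).2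
      have e7 : |sW a b (s, t)| ≤ 1 + 2 * M ^ 2 := by
        rw [abs_le]; unfold sW
        constructor <;> nlinarith [sq_nonneg (a (s,t)), sq_nonneg (b (s,t))]
      have f1 : |a (s,t) * Ds b (s,t)| ≤ M * (M * Real.exp s) := by
        rw [abs_mul]; exact mul_le_mul h1 h5 (abs_nonneg _) hM0
      have f2 : |b (s,t) * Ds a (s,t)| ≤ M * (M * Real.exp s) := by
        rw [abs_mul]; exact mul_le_mul h2 h3 (abs_nonneg _) hM0
      have f3 : |c / 2 * Real.exp s * sW a b (s,t) * Real.sin t| ≤ |c| / 2 * (1 + 2 * M ^ 2) * Real.exp s := by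
        rw [abs_mul, abs_mul, abs_mul, abs_div, Real.abs_exp, abs_two]
        calc |c| / 2 * Real.exp s * |sW a b (s, t)| * |Real.sin t|
            ≤ |c| / 2 * Real.exp s * (1 + 2 * M ^ 2) * 1 := by
              gcongr
              exact Real.abs_sin_le_one t
          _ = _ := by ring
      unfold sF
      rw [Real.norm_eq_abs]
      refine (abs_sub _ _).trans ((add_le_add (abs_sub _ _) le_rfl).trans ?_)
      calc _ ≤ M * (M * Real.exp s) + M * (M * Real.exp s) + |c| / 2 * (1 + 2 * M ^ 2) * Real.exp s := by
            gcongr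
        _ = _ := by ring
    have := intervalIntegral.norm_integral_le_of_norm_le_const this
    refine this.trans (le_of_eq ?_)
    rw [sub_zero, abs_of_pos (by positivity : (0:ℝ) < 2 * Real.pi)]
    ring
  simp_rw [hconst] at lim0
  exact tendsto_nhds_unique tendsto_const_nhds lim0

end Strip

section Strip

variable {a b : ℝ × ℝ → ℝ} {c : ℝ}

/-- The common mixed derivative of the phase. -/
def sD (a b : ℝ × ℝ → ℝ) (x : ℝ × ℝ) : ℝ :=
  ((Ds a x * Dt b x + a x * Ds (Dt b) x - Ds b x * Dt a x - b x * Ds (Dt a) x) * (a x ^ 2 + b x ^ 2)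
    - (a x * Dt b x - b x * Dt a x) * (2 * a x * Ds a x + 2 * b x * Ds b x)) / (a x ^ 2 + b x ^ 2) ^ 2

theorem hasDerivAt_sPsi (ha : ContDiff ℝ ∞ a) (hb : ContDiff ℝ ∞ b) {s t : ℝ}
    (hn : a (s, t) ^ 2 + b (s, t) ^ 2 ≠ 0) :
    HasDerivAt (fun s => sPsi a b (s, t)) (sD a b (s, t)) s := by
  have e1 := ((hasDerivAt_Ds ha s t).mul (hasDerivAt_Ds (contDiff_dd (v := ((0:ℝ),(1:ℝ))) hb) s t)).sub
      ((hasDerivAt_Ds hb s t).mul (hasDerivAt_Ds (contDiff_dd (v := ((0:ℝ),(1:ℝ))) ha) s t))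
  have e3 := (((hasDerivAt_Ds ha s t).pow 2).add ((hasDerivAt_Ds hb s t).pow 2))
  refine (e1.div e3 hn).congr_deriv ?_
  unfold sD
  simp only [Pi.pow_apply, Pi.add_apply, Pi.mul_apply, Pi.sub_apply]
  congr 1
  ring

theorem hasDerivAt_sChi (ha : ContDiff ℝ ∞ a) (hb : ContDiff ℝ ∞ b) {s t : ℝ}
    (hn : a (s, t) ^ 2 + b (s, t) ^ 2 ≠ 0) :
    HasDerivAt (fun t => sChi a b (s, t)) (sD a b (s, t)) t := by
  have e1 := ((hasDerivAt_Dt ha s t).mul (hasDerivAt_Dt (contDiff_dd (v := ((1:ℝ),(0:ℝ))) hb) s t)).sub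
      ((hasDerivAt_Dt hb s t).mul (hasDerivAt_Dt (contDiff_dd (v := ((1:ℝ),(0:ℝ))) ha) s t))
  have e3 := (((hasDerivAt_Dt ha s t).pow 2).add ((hasDerivAt_Dt hb s t).pow 2))
  refine (e1.div e3 hn).congr_deriv ?_
  have hca : Dt (Ds a) = Ds (Dt a) := dd_comm ha
  have hcb : Dt (Ds b) = Ds (Dt b) := dd_comm hb
  unfold sD
  simp only [Pi.pow_apply, Pi.add_apply, Pi.mul_apply, Pi.sub_apply, hca, hcb]
  field_simp
  ring

theorem continuousOn_sD (ha : ContDiff ℝ ∞ a) (hb : ContDiff ℝ ∞ b) {K : Set (ℝ × ℝ)}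
    (hK : ∀ x ∈ K, a x ^ 2 + b x ^ 2 ≠ 0) : ContinuousOn (sD a b) K := by
  obtain ⟨ca, ca1, ca2, ca11, ca21, ca22⟩ := smooth_continuous ha
  obtain ⟨cb, cb1, cb2, cb11, cb21, cb22⟩ := smooth_continuous hb
  unfold sD
  refine ContinuousOn.div (by fun_prop) (by fun_prop) fun x hx => ?_
  have := hK x hx
  positivity

theorem continuousOn_sPsi (ha : ContDiff ℝ ∞ a) (hb : ContDiff ℝ ∞ b) {K : Set (ℝ × ℝ)}
    (hK : ∀ x ∈ K, a x ^ 2 + b x ^ 2 ≠ 0) : ContinuousOn (sPsi a b) K := by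
  obtain ⟨ca, ca1, ca2, ca11, ca21, ca22⟩ := smooth_continuous ha
  obtain ⟨cb, cb1, cb2, cb11, cb21, cb22⟩ := smooth_continuous hb
  unfold sPsi
  exact ContinuousOn.div (by fun_prop) (by fun_prop) hK

theorem continuousOn_sChi (ha : ContDiff ℝ ∞ a) (hb : ContDiff ℝ ∞ b) {K : Set (ℝ × ℝ)}
    (hK : ∀ x ∈ K, a x ^ 2 + b x ^ 2 ≠ 0) : ContinuousOn (sChi a b) K := by
  obtain ⟨ca, ca1, ca2, ca11, ca21, ca22⟩ := smooth_continuous ha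
  obtain ⟨cb, cb1, cb2, cb11, cb21, cb22⟩ := smooth_continuous hb
  unfold sChi
  exact ContinuousOn.div (by fun_prop) (by fun_prop) hK

theorem normSq_ge {x : ℝ × ℝ} {τ : ℝ} (h : |sW a b x| ≤ τ) :
    1 - τ ≤ a x ^ 2 + b x ^ 2 ∧ a x ^ 2 + b x ^ 2 ≤ 1 + τ := by
  have := abs_le.1 h
  unfold sW at this
  constructor <;> linarith

theorem continuous_section {f : ℝ × ℝ → ℝ} {s : ℝ} (h : ContinuousOn f ({s} ×ˢ Set.univ)) :
    Continuous fun t => f (s, t) := by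
  rw [← continuousOn_univ]
  exact h.comp (f := fun t => (s, t)) (by fun_prop) (fun t _ => ⟨rfl, trivial⟩)

/-- The winding number of a nonvanishing circle is an integer. -/
theorem cos_circWind (ha : ContDiff ℝ ∞ a) (hb : ContDiff ℝ ∞ b)
    (pa : ∀ s t, a (s, t + 2 * Real.pi) = a (s, t)) (pb : ∀ s t, b (s, t + 2 * Real.pi) = b (s, t))
    {s : ℝ} (hn : ∀ t, 0 < a (s, t) ^ 2 + b (s, t) ^ 2) : Real.cos (circWind a b s) = 1 := by
  have cpsi : Continuous fun t => sPsi a b (s, t) :=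
    continuous_section (continuousOn_sPsi ha hb (by rintro ⟨s', t⟩ ⟨h, -⟩; obtain rfl : s' = s := h; exact (hn t).ne'))
  set θ : ℝ → ℝ := fun t => ∫ x in (0:ℝ)..t, sPsi a b (s, x) with hθ
  have dθ : ∀ t, HasDerivAt θ (sPsi a b (s, t)) t := fun t =>
    (cpsi.integral_hasStrictDerivAt 0 t).hasDerivAt
  have key : ∀ f : ℝ → ℝ, (∀ t, HasDerivAt f (0:ℝ) t) → f (2 * Real.pi) = f 0 := fun f hf =>
    is_const_of_deriv_eq_zero (fun x => (hf x).differentiableAt) (fun x => (hf x).deriv) _ _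
  have d1 : ∀ t, HasDerivAt (fun t => (a (s,t) * Real.cos (θ t) + b (s,t) * Real.sin (θ t)) /
      Real.sqrt (a (s,t) ^ 2 + b (s,t) ^ 2)) 0 t := by
    intro t
    have e3 := (((hasDerivAt_Dt ha s t).pow 2).add ((hasDerivAt_Dt hb s t).pow 2)).sqrt (hn t).ne'
    have e1 := ((hasDerivAt_Dt ha s t).mul (dθ t).cos).add ((hasDerivAt_Dt hb s t).mul (dθ t).sin)
    refine (e1.div e3 (Real.sqrt_pos.2 (hn t)).ne').congr_deriv ?_
    have hs := Real.sq_sqrt (hn t).le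
    have hp := Real.sqrt_pos.2 (hn t)
    simp only [Pi.pow_apply, Pi.add_apply, Pi.mul_apply]
    set r := Real.sqrt (a (s,t) ^ 2 + b (s,t) ^ 2) with hr
    rw [div_eq_zero_iff]
    left
    unfold sPsi
    rw [← hs]
    field_simp
    rw [hs]
    ring
  have d2 : ∀ t, HasDerivAt (fun t => (b (s,t) * Real.cos (θ t) - a (s,t) * Real.sin (θ t)) /
      Real.sqrt (a (s,t) ^ 2 + b (s,t) ^ 2)) 0 t := by
    intro t
    have e3 := (((hasDerivAt_Dt ha s t).pow 2).add ((hasDerivAt_Dt hb s t).pow 2)).sqrt (hn t).ne'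
    have e1 := ((hasDerivAt_Dt hb s t).mul (dθ t).cos).sub ((hasDerivAt_Dt ha s t).mul (dθ t).sin)
    refine (e1.div e3 (Real.sqrt_pos.2 (hn t)).ne').congr_deriv ?_
    have hs := Real.sq_sqrt (hn t).le
    have hp := Real.sqrt_pos.2 (hn t)
    simp only [Pi.pow_apply, Pi.add_apply, Pi.mul_apply, Pi.sub_apply]
    set r := Real.sqrt (a (s,t) ^ 2 + b (s,t) ^ 2) with hr
    rw [div_eq_zero_iff]
    left
    unfold sPsi
    rw [← hs]
    field_simp
    rw [hs]
    ring
  have k1 := key _ d1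
  have k2 := key _ d2
  have p1 := pa s 0
  have q1 := pb s 0
  have hp := Real.sqrt_pos.2 (hn 0)
  rw [zero_add] at p1 q1
  have hθ0 : θ 0 = 0 := by simp [hθ]
  rw [p1, q1, div_left_inj' hp.ne', hθ0] at k1 k2
  simp only [Real.cos_zero, Real.sin_zero, mul_one, mul_zero, add_zero, sub_zero] at k1 k2
  change Real.cos (θ (2 * Real.pi)) = 1
  have : (a (s,0) ^ 2 + b (s,0) ^ 2) * Real.cos (θ (2 * Real.pi)) = (a (s,0) ^ 2 + b (s,0) ^ 2) * 1 := by
    linear_combination a (s,0) * k1 + b (s,0) * k2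
  exact mul_left_cancel₀ (hn 0).ne' this

theorem circWind_eq_zero_or (ha : ContDiff ℝ ∞ a) (hb : ContDiff ℝ ∞ b)
    (pa : ∀ s t, a (s, t + 2 * Real.pi) = a (s, t)) (pb : ∀ s t, b (s, t + 2 * Real.pi) = b (s, t))
    {s : ℝ} (hn : ∀ t, 0 < a (s, t) ^ 2 + b (s, t) ^ 2) :
    circWind a b s = 0 ∨ 2 * Real.pi ≤ |circWind a b s| := by
  by_cases h : 2 * Real.pi ≤ |circWind a b s|
  · exact Or.inr h
  · left
    have := abs_lt.1 (not_le.1 h)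
    exact (Real.cos_eq_one_iff_of_lt_of_lt this.1 this.2).1 (cos_circWind ha hb pa pb hn)

theorem circWind_const (ha : ContDiff ℝ ∞ a) (hb : ContDiff ℝ ∞ b)
    (pa : ∀ s t, a (s, t + 2 * Real.pi) = a (s, t)) (pb : ∀ s t, b (s, t + 2 * Real.pi) = b (s, t))
    {x y : ℝ} (hn : ∀ s ∈ Set.Ioo x y, ∀ t, 0 < a (s, t) ^ 2 + b (s, t) ^ 2) {s s' : ℝ}
    (hs : s ∈ Set.Ioo x y) (hs' : s' ∈ Set.Ioo x y) : circWind a b s = circWind a b s' := by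
  have d0 : ∀ s ∈ Set.Ioo x y, HasDerivAt (circWind a b) 0 s := by
    intro s hs
    have hc : ContinuousOn (sD a b) (Set.Ioo x y ×ˢ Set.univ) :=
      continuousOn_sD ha hb (by rintro ⟨s', t⟩ ⟨h, -⟩; exact (hn s' h t).ne')
    have h1 := hasDerivAt_integral_period (F := fun s t => sPsi a b (s, t))
      (F' := fun s t => sD a b (s, t)) isOpen_Ioo hs
      (fun s h => continuous_section (continuousOn_sPsi ha hb (by
        rintro ⟨s', t⟩ ⟨h', -⟩; obtain rfl : s' = s := h'; exact (hn s' h t).ne')))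
      hc (fun s h t => hasDerivAt_sPsi ha hb (hn s h t).ne') (2 * Real.pi)
    refine h1.congr_deriv ?_
    refine integral_eq_zero_of_hasDerivAt_periodic (G := fun t => sChi a b (s, t))
      (fun t => hasDerivAt_sChi ha hb (hn s hs t).ne')
      (continuous_section (hc.mono (by rintro ⟨s', t⟩ ⟨h', -⟩; obtain rfl : s' = s := h'; exact ⟨hs, trivial⟩))) ?_
    obtain ⟨p1, p2, -⟩ := dd_zero_periodic pa s
    obtain ⟨q1, q2, -⟩ := dd_zero_periodic pb s
    simp [sChi, p1, p2, q1, q2]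
  exact isOpen_Ioo.is_const_of_deriv_eq_zero isPreconnected_Ioo
    (fun s h => (d0 s h).differentiableAt.differentiableWithinAt) (fun s h => (d0 s h).deriv) hs hs'

/-- A circle with nonzero winding carries at least the vortex energy. -/
theorem circE_of_wind (ha : ContDiff ℝ ∞ a) (hb : ContDiff ℝ ∞ b) {s τ : ℝ} (hτ : τ < 1)
    (hw : ∀ t, |sW a b (s, t)| ≤ τ) (hwind : 2 * Real.pi ≤ |circWind a b s|) :
    (1 - τ) * Real.pi ≤ circE a b s ∧ 2 * (1 - τ) * Real.pi - circE a b s ≤ circA a b s := by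
  have hn : ∀ t, 0 < a (s, t) ^ 2 + b (s, t) ^ 2 := fun t => by linarith [(normSq_ge (hw t)).1]
  obtain ⟨ca, ca1, ca2, ca11, ca21, ca22⟩ := smooth_continuous ha
  obtain ⟨cb, cb1, cb2, cb11, cb21, cb22⟩ := smooth_continuous hb
  have cpsi : Continuous fun t => sPsi a b (s, t) :=
    continuous_section (continuousOn_sPsi ha hb (by rintro ⟨s', t⟩ ⟨h, -⟩; obtain rfl : s' = s := h; exact (hn t).ne'))
  have hpi := Real.pi_pos
  have h1 : 2 * Real.pi ≤ ∫ t in (0:ℝ)..2 * Real.pi, sPsi a b (s, t) ^ 2 := by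
    have := sq_integral_le cpsi (by positivity : 0 < 2 * Real.pi)
    have h2 : (2 * Real.pi) ^ 2 ≤ (circWind a b s) ^ 2 := by
      rw [← sq_abs (circWind a b s)]
      exact pow_le_pow_left₀ (by positivity) hwind 2
    unfold circWind at h2
    nlinarith
  have h3 : (1 - τ) * Real.pi ≤ ∫ t in (0:ℝ)..2 * Real.pi, 1 / 2 * (Dt a (s,t) ^ 2 + Dt b (s,t) ^ 2) := by
    have : ∫ t in (0:ℝ)..2 * Real.pi, (1 - τ) / 2 * sPsi a b (s, t) ^ 2 ≤
        ∫ t in (0:ℝ)..2 * Real.pi, 1 / 2 * (Dt a (s,t) ^ 2 + Dt b (s,t) ^ 2) := by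
      refine intervalIntegral.integral_mono_on (by positivity)
        (Continuous.intervalIntegrable (by fun_prop) _ _)
        (Continuous.intervalIntegrable (by fun_prop) _ _) fun t _ => ?_
      have hge := (normSq_ge (hw t)).1
      have e : sPsi a b (s, t) * (a (s, t) ^ 2 + b (s, t) ^ 2) = a (s,t) * Dt b (s,t) - b (s,t) * Dt a (s,t) := by
        unfold sPsi; field_simp [(hn t).ne']
      have e2 : (a (s, t) ^ 2 + b (s, t) ^ 2) * sPsi a b (s, t) ^ 2 ≤ Dt a (s,t) ^ 2 + Dt b (s,t) ^ 2 := by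
        have : (a (s, t) ^ 2 + b (s, t) ^ 2) * ((a (s, t) ^ 2 + b (s, t) ^ 2) * sPsi a b (s, t) ^ 2) ≤
          (a (s, t) ^ 2 + b (s, t) ^ 2) * (Dt a (s,t) ^ 2 + Dt b (s,t) ^ 2) := by
          calc _ = (sPsi a b (s, t) * (a (s, t) ^ 2 + b (s, t) ^ 2)) ^ 2 := by ring
            _ = (a (s,t) * Dt b (s,t) - b (s,t) * Dt a (s,t)) ^ 2 := by rw [e]
            _ ≤ _ := by nlinarith [sq_nonneg (a (s,t) * Dt a (s,t) + b (s,t) * Dt b (s,t))]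
        exact le_of_mul_le_mul_left this (hn t)
      nlinarith [sq_nonneg (sPsi a b (s,t))]
    rw [intervalIntegral.integral_const_mul] at this
    nlinarith
  have cE := continuous_sE ha hb
  have cA : Continuous fun t => sA a b (s, t) := by unfold sA sW; fun_prop
  constructor
  · refine h3.trans ?_
    refine intervalIntegral.integral_mono_on (by positivity)
        (Continuous.intervalIntegrable (by fun_prop) _ _)
        (Continuous.intervalIntegrable (by fun_prop) _ _) fun t _ => ?_
    unfold sE
    nlinarith [sq_nonneg (Ds a (s,t)), sq_nonneg (Ds b (s,t)), sq_nonneg (Real.exp s * sW a b (s,t))]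
  · have : 2 * ∫ t in (0:ℝ)..2 * Real.pi, 1 / 2 * (Dt a (s,t) ^ 2 + Dt b (s,t) ^ 2) ≤
        circA a b s + circE a b s := by
      unfold circA circE
      rw [← intervalIntegral.integral_const_mul, ← intervalIntegral.integral_add
        (cA.intervalIntegrable _ _) (Continuous.intervalIntegrable (by fun_prop) _ _)]
      refine intervalIntegral.integral_mono_on (by positivity)
        (Continuous.intervalIntegrable (by fun_prop) _ _)
        (Continuous.intervalIntegrable (by fun_prop) _ _) fun t _ => ?_
      unfold sE sA
      nlinarith [sq_nonneg (Real.exp s * sW a b (s,t))]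
    linarith

theorem circA_le_circE (ha : ContDiff ℝ ∞ a) (hb : ContDiff ℝ ∞ b) (s : ℝ) :
    circA a b s ≤ circE a b s := by
  obtain ⟨ca, ca1, ca2, -⟩ := smooth_continuous ha
  obtain ⟨cb, cb1, cb2, -⟩ := smooth_continuous hb
  have cE := continuous_sE ha hb
  have cA : Continuous fun t => sA a b (s, t) := by unfold sA sW; fun_prop
  refine intervalIntegral.integral_mono_on (by positivity) (cA.intervalIntegrable _ _)
    (Continuous.intervalIntegrable (by fun_prop) _ _) fun t _ => ?_
  unfold sE sA
  nlinarith [sq_nonneg (Ds a (s,t)), sq_nonneg (Ds b (s,t))]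

end Strip

section Strip

variable {a b : ℝ × ℝ → ℝ} {c : ℝ}

theorem virial_pointwise {n w X ψ χ r r' S C c N : ℝ} (hw : |w| ≤ 1 / 8) (hnw : w = 1 - n)
    (hc : 0 ≤ c) (hc' : c ≤ 1 / 30) (hS : |S| ≤ 1) (hC : |C| ≤ 1)
    (hN : n * N = n ^ 2 * (ψ ^ 2 + χ ^ 2) + (r ^ 2 + r' ^ 2)) :
    1 / 2 * N + 1 / 4 * X ^ 2 ≤ (n * ψ - c / 2 * X * C) * ψ + (n * χ - c / 2 * X * S) * χ
      + (4 * r ^ 2 + 4 * r' ^ 2) - 2 * w * N - 2 * c * X * (S * (n * χ) + C * (n * ψ))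
      + 2 * n * X ^ 2 := by
  obtain ⟨w1, w2⟩ := abs_le.1 hw
  have n1 : 7 / 8 ≤ n := by linarith
  have n2 : n ≤ 9 / 8 := by linarith
  have hN1 : n * (ψ ^ 2 + χ ^ 2) ≤ N := by
    have : n * (n * (ψ ^ 2 + χ ^ 2)) ≤ n * N := by nlinarith [sq_nonneg r, sq_nonneg r']
    exact le_of_mul_le_mul_left this (by linarith)
  have hN2 : N ≤ n * (ψ ^ 2 + χ ^ 2) + 4 * (r ^ 2 + r' ^ 2) := by
    have : n * N ≤ n * (n * (ψ ^ 2 + χ ^ 2) + 4 * (r ^ 2 + r' ^ 2)) := by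
      nlinarith [sq_nonneg r, sq_nonneg r', mul_nonneg (sub_nonneg.2 n1) (add_nonneg (sq_nonneg r) (sq_nonneg r'))]
    exact le_of_mul_le_mul_left this (by linarith)
  have hN0 : 7 / 8 * (ψ ^ 2 + χ ^ 2) ≤ N := by nlinarith [sq_nonneg ψ, sq_nonneg χ]
  have hNN : 0 ≤ N := by nlinarith [sq_nonneg ψ, sq_nonneg χ]
  have hwN : -(1 / 4 * N) ≤ - 2 * w * N := by nlinarith
  have hX1 : |X * (S * χ + C * ψ)| ≤ X ^ 2 + 1 / 2 * (ψ ^ 2 + χ ^ 2) := by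
    have S2 : S ^ 2 ≤ 1 := by rw [← sq_abs]; nlinarith [abs_nonneg S]
    have C2 : C ^ 2 ≤ 1 := by rw [← sq_abs]; nlinarith [abs_nonneg C]
    have e1 := mul_le_mul_of_nonneg_left S2 (sq_nonneg X)
    have e2 := mul_le_mul_of_nonneg_left C2 (sq_nonneg X)
    rw [abs_le]
    constructor <;> nlinarith [sq_nonneg (X * S + χ), sq_nonneg (X * S - χ), sq_nonneg (X * C - ψ),
      sq_nonneg (X * C + ψ)]
  have hk : 0 ≤ c * (1 / 2 + 2 * n) := by positivity
  have hk' : c * (1 / 2 + 2 * n) ≤ 1 / 10 := by nlinarith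
  have hX2 : c * (1 / 2 + 2 * n) * (X * (S * χ + C * ψ)) ≤ 1 / 10 * (X ^ 2 + 1 / 2 * (ψ ^ 2 + χ ^ 2)) := by
    calc _ ≤ c * (1 / 2 + 2 * n) * |X * (S * χ + C * ψ)| :=
          mul_le_mul_of_nonneg_left (le_abs_self _) hk
      _ ≤ 1 / 10 * |X * (S * χ + C * ψ)| := mul_le_mul_of_nonneg_right hk' (abs_nonneg _)
      _ ≤ _ := by linarith
  have hX3 : 7 / 4 * X ^ 2 ≤ 2 * n * X ^ 2 := by nlinarith [sq_nonneg X]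
  nlinarith [sq_nonneg X, sq_nonneg ψ, sq_nonneg χ]

theorem StripSol.virial_potential (h : StripSol c a b) (s : ℝ) :
    HasDerivAt (fun s => ∫ t in (0:ℝ)..2 * Real.pi,
        -2 * (sW a b (s, t) * (a (s,t) * Ds a (s,t) + b (s,t) * Ds b (s,t))))
      (∫ t in (0:ℝ)..2 * Real.pi, (4 * (a (s,t) * Ds a (s,t) + b (s,t) * Ds b (s,t)) ^ 2
        + 4 * (a (s,t) * Dt a (s,t) + b (s,t) * Dt b (s,t)) ^ 2
        - 2 * sW a b (s,t) * (Ds a (s,t) ^ 2 + Ds b (s,t) ^ 2 + Dt a (s,t) ^ 2 + Dt b (s,t) ^ 2)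
        - 2 * c * (Real.exp s * sW a b (s,t)) * (Real.sin t * (a (s,t) * Ds b (s,t) - b (s,t) * Ds a (s,t))
          + Real.cos t * (a (s,t) * Dt b (s,t) - b (s,t) * Dt a (s,t)))
        + 2 * (a (s,t) ^ 2 + b (s,t) ^ 2) * (Real.exp s * sW a b (s,t)) ^ 2)) s := by
  have ha := h.smooth_a
  have hb := h.smooth_b
  obtain ⟨ca, ca1, ca2, ca11, ca21, ca22⟩ := smooth_continuous ha
  obtain ⟨cb, cb1, cb2, cb11, cb21, cb22⟩ := smooth_continuous hb
  have cW : Continuous (sW a b) := by unfold sW; fun_prop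
  set Z' : ℝ → ℝ → ℝ := fun s t => 4 * (a (s,t) * Ds a (s,t) + b (s,t) * Ds b (s,t)) ^ 2
    - 2 * sW a b (s,t) * (Ds a (s,t) ^ 2 + Ds b (s,t) ^ 2 + a (s,t) * Ds (Ds a) (s,t) + b (s,t) * Ds (Ds b) (s,t))
    with hZ'
  have h1 := hasDerivAt_integral_period
    (F := fun s t => -2 * (sW a b (s, t) * (a (s,t) * Ds a (s,t) + b (s,t) * Ds b (s,t))))
    (F' := Z') isOpen_univ (Set.mem_univ s) (by intro s _; fun_prop)
    (by refine Continuous.continuousOn ?_; unfold Function.uncurry; simp only [hZ']; fun_prop)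
    (by
      intro s _ t
      have e1 := ((hasDerivAt_Ds ha s t).mul (hasDerivAt_Ds (contDiff_dd (v := ((1:ℝ),(0:ℝ))) ha) s t)).add
        ((hasDerivAt_Ds hb s t).mul (hasDerivAt_Ds (contDiff_dd (v := ((1:ℝ),(0:ℝ))) hb) s t))
      have e3 := (((hasDerivAt_Ds ha s t).pow 2).add ((hasDerivAt_Ds hb s t).pow 2)).const_sub 1
      refine ((e3.mul e1).const_mul (-2)).congr_deriv ?_
      simp only [hZ', sW, Pi.pow_apply, Pi.add_apply, Pi.mul_apply]
      push_cast
      ring) (2 * Real.pi)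
  refine h1.congr_deriv ?_
  set R' : ℝ → ℝ := fun t => - 2 * (a (s,t) * Dt a (s,t) + b (s,t) * Dt b (s,t)) ^ 2
    + sW a b (s,t) * (Dt a (s,t) ^ 2 + Dt b (s,t) ^ 2 + a (s,t) * Dt (Dt a) (s,t) + b (s,t) * Dt (Dt b) (s,t))
    with hR'
  have cR' : Continuous R' := by simp only [hR']; fun_prop
  have hR : ∫ t in (0:ℝ)..2 * Real.pi, R' t = 0 := by
    refine integral_eq_zero_of_hasDerivAt_periodic
      (G := fun t => sW a b (s, t) * (a (s,t) * Dt a (s,t) + b (s,t) * Dt b (s,t))) ?_ cR' ?_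
    · intro t
      have e1 := ((hasDerivAt_Dt ha s t).mul (hasDerivAt_Dt (contDiff_dd (v := ((0:ℝ),(1:ℝ))) ha) s t)).add
        ((hasDerivAt_Dt hb s t).mul (hasDerivAt_Dt (contDiff_dd (v := ((0:ℝ),(1:ℝ))) hb) s t))
      have e3 := (((hasDerivAt_Dt ha s t).pow 2).add ((hasDerivAt_Dt hb s t).pow 2)).const_sub 1
      refine (e3.mul e1).congr_deriv ?_
      simp only [hR', sW, Pi.pow_apply, Pi.add_apply, Pi.mul_apply]
      push_cast
      ring
    · obtain ⟨p1, -, p3⟩ := dd_zero_periodic h.per_a s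
      obtain ⟨q1, -, q3⟩ := dd_zero_periodic h.per_b s
      simp [sW, p1, p3, q1, q3]
  have e := intervalIntegral.integral_sub (μ := volume) (a := 0) (b := 2 * Real.pi) (f := Z' s)
    (g := fun t => 2 * R' t)
    (Continuous.intervalIntegrable (by simp only [hZ']; fun_prop) _ _)
    (Continuous.intervalIntegrable (by fun_prop) _ _)
  rw [intervalIntegral.integral_const_mul, hR, mul_zero, sub_zero] at e
  rw [← e]
  refine intervalIntegral.integral_congr fun t _ => ?_
  have q1 := h.eq_a s t
  have q2 := h.eq_b s t
  simp only [hZ', hR']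
  unfold sW
  linear_combination (-2 * (1 - (a (s,t) ^ 2 + b (s,t) ^ 2)) * a (s,t)) * q1
    + (-2 * (1 - (a (s,t) ^ 2 + b (s,t) ^ 2)) * b (s,t)) * q2

end Strip

section Strip

variable {a b : ℝ × ℝ → ℝ} {c : ℝ}

theorem continuous_sF (ha : ContDiff ℝ ∞ a) (hb : ContDiff ℝ ∞ b) :
    Continuous (sF a b c) ∧ Continuous (sG a b c) := by
  obtain ⟨ca, ca1, ca2, -⟩ := smooth_continuous ha
  obtain ⟨cb, cb1, cb2, -⟩ := smooth_continuous hb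
  exact ⟨by unfold sF sW; fun_prop, by unfold sG sW; fun_prop⟩

/-- The flux virial: pairing the conserved flux with a single-valued phase. -/
theorem StripSol.virial_flux (h : StripSol c a b) {x y : ℝ}
    (hw : ∀ s ∈ Set.Ioo x y, ∀ t, |sW a b (s, t)| ≤ 1 / 8)
    (hwind : ∀ s ∈ Set.Ioo x y, circWind a b s = 0) :
    ∃ Y : ℝ → ℝ, ∀ s ∈ Set.Ioo x y,
      HasDerivAt Y (∫ t in (0:ℝ)..2 * Real.pi,
        (sG a b c (s, t) * sPsi a b (s, t) + sF a b c (s, t) * sChi a b (s, t))) s ∧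
      |Y s| ≤ (∫ t in (0:ℝ)..2 * Real.pi, |sF a b c (s, t)|) *
        ∫ t in (0:ℝ)..2 * Real.pi, |sPsi a b (s, t)| := by
  have ha := h.smooth_a
  have hb := h.smooth_b
  obtain ⟨ca, ca1, ca2, ca11, ca21, ca22⟩ := smooth_continuous ha
  obtain ⟨cb, cb1, cb2, cb11, cb21, cb22⟩ := smooth_continuous hb
  have cW : Continuous (sW a b) := by unfold sW; fun_prop
  obtain ⟨cF, cG⟩ := continuous_sF (c := c) ha hb
  have hn : ∀ s ∈ Set.Ioo x y, ∀ t, 0 < a (s, t) ^ 2 + b (s, t) ^ 2 := fun s hs t => by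
    linarith [(normSq_ge (hw s hs t)).1]
  choose z hF hG hz using h.flux_deriv
  have cz : Continuous (Function.uncurry z) := by
    unfold Function.uncurry
    simp only [hz]
    fun_prop
  set P : ℝ × ℝ → ℝ := fun q => (a q * Dt b q - b q * Dt a q) / max (a q ^ 2 + b q ^ 2) (1 / 2) with hP
  have cP : Continuous P := by
    simp only [hP]
    exact Continuous.div (by fun_prop) (by fun_prop) fun q => (lt_max_of_lt_right (by norm_num)).ne'
  have hPψ : ∀ s ∈ Set.Ioo x y, ∀ t, P (s, t) = sPsi a b (s, t) := by
    intro s hs t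
    simp only [hP, sPsi]
    rw [max_eq_left]
    linarith [(normSq_ge (hw s hs t)).1]
  set φ : ℝ → ℝ → ℝ := fun s t => ∫ τ in (0:ℝ)..t, P (s, τ) with hφ
  have cφ : Continuous (Function.uncurry φ) := by
    have : Continuous fun q : ℝ × ℝ => ∫ τ in (0:ℝ)..q.2, P (q.1, τ) :=
      intervalIntegral.continuous_parametric_intervalIntegral_of_continuous
        (f := fun (q : ℝ × ℝ) τ => P (q.1, τ)) (by unfold Function.uncurry; fun_prop) continuous_snd
    exact this
  have cφs : ∀ s, Continuous (φ s) := fun s => cφ.comp (by fun_prop : Continuous fun t : ℝ => (s, t))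
  have cD : ContinuousOn (sD a b) (Set.Ioo x y ×ˢ Set.univ) :=
    continuousOn_sD ha hb (by rintro ⟨s', t⟩ ⟨h, -⟩; exact (hn s' h t).ne')
  have cχ : ContinuousOn (sChi a b) (Set.Ioo x y ×ˢ Set.univ) :=
    continuousOn_sChi ha hb (by rintro ⟨s', t⟩ ⟨h, -⟩; exact (hn s' h t).ne')
  have sec : ∀ {s}, s ∈ Set.Ioo x y → ({s} : Set ℝ) ×ˢ (Set.univ : Set ℝ) ⊆ Set.Ioo x y ×ˢ Set.univ := by
    rintro s hs ⟨s', t⟩ ⟨h', -⟩; obtain rfl : s' = s := h'; exact ⟨hs, trivial⟩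
  have dφs : ∀ s ∈ Set.Ioo x y, ∀ t, HasDerivAt (fun s => φ s t) (sChi a b (s, t) - sChi a b (s, 0)) s := by
    intro s hs t
    have h1 := hasDerivAt_integral_period (F := fun s t => sPsi a b (s, t))
      (F' := fun s t => sD a b (s, t)) isOpen_Ioo hs
      (fun s h => continuous_section (continuousOn_sPsi ha hb (by
        rintro ⟨s', t⟩ ⟨h', -⟩; obtain rfl : s' = s := h'; exact (hn s' h t).ne')))
      cD (fun s h t => hasDerivAt_sPsi ha hb (hn s h t).ne') t
    rw [intervalIntegral.integral_eq_sub_of_hasDerivAt (fun t _ => hasDerivAt_sChi ha hb (hn s hs t).ne')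
      ((continuous_section (cD.mono (sec hs))).intervalIntegrable _ _)] at h1
    refine h1.congr_of_eventuallyEq ?_
    filter_upwards [isOpen_Ioo.mem_nhds hs] with s' hs'
    exact intervalIntegral.integral_congr fun τ _ => hPψ s' hs' τ
  have dφt : ∀ s t, HasDerivAt (φ s) (P (s, t)) t := fun s t =>
    ((cP.comp (by fun_prop : Continuous fun t : ℝ => (s, t))).integral_hasStrictDerivAt 0 t).hasDerivAt
  have hφper : ∀ s ∈ Set.Ioo x y, φ s (2 * Real.pi) = 0 := by
    intro s hs
    rw [← hwind s hs]
    exact intervalIntegral.integral_congr fun τ _ => hPψ s hs τ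
  refine ⟨fun s => ∫ t in (0:ℝ)..2 * Real.pi, sF a b c (s, t) * φ s t, fun s hs => ⟨?_, ?_⟩⟩
  · have h1 := hasDerivAt_integral_period (F := fun s t => sF a b c (s, t) * φ s t)
      (F' := fun s t => -z s t * φ s t + sF a b c (s, t) * (sChi a b (s, t) - sChi a b (s, 0))) isOpen_Ioo hs
      (fun s _ => by have := cφs s; fun_prop)
      (by
        refine ContinuousOn.add (cz.neg.mul cφ).continuousOn (cF.continuousOn.mul (cχ.sub ?_))
        exact cχ.comp (f := fun q : ℝ × ℝ => (q.1, (0:ℝ))) (by fun_prop) (fun q hq => ⟨hq.1, trivial⟩))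
      (fun s hs t => (hF s t).mul (dφs s hs t)) (2 * Real.pi)
    refine h1.congr_deriv ?_
    have cψs : Continuous fun t => sPsi a b (s, t) :=
      continuous_section (continuousOn_sPsi ha hb (by
        rintro ⟨s', t⟩ ⟨h', -⟩; obtain rfl : s' = s := h'; exact (hn s' hs t).ne'))
    have cχs : Continuous fun t => sChi a b (s, t) := continuous_section (cχ.mono (sec hs))
    have czs : Continuous (z s) := cz.comp (by fun_prop : Continuous fun t : ℝ => (s, t))
    have cφ0 := cφs s
    have i1 : ∫ t in (0:ℝ)..2 * Real.pi, (z s t * φ s t + sG a b c (s, t) * sPsi a b (s, t)) = 0 := by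
      refine integral_eq_zero_of_hasDerivAt_periodic (G := fun t => sG a b c (s, t) * φ s t) ?_ (by fun_prop) ?_
      · intro t
        rw [← hPψ s hs t]
        exact (hG s t).mul (dφt s t)
      · rw [hφper s hs]; simp [hφ]
    have i2 : ∫ t in (0:ℝ)..2 * Real.pi, sChi a b (s, 0) * sF a b c (s, t) = 0 := by
      rw [intervalIntegral.integral_const_mul, h.flux_zero, mul_zero]
    have e : ∀ t, -z s t * φ s t + sF a b c (s, t) * (sChi a b (s, t) - sChi a b (s, 0)) =
      (sG a b c (s, t) * sPsi a b (s, t) + sF a b c (s, t) * sChi a b (s, t))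
        - (z s t * φ s t + sG a b c (s, t) * sPsi a b (s, t)) - sChi a b (s, 0) * sF a b c (s, t) := fun t => by ring
    simp_rw [e]
    rw [intervalIntegral.integral_sub, intervalIntegral.integral_sub, i1, i2, sub_zero, sub_zero]
    all_goals exact Continuous.intervalIntegrable (by fun_prop) _ _
  · have cψs : Continuous fun t => sPsi a b (s, t) :=
      continuous_section (continuousOn_sPsi ha hb (by
        rintro ⟨s', t⟩ ⟨h', -⟩; obtain rfl : s' = s := h'; exact (hn s' hs t).ne'))
    have cφ0 := cφs s
    rw [← intervalIntegral.integral_mul_const]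
    refine (intervalIntegral.abs_integral_le_integral_abs (by positivity)).trans ?_
    refine intervalIntegral.integral_mono_on (by positivity)
      (Continuous.intervalIntegrable (by fun_prop) _ _)
      (Continuous.intervalIntegrable (by fun_prop) _ _) fun t ht => ?_
    rw [abs_mul]
    refine mul_le_mul_of_nonneg_left ?_ (abs_nonneg _)
    have : φ s t = ∫ τ in (0:ℝ)..t, sPsi a b (s, τ) :=
      intervalIntegral.integral_congr fun τ _ => hPψ s hs τ
    rw [this]
    refine (intervalIntegral.abs_integral_le_integral_abs ht.1).trans ?_
    exact intervalIntegral.integral_mono_interval le_rfl ht.1 ht.2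
      (Eventually.of_forall fun _ => abs_nonneg _) (Continuous.intervalIntegrable (by fun_prop) _ _)

end Strip

section Strip

variable {a b : ℝ × ℝ → ℝ} {c : ℝ}

theorem phase_lagrange {x : ℝ × ℝ} (hn : 0 < a x ^ 2 + b x ^ 2) :
    a x * Dt b x - b x * Dt a x = (a x ^ 2 + b x ^ 2) * sPsi a b x ∧
    a x * Ds b x - b x * Ds a x = (a x ^ 2 + b x ^ 2) * sChi a b x := by
  unfold sPsi sChi
  constructor <;> field_simp

theorem flux_sq_le {x : ℝ × ℝ} (hw : |sW a b x| ≤ 1 / 8) (hc : 0 ≤ c) (hc' : c ≤ 1 / 30) :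
    sF a b c x ^ 2 ≤ 9 * sE a b x ∧ sPsi a b x ^ 2 ≤ 3 * sE a b x := by
  obtain ⟨n1, n2⟩ := normSq_ge hw
  have hn : 0 < a x ^ 2 + b x ^ 2 := by linarith
  obtain ⟨hP, hq⟩ := phase_lagrange hn
  set X := Real.exp x.1 * sW a b x with hX
  have hE : sE a b x = 1 / 2 * (Ds a x ^ 2 + Ds b x ^ 2 + Dt a x ^ 2 + Dt b x ^ 2) + 1 / 4 * X ^ 2 := by
    unfold sE; rw [hX]; ring
  constructor
  · have e1 : (a x * Ds b x - b x * Ds a x) ^ 2 ≤ 9 / 8 * (Ds a x ^ 2 + Ds b x ^ 2) := by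
      calc _ ≤ (a x ^ 2 + b x ^ 2) * (Ds a x ^ 2 + Ds b x ^ 2) := by
            nlinarith [sq_nonneg (a x * Ds a x + b x * Ds b x)]
        _ ≤ _ := by
            refine mul_le_mul_of_nonneg_right (by linarith) (by positivity)
    have e2 : (c / 2 * X * Real.sin x.2) ^ 2 ≤ X ^ 2 := by
      have s2 := Real.sin_sq_le_one x.2
      have c2 : (c / 2) ^ 2 ≤ 1 := by nlinarith
      have : (c / 2) ^ 2 * Real.sin x.2 ^ 2 ≤ 1 := by nlinarith [sq_nonneg (Real.sin x.2), sq_nonneg (c/2)]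
      calc _ = X ^ 2 * ((c / 2) ^ 2 * Real.sin x.2 ^ 2) := by ring
        _ ≤ X ^ 2 * 1 := mul_le_mul_of_nonneg_left this (sq_nonneg _)
        _ = _ := mul_one _
    have e3 : sF a b c x = (a x * Ds b x - b x * Ds a x) - c / 2 * X * Real.sin x.2 := by
      unfold sF; rw [hX]; ring
    rw [e3, hE]
    nlinarith [sq_nonneg ((a x * Ds b x - b x * Ds a x) + c / 2 * X * Real.sin x.2),
      sq_nonneg (Dt a x), sq_nonneg (Dt b x), sq_nonneg (Ds a x), sq_nonneg (Ds b x), sq_nonneg X]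
  · have e1 : (a x * Dt b x - b x * Dt a x) ^ 2 ≤ (a x ^ 2 + b x ^ 2) * (Dt a x ^ 2 + Dt b x ^ 2) := by
      nlinarith [sq_nonneg (a x * Dt a x + b x * Dt b x)]
    rw [hP, mul_pow, sq (a x ^ 2 + b x ^ 2), mul_assoc] at e1
    have e2 := le_of_mul_le_mul_left e1 hn
    rw [hE]
    nlinarith [sq_nonneg (Dt a x), sq_nonneg (Dt b x), sq_nonneg (Ds a x), sq_nonneg (Ds b x), sq_nonneg X,
      sq_nonneg (sPsi a b x)]

theorem StripSol.virial (h : StripSol c a b) (hc : 0 ≤ c) (hc' : c ≤ 1 / 30) {x y : ℝ}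
    (hw : ∀ s ∈ Set.Ioo x y, ∀ t, |sW a b (s, t)| ≤ 1 / 8)
    (hwind : ∀ s ∈ Set.Ioo x y, circWind a b s = 0) :
    ∃ W : ℝ → ℝ, ∀ s ∈ Set.Ioo x y, (∃ d, HasDerivAt W d s ∧ circE a b s ≤ d) ∧
      (0 ≤ s → |W s| ≤ 50 * circE a b s) := by
  have ha := h.smooth_a
  have hb := h.smooth_b
  obtain ⟨ca, ca1, ca2, ca11, ca21, ca22⟩ := smooth_continuous ha
  obtain ⟨cb, cb1, cb2, cb11, cb21, cb22⟩ := smooth_continuous hb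
  have cW : Continuous (sW a b) := by unfold sW; fun_prop
  have cE := continuous_sE ha hb
  obtain ⟨cF, cG⟩ := continuous_sF (c := c) ha hb
  have hn : ∀ s ∈ Set.Ioo x y, ∀ t, 0 < a (s, t) ^ 2 + b (s, t) ^ 2 := fun s hs t => by
    linarith [(normSq_ge (hw s hs t)).1]
  obtain ⟨Y, hY⟩ := h.virial_flux hw hwind
  refine ⟨fun s => Y s + ∫ t in (0:ℝ)..2 * Real.pi,
        -2 * (sW a b (s, t) * (a (s,t) * Ds a (s,t) + b (s,t) * Ds b (s,t))), fun s hs => ?_⟩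
  obtain ⟨hY1, hY2⟩ := hY s hs
  have cψs : Continuous fun t => sPsi a b (s, t) :=
    continuous_section (continuousOn_sPsi ha hb (by
      rintro ⟨s', t⟩ ⟨h', -⟩; obtain rfl : s' = s := h'; exact (hn s' hs t).ne'))
  have cχs : Continuous fun t => sChi a b (s, t) :=
    continuous_section (continuousOn_sChi ha hb (by
      rintro ⟨s', t⟩ ⟨h', -⟩; obtain rfl : s' = s := h'; exact (hn s' hs t).ne'))
  refine ⟨⟨_, hY1.add (h.virial_potential s), ?_⟩, fun hs0 => ?_⟩
  · rw [← intervalIntegral.integral_add (Continuous.intervalIntegrable (by fun_prop) _ _)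
      (Continuous.intervalIntegrable (by fun_prop) _ _)]
    refine intervalIntegral.integral_mono_on (by positivity)
      (Continuous.intervalIntegrable (by fun_prop) _ _)
      (Continuous.intervalIntegrable (by fun_prop) _ _) fun t _ => ?_
    obtain ⟨hP, hq⟩ := phase_lagrange (hn s hs t)
    have key := virial_pointwise (n := a (s,t) ^ 2 + b (s,t) ^ 2) (w := sW a b (s,t))
      (X := Real.exp s * sW a b (s,t)) (ψ := sPsi a b (s,t)) (χ := sChi a b (s,t))
      (r := a (s,t) * Ds a (s,t) + b (s,t) * Ds b (s,t))
      (r' := a (s,t) * Dt a (s,t) + b (s,t) * Dt b (s,t)) (S := Real.sin t) (C := Real.cos t) (c := c)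
      (N := Ds a (s,t) ^ 2 + Ds b (s,t) ^ 2 + Dt a (s,t) ^ 2 + Dt b (s,t) ^ 2)
      (hw s hs t) rfl hc hc' (Real.abs_sin_le_one t) (Real.abs_cos_le_one t) (by
        rw [mul_add (_ ^ 2), ← mul_pow, ← mul_pow, ← hP, ← hq]; ring)
    rw [← hP, ← hq] at key
    have hE : sE a b (s,t) = 1 / 2 * (Ds a (s,t) ^ 2 + Ds b (s,t) ^ 2 + Dt a (s,t) ^ 2 + Dt b (s,t) ^ 2)
        + 1 / 4 * (Real.exp s * sW a b (s,t)) ^ 2 := by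
      unfold sE; ring
    rw [hE]
    refine key.trans (le_of_eq ?_)
    unfold sF sG
    ring
  · have hpi := Real.pi_pos
    have hpi4 := Real.pi_lt_four
    have e1 := sq_integral_le (f := fun t => |sF a b c (s, t)|) (by fun_prop) (by positivity : 0 < 2 * Real.pi)
    have e2 := sq_integral_le (f := fun t => |sPsi a b (s, t)|) (by fun_prop) (by positivity : 0 < 2 * Real.pi)
    have e3 : ∫ t in (0:ℝ)..2 * Real.pi, |sF a b c (s, t)| ^ 2 ≤ 9 * circE a b s := by
      unfold circE
      rw [← intervalIntegral.integral_const_mul]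
      refine intervalIntegral.integral_mono_on (by positivity)
        (Continuous.intervalIntegrable (by fun_prop) _ _)
        (Continuous.intervalIntegrable (by fun_prop) _ _) fun t _ => ?_
      rw [sq_abs]
      exact (flux_sq_le (hw s hs t) hc hc').1
    have e4 : ∫ t in (0:ℝ)..2 * Real.pi, |sPsi a b (s, t)| ^ 2 ≤ 3 * circE a b s := by
      unfold circE
      rw [← intervalIntegral.integral_const_mul]
      refine intervalIntegral.integral_mono_on (by positivity)
        (Continuous.intervalIntegrable (by fun_prop) _ _)
        (Continuous.intervalIntegrable (by fun_prop) _ _) fun t _ => ?_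
      rw [sq_abs]
      exact (flux_sq_le (c := c) (hw s hs t) hc hc').2
    have e5 : |Y s| ≤ 12 * Real.pi * circE a b s := by
      refine hY2.trans ?_
      have := mul_le_mul_of_nonneg_left (add_le_add e3 e4) (by positivity : 0 ≤ Real.pi)
      nlinarith [sq_nonneg ((∫ t in (0:ℝ)..2 * Real.pi, |sF a b c (s, t)|) -
        ∫ t in (0:ℝ)..2 * Real.pi, |sPsi a b (s, t)|)]
    have e5' : |Y s| ≤ 39 * circE a b s := by
      refine e5.trans (mul_le_mul_of_nonneg_right ?_ (circE_nonneg s))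
      linarith [Real.pi_lt_d2]
    have e6 : |∫ t in (0:ℝ)..2 * Real.pi,
        -2 * (sW a b (s, t) * (a (s,t) * Ds a (s,t) + b (s,t) * Ds b (s,t)))| ≤ 7 * circE a b s := by
      unfold circE
      rw [← intervalIntegral.integral_const_mul]
      refine (intervalIntegral.abs_integral_le_integral_abs (by positivity)).trans ?_
      refine intervalIntegral.integral_mono_on (by positivity)
        (Continuous.intervalIntegrable (by fun_prop) _ _)
        (Continuous.intervalIntegrable (by fun_prop) _ _) fun t _ => ?_
      have f1 : (a (s,t) * Ds a (s,t) + b (s,t) * Ds b (s,t)) ^ 2 ≤ 9 / 8 * (Ds a (s,t) ^ 2 + Ds b (s,t) ^ 2) := by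
        calc _ ≤ (a (s,t) ^ 2 + b (s,t) ^ 2) * (Ds a (s,t) ^ 2 + Ds b (s,t) ^ 2) := by
              nlinarith [sq_nonneg (a (s,t) * Ds b (s,t) - b (s,t) * Ds a (s,t))]
          _ ≤ _ := mul_le_mul_of_nonneg_right (by linarith [(normSq_ge (hw s hs t)).2]) (by positivity)
      have f2 : sW a b (s,t) ^ 2 ≤ Real.exp s ^ 2 * sW a b (s,t) ^ 2 := by
        exact le_mul_of_one_le_left (sq_nonneg _) (one_le_pow₀ (Real.one_le_exp hs0))
      unfold sE
      rw [abs_le]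
      set r := a (s,t) * Ds a (s,t) + b (s,t) * Ds b (s,t)
      set w := sW a b (s,t)
      constructor <;> nlinarith [sq_nonneg (w + r), sq_nonneg (w - r), sq_nonneg (Dt a (s,t)), sq_nonneg (Dt b (s,t))]
    refine (abs_add_le _ _).trans ?_
    linarith [circE_nonneg (a := a) (b := b) s]

/-- Exponential decay of the circle energy in the middle of a window carrying no winding. -/
theorem StripSol.exists_small_circE (h : StripSol c a b) (hc : 0 ≤ c) (hc' : c ≤ 1 / 30) {x y E : ℝ}
    (hx : 0 ≤ x) (hxy : x < y)
    (hw : ∀ s ∈ Set.Ioo x y, ∀ t, |sW a b (s, t)| ≤ 1 / 8)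
    (hwind : ∀ s ∈ Set.Ioo x y, circWind a b s = 0) (hE : ∫ s in x..y, circE a b s ≤ E) :
    ∃ s ∈ Set.Ioo x y, circE a b s ≤ 2 / (y - x) * (E * Real.exp (-((y - x) / 200))) := by
  obtain ⟨W, hW⟩ := h.virial hc hc' hw hwind
  have cE := continuous_circE h.smooth_a h.smooth_b
  set m := (x + y) / 2 with hm
  set T := (y - x) / 2 with hT
  have hTp : 0 < T := by rw [hT]; linarith
  have hmx : m - T = x := by rw [hm, hT]; ring
  have hmy : m + T = y := by rw [hm, hT]; ring
  set e := circE a b with he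
  set J : ℝ → ℝ := fun t => ∫ s in (m - t)..(m + t), e s with hJ
  have dJ : ∀ t, HasDerivAt J (e (m + t) + e (m - t)) t := by
    intro t
    have h1 : HasDerivAt (fun t => ∫ s in (0:ℝ)..t, e s) (e (m + t)) (m + t) :=
      (cE.integral_hasStrictDerivAt 0 _).hasDerivAt
    have h2 : HasDerivAt (fun t => ∫ s in (0:ℝ)..t, e s) (e (m - t)) (m - t) :=
      (cE.integral_hasStrictDerivAt 0 _).hasDerivAt
    have h3 := (h1.comp t ((hasDerivAt_id t).const_add m)).sub (h2.comp t ((hasDerivAt_id t).const_sub m))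
    refine (h3.congr_deriv (by ring)).congr_of_eventuallyEq (Eventually.of_forall fun t => ?_)
    simp only [hJ, Pi.sub_apply, Function.comp]
    rw [intervalIntegral.integral_interval_sub_left (cE.intervalIntegrable _ _) (cE.intervalIntegrable _ _)]
  have hJW : ∀ t ∈ Set.Ioo 0 T, J t ≤ 50 * (e (m + t) + e (m - t)) := by
    intro t ht
    have h1 : Set.Icc (m - t) (m + t) ⊆ Set.Ioo x y := fun s hs =>
      ⟨by linarith [hs.1, ht.2], by linarith [hs.2, ht.2]⟩
    have i1 := h1 ⟨le_rfl, by linarith [ht.1]⟩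
    have i2 := h1 ⟨by linarith [ht.1], le_rfl⟩
    have mono : MonotoneOn (fun s => W s - ∫ r in (0:ℝ)..s, e r) (Set.Icc (m - t) (m + t)) := by
      have dd : ∀ s ∈ Set.Ioo x y, ∃ d, HasDerivAt (fun s => W s - ∫ r in (0:ℝ)..s, e r) d s ∧ 0 ≤ d := by
        intro s hs
        obtain ⟨⟨d, hd, hd'⟩, -⟩ := hW s hs
        exact ⟨_, hd.sub (cE.integral_hasStrictDerivAt 0 s).hasDerivAt, sub_nonneg.2 hd'⟩
      refine monotoneOn_of_deriv_nonneg (convex_Icc _ _) ?_ ?_ ?_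
      · intro s hs; obtain ⟨d, hd, -⟩ := dd s (h1 hs); exact hd.continuousAt.continuousWithinAt
      · intro s hs; obtain ⟨d, hd, -⟩ := dd s (h1 (interior_subset hs))
        exact hd.differentiableAt.differentiableWithinAt
      · intro s hs; obtain ⟨d, hd, hd'⟩ := dd s (h1 (interior_subset hs)); rw [hd.deriv]; exact hd'
    have h2 := mono ⟨le_rfl, by linarith [ht.1]⟩ ⟨by linarith [ht.1], le_rfl⟩ (by linarith [ht.1])
    have h3 : J t = (∫ r in (0:ℝ)..(m + t), e r) - ∫ r in (0:ℝ)..(m - t), e r := by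
      rw [intervalIntegral.integral_interval_sub_left (cE.intervalIntegrable _ _) (cE.intervalIntegrable _ _)]
    have h4 := abs_le.1 ((hW _ i1).2 (by linarith [i1.1]))
    have h5 := abs_le.1 ((hW _ i2).2 (by linarith [i2.1]))
    simp only at h2
    linarith [h4.1, h5.2]
  have mono : MonotoneOn (fun t => J t * Real.exp (-(t / 50))) (Set.Icc 0 T) := by
    have dd : ∀ t, HasDerivAt (fun t => J t * Real.exp (-(t / 50)))
        ((e (m + t) + e (m - t)) * Real.exp (-(t / 50)) + J t * (Real.exp (-(t / 50)) * (-(1 / 50)))) t := fun t =>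
      (dJ t).mul ((hasDerivAt_id t).div_const 50).neg.exp
    refine monotoneOn_of_deriv_nonneg (convex_Icc _ _)
      (fun t _ => (dd t).continuousAt.continuousWithinAt)
      (fun t _ => (dd t).differentiableAt.differentiableWithinAt) fun t ht => ?_
    rw [interior_Icc] at ht
    rw [(dd t).deriv]
    have := hJW t ht
    have hexp := Real.exp_pos (-(t / 50))
    nlinarith
  have h1 := mono (a := T / 2) (b := T) ⟨by linarith, by linarith⟩ ⟨hTp.le, le_rfl⟩ (by linarith)
  have h2 : J T ≤ E := by simp only [hJ]; rw [hmx, hmy]; exact hE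
  have h3 : J (T / 2) ≤ E * Real.exp (-((y - x) / 200)) := by
    have : J (T / 2) * Real.exp (-(T / 2 / 50)) ≤ E * Real.exp (-(T / 50)) :=
      h1.trans (mul_le_mul_of_nonneg_right h2 (Real.exp_pos _).le)
    have e1 : Real.exp (-(T / 50)) = Real.exp (-((y - x) / 200)) * Real.exp (-(T / 2 / 50)) := by
      rw [← Real.exp_add]; congr 1; rw [hT]; ring
    rw [e1, ← mul_assoc] at this
    exact le_of_mul_le_mul_right this (Real.exp_pos _)
  by_contra hcon
  push Not at hcon
  set B := 2 / (y - x) * (E * Real.exp (-((y - x) / 200))) with hB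
  have h4 : ∫ s in (m - T / 2)..(m + T / 2), B < ∫ s in (m - T / 2)..(m + T / 2), e s := by
    refine intervalIntegral.integral_lt_integral_of_continuousOn_of_le_of_exists_lt (by linarith)
      continuousOn_const cE.continuousOn (fun s hs => (hcon s ⟨by linarith [hs.1], by linarith [hs.2]⟩).le)
      ⟨m, ⟨by linarith, by linarith⟩, hcon m ⟨by linarith, by linarith⟩⟩
  rw [intervalIntegral.integral_const, smul_eq_mul] at h4
  have h5 : (m + T / 2 - (m - T / 2)) * B = E * Real.exp (-((y - x) / 200)) := by
    rw [hB, hT]; have : y - x ≠ 0 := by linarith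
    field_simp; ring
  rw [h5] at h4
  exact absurd h3 (not_le.2 h4)

end Strip

section Plane

/-- Polar coordinates with logarithmic radius, centred at `z`. -/
def polarMap (z : ℂ) (x : ℝ × ℝ) : ℂ :=
  z + Real.exp x.1 * (Real.cos x.2 + Real.sin x.2 * Complex.I)

theorem contDiff_polarMap (z : ℂ) : ContDiff ℝ ∞ (polarMap z) := by
  have h : ContDiff ℝ ∞ (fun r : ℝ => (r : ℂ)) := Complex.ofRealCLM.contDiff
  have h1 : ContDiff ℝ ∞ (fun x : ℝ × ℝ => Real.exp x.1) := Real.contDiff_exp.comp contDiff_fst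
  have h2 : ContDiff ℝ ∞ (fun x : ℝ × ℝ => Real.cos x.2) := Real.contDiff_cos.comp contDiff_snd
  have h3 : ContDiff ℝ ∞ (fun x : ℝ × ℝ => Real.sin x.2) := Real.contDiff_sin.comp contDiff_snd
  exact contDiff_const.add ((h.comp h1).mul ((h.comp h2).add ((h.comp h3).mul contDiff_const)))

theorem norm_polarMap_sub (z : ℂ) (s t : ℝ) : ‖polarMap z (s, t) - z‖ = Real.exp s := by
  unfold polarMap
  rw [add_sub_cancel_left, norm_mul, Complex.norm_real, Real.norm_eq_abs, Real.abs_exp]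
  have : ‖((Real.cos t : ℝ) : ℂ) + (Real.sin t : ℝ) * Complex.I‖ = 1 := by
    rw [Complex.ofReal_cos, Complex.ofReal_sin, ← Complex.exp_mul_I, Complex.norm_exp_ofReal_mul_I]
  simp only [this, mul_one]

theorem dd_vec (f : ℂ → ℝ) (v x : ℂ) : dd v f x = v.re * dd 1 f x + v.im * dd Complex.I f x := by
  unfold dd
  conv_lhs => rw [show v = v.re • (1:ℂ) + v.im • Complex.I by simp [Complex.re_add_im]]
  rw [map_add, map_smul, map_smul]
  rfl

theorem polarMap_hasDerivAt_s {f : ℂ → ℝ} (hf : ContDiff ℝ ∞ f) (z : ℂ) (s t : ℝ) :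
    HasDerivAt (fun s => f (polarMap z (s, t)))
      (Real.exp s * (Real.cos t * dd 1 f (polarMap z (s, t)) + Real.sin t * dd Complex.I f (polarMap z (s, t)))) s := by
  have h1 : HasDerivAt (fun s : ℝ => polarMap z (s, t))
      (Real.exp s * (Real.cos t + Real.sin t * Complex.I)) s := by
    have := (((Real.hasDerivAt_exp s).ofReal_comp).mul_const
      (((Real.cos t : ℝ) : ℂ) + (Real.sin t : ℝ) * Complex.I)).const_add z
    exact this
  have h2 := (smooth_differentiable hf (polarMap z (s, t))).hasFDerivAt.comp_hasDerivAt s h1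
  refine h2.congr_deriv ?_
  change dd _ f _ = _
  rw [dd_vec]
  simp only [Complex.re_ofReal_mul, Complex.im_ofReal_mul, Complex.add_re, Complex.add_im,
    Complex.ofReal_re, Complex.ofReal_im, Complex.I_re, Complex.I_im]
  ring

theorem polarMap_hasDerivAt_t {f : ℂ → ℝ} (hf : ContDiff ℝ ∞ f) (z : ℂ) (s t : ℝ) :
    HasDerivAt (fun t => f (polarMap z (s, t)))
      (Real.exp s * (-Real.sin t * dd 1 f (polarMap z (s, t)) + Real.cos t * dd Complex.I f (polarMap z (s, t)))) t := by
  have h1 : HasDerivAt (fun t : ℝ => polarMap z (s, t))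
      (Real.exp s * ((-Real.sin t : ℝ) + Real.cos t * Complex.I)) t := by
    have := ((((Real.hasDerivAt_cos t).ofReal_comp).add
      (((Real.hasDerivAt_sin t).ofReal_comp).mul_const Complex.I)).const_mul ((Real.exp s : ℝ) : ℂ)).const_add z
    exact this
  have h2 := (smooth_differentiable hf (polarMap z (s, t))).hasFDerivAt.comp_hasDerivAt t h1
  refine h2.congr_deriv ?_
  change dd _ f _ = _
  rw [dd_vec]
  simp only [Complex.re_ofReal_mul, Complex.im_ofReal_mul, Complex.add_re, Complex.add_im,
    Complex.ofReal_re, Complex.ofReal_im, Complex.I_re, Complex.I_im]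
  ring

theorem contDiff_polar {f : ℂ → ℝ} (hf : ContDiff ℝ ∞ f) (z : ℂ) :
    ContDiff ℝ ∞ (fun x => f (polarMap z x)) := hf.comp (contDiff_polarMap z)

theorem polar_Ds {f : ℂ → ℝ} (hf : ContDiff ℝ ∞ f) (z : ℂ) (s t : ℝ) :
    Ds (fun x => f (polarMap z x)) (s, t) =
      Real.exp s * (Real.cos t * dd 1 f (polarMap z (s, t)) + Real.sin t * dd Complex.I f (polarMap z (s, t))) :=
  (hasDerivAt_Ds (contDiff_polar hf z) s t).unique (polarMap_hasDerivAt_s hf z s t)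

theorem polar_Dt {f : ℂ → ℝ} (hf : ContDiff ℝ ∞ f) (z : ℂ) (s t : ℝ) :
    Dt (fun x => f (polarMap z x)) (s, t) =
      Real.exp s * (-Real.sin t * dd 1 f (polarMap z (s, t)) + Real.cos t * dd Complex.I f (polarMap z (s, t))) :=
  (hasDerivAt_Dt (contDiff_polar hf z) s t).unique (polarMap_hasDerivAt_t hf z s t)

theorem polar_laplacian {f : ℂ → ℝ} (hf : ContDiff ℝ ∞ f) (z : ℂ) (s t : ℝ) :
    Ds (Ds (fun x => f (polarMap z x))) (s, t) + Dt (Dt (fun x => f (polarMap z x))) (s, t) =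
      Real.exp s ^ 2 * (dd 1 (dd 1 f) (polarMap z (s, t)) + dd Complex.I (dd Complex.I f) (polarMap z (s, t))) := by
  have f1 : ContDiff ℝ ∞ (dd (1:ℂ) f) := contDiff_dd hf
  have f2 : ContDiff ℝ ∞ (dd Complex.I f) := contDiff_dd hf
  have e1 := by
    have := (Real.hasDerivAt_exp s).mul (((polarMap_hasDerivAt_s f1 z s t).const_mul (Real.cos t)).add
      ((polarMap_hasDerivAt_s f2 z s t).const_mul (Real.sin t)))
    exact this.congr_of_eventuallyEq (f₁ := fun s => Ds (fun x => f (polarMap z x)) (s, t))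
      (Eventually.of_forall fun s => polar_Ds hf z s t)
  have e2 := by
    have := (((Real.hasDerivAt_sin t).neg.mul (polarMap_hasDerivAt_t f1 z s t)).add
      ((Real.hasDerivAt_cos t).mul (polarMap_hasDerivAt_t f2 z s t))).const_mul (Real.exp s)
    exact this.congr_of_eventuallyEq (f₁ := fun t => Dt (fun x => f (polarMap z x)) (s, t))
      (Eventually.of_forall fun t => polar_Dt hf z s t)
  rw [(hasDerivAt_Ds (contDiff_dd (contDiff_polar hf z)) s t).unique e1,
    (hasDerivAt_Dt (contDiff_dd (contDiff_polar hf z)) s t).unique e2]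
  have hc : dd (1:ℂ) (dd Complex.I f) = dd Complex.I (dd 1 f) := dd_comm hf
  rw [hc]
  have := Real.sin_sq_add_cos_sq t
  simp only [Pi.add_apply, Pi.neg_apply]
  linear_combination (Real.exp s ^ 2 * (dd 1 (dd 1 f) (polarMap z (s, t)) + dd Complex.I (dd Complex.I f) (polarMap z (s, t)))) * this

/-- Real form of the travelling wave equation. -/
structure Sol (c : ℝ) (a b : ℂ → ℝ) : Prop where
  smooth_a : ContDiff ℝ ∞ a
  smooth_b : ContDiff ℝ ∞ b
  eq_a : ∀ z, dd 1 (dd 1 a) z + dd Complex.I (dd Complex.I a) z =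
    c * dd Complex.I b z - (1 - (a z ^ 2 + b z ^ 2)) * a z
  eq_b : ∀ z, dd 1 (dd 1 b) z + dd Complex.I (dd Complex.I b) z =
    -(c * dd Complex.I a z) - (1 - (a z ^ 2 + b z ^ 2)) * b z

/-- `1 - |u|²`. -/
def cw (a b : ℂ → ℝ) (z : ℂ) : ℝ := 1 - (a z ^ 2 + b z ^ 2)

/-- Energy density in real form. -/
def ed (a b : ℂ → ℝ) (z : ℂ) : ℝ :=
  1 / 2 * (dd 1 a z ^ 2 + dd 1 b z ^ 2 + dd Complex.I a z ^ 2 + dd Complex.I b z ^ 2) + 1 / 4 * cw a b z ^ 2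

variable {c : ℝ} {a b : ℂ → ℝ}

theorem continuous_cw (ha : ContDiff ℝ ∞ a) (hb : ContDiff ℝ ∞ b) : Continuous (cw a b) := by
  have := ha.continuous
  have := hb.continuous
  unfold cw
  fun_prop

theorem continuous_ed (ha : ContDiff ℝ ∞ a) (hb : ContDiff ℝ ∞ b) : Continuous (ed a b) := by
  have := continuous_cw ha hb
  have := (contDiff_dd (v := (1:ℂ)) ha).continuous
  have := (contDiff_dd (v := (1:ℂ)) hb).continuous
  have := (contDiff_dd (v := Complex.I) ha).continuous
  have := (contDiff_dd (v := Complex.I) hb).continuous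
  unfold ed
  fun_prop

theorem ed_nonneg (z : ℂ) : 0 ≤ ed a b z := by unfold ed; positivity

theorem cw_sq_le_ed (z : ℂ) : cw a b z ^ 2 ≤ 4 * ed a b z := by
  unfold ed
  nlinarith [sq_nonneg (dd 1 a z), sq_nonneg (dd 1 b z), sq_nonneg (dd Complex.I a z),
    sq_nonneg (dd Complex.I b z)]

theorem polar_bound {f : ℂ → ℝ} (hf : ContDiff ℝ ∞ f) (z : ℂ) :
    ∃ M, 0 ≤ M ∧ ∀ s ≤ 0, ∀ t, |f (polarMap z (s, t))| ≤ M ∧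
      |Ds (fun x => f (polarMap z x)) (s, t)| ≤ M * Real.exp s ∧
      |Dt (fun x => f (polarMap z x)) (s, t)| ≤ M * Real.exp s := by
  have hK : IsCompact (closedBall z 1) := isCompact_closedBall _ _
  obtain ⟨M0, h0⟩ := hK.exists_bound_of_continuousOn hf.continuous.continuousOn
  obtain ⟨M1, h1⟩ := hK.exists_bound_of_continuousOn (contDiff_dd (v := (1:ℂ)) hf).continuous.continuousOn
  obtain ⟨M2, h2⟩ := hK.exists_bound_of_continuousOn (contDiff_dd (v := Complex.I) hf).continuous.continuousOn
  refine ⟨|M0| + |M1| + |M2|, by positivity, fun s hs t => ?_⟩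
  have hin : polarMap z (s, t) ∈ closedBall z 1 := by
    rw [mem_closedBall, dist_eq_norm, norm_polarMap_sub]
    exact Real.exp_le_one_iff.2 hs
  have b0 := (h0 _ hin).trans (le_abs_self _)
  have b1 := (h1 _ hin).trans (le_abs_self _)
  have b2 := (h2 _ hin).trans (le_abs_self _)
  rw [Real.norm_eq_abs] at b0 b1 b2
  have hs1 := Real.abs_sin_le_one t
  have hc1 := Real.abs_cos_le_one t
  have hM0 := abs_nonneg M0
  refine ⟨by linarith [abs_nonneg M1, abs_nonneg M2], ?_, ?_⟩
  · rw [polar_Ds hf, abs_mul, Real.abs_exp, mul_comm]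
    refine mul_le_mul_of_nonneg_right ?_ (Real.exp_pos s).le
    refine (abs_add_le _ _).trans ?_
    rw [abs_mul, abs_mul]
    have i1 := mul_le_mul hc1 b1 (abs_nonneg _) zero_le_one
    have i2 := mul_le_mul hs1 b2 (abs_nonneg _) zero_le_one
    linarith
  · rw [polar_Dt hf, abs_mul, Real.abs_exp, mul_comm]
    refine mul_le_mul_of_nonneg_right ?_ (Real.exp_pos s).le
    refine (abs_add_le _ _).trans ?_
    rw [abs_mul, abs_mul, abs_neg]
    have i1 := mul_le_mul hs1 b1 (abs_nonneg _) zero_le_one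
    have i2 := mul_le_mul hc1 b2 (abs_nonneg _) zero_le_one
    linarith

/-- A travelling wave seen from any centre in logarithmic polar coordinates. -/
theorem Sol.strip (h : Sol c a b) (z : ℂ) :
    StripSol c (fun x => a (polarMap z x)) (fun x => b (polarMap z x)) where
  smooth_a := contDiff_polar h.smooth_a z
  smooth_b := contDiff_polar h.smooth_b z
  per_a s t := by simp [polarMap]
  per_b s t := by simp [polarMap]
  eq_a s t := by
    rw [polar_laplacian h.smooth_a, h.eq_a, polar_Ds h.smooth_b, polar_Dt h.smooth_b]
    have := Real.sin_sq_add_cos_sq t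
    linear_combination (-c * Real.exp s ^ 2 * dd Complex.I b (polarMap z (s, t))) * this
  eq_b s t := by
    rw [polar_laplacian h.smooth_b, h.eq_b, polar_Ds h.smooth_a, polar_Dt h.smooth_a]
    have := Real.sin_sq_add_cos_sq t
    linear_combination (c * Real.exp s ^ 2 * dd Complex.I a (polarMap z (s, t))) * this
  bound := by
    obtain ⟨M, hM, h1⟩ := polar_bound h.smooth_a z
    obtain ⟨M', hM', h2⟩ := polar_bound h.smooth_b z
    refine ⟨M + M', fun s hs t => ?_⟩
    have i1 := h1 s hs t
    have i2 := h2 s hs t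
    have := mul_nonneg hM (Real.exp_pos s).le
    have := mul_nonneg hM' (Real.exp_pos s).le
    refine ⟨?_, ?_, ?_, ?_, ?_, ?_⟩ <;> linarith [i1.1, i1.2.1, i1.2.2, i2.1, i2.2.1, i2.2.2]

theorem polar_sE (ha : ContDiff ℝ ∞ a) (hb : ContDiff ℝ ∞ b) (z : ℂ) (s t : ℝ) :
    sE (fun x => a (polarMap z x)) (fun x => b (polarMap z x)) (s, t) =
      Real.exp s ^ 2 * ed a b (polarMap z (s, t)) := by
  unfold sE ed sW cw
  rw [polar_Ds ha, polar_Dt ha, polar_Ds hb, polar_Dt hb]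
  have := Real.sin_sq_add_cos_sq t
  linear_combination (1 / 2 * Real.exp s ^ 2 * (dd 1 a (polarMap z (s, t)) ^ 2 + dd 1 b (polarMap z (s, t)) ^ 2
    + dd Complex.I a (polarMap z (s, t)) ^ 2 + dd Complex.I b (polarMap z (s, t)) ^ 2)) * this

/-- Integration over annuli in logarithmic polar coordinates. -/
theorem integral_annulus {f : ℂ → ℝ} (hf : Continuous f) (h0 : ∀ z, 0 ≤ f z) (z : ℂ) {S' S : ℝ}
    (hS : S' ≤ S) :
    ∫ s in S'..S, ∫ t in (0:ℝ)..2 * Real.pi, Real.exp s ^ 2 * f (polarMap z (s, t)) =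
      ∫ x in {x : ℂ | Real.exp S' < ‖x - z‖ ∧ ‖x - z‖ ≤ Real.exp S}, f x := by
  have hpi := Real.pi_pos
  set A : Set ℂ := {x : ℂ | Real.exp S' < ‖x - z‖ ∧ ‖x - z‖ ≤ Real.exp S} with hA
  have mA : MeasurableSet A := by
    refine MeasurableSet.inter ?_ ?_
    · exact (isOpen_lt (f := fun _ : ℂ => Real.exp S') (g := fun x : ℂ => ‖x - z‖)
        continuous_const (by fun_prop)).measurableSet
    · exact (isClosed_le (f := fun x : ℂ => ‖x - z‖) (g := fun _ : ℂ => Real.exp S)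
        (by fun_prop) continuous_const).measurableSet
  have cΦ : Continuous (polarMap z) := (contDiff_polarMap z).continuous
  set I : ℝ → ℝ := fun s => ∫ t in (0:ℝ)..2 * Real.pi, Real.exp s ^ 2 * f (polarMap z (s, t)) with hI
  have cI : Continuous I :=
    intervalIntegral.continuous_parametric_intervalIntegral_of_continuous'
      (f := fun s t => Real.exp s ^ 2 * f (polarMap z (s, t))) (by unfold Function.uncurry; fun_prop) _ _
  have I0 : ∀ s, 0 ≤ I s := fun s => intervalIntegral.integral_nonneg (by positivity)
    fun t _ => mul_nonneg (sq_nonneg _) (h0 _)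
  have hIper : ∀ s, I s = ∫ t in (-Real.pi)..Real.pi, Real.exp s ^ 2 * f (polarMap z (s, t)) := by
    intro s
    have hp : Function.Periodic (fun t => Real.exp s ^ 2 * f (polarMap z (s, t))) (2 * Real.pi) := by
      intro t; simp [polarMap]
    have := hp.intervalIntegral_add_eq 0 (-Real.pi)
    rw [zero_add, show -Real.pi + 2 * Real.pi = Real.pi by ring] at this
    exact this
  have hIl : ∀ s, ENNReal.ofReal (I s) = ∫⁻ t in Set.Ioo (-Real.pi) Real.pi,
      ENNReal.ofReal (Real.exp s ^ 2 * f (polarMap z (s, t))) := by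
    intro s
    have cc : Continuous fun t => Real.exp s ^ 2 * f (polarMap z (s, t)) := by fun_prop
    rw [hIper, intervalIntegral.integral_of_le (by linarith), integral_Ioc_eq_integral_Ioo,
      ofReal_integral_eq_lintegral_ofReal]
    · exact (cc.integrableOn_Icc (a := -Real.pi) (b := Real.pi)).mono_set Set.Ioo_subset_Icc_self
    · exact Eventually.of_forall fun t => mul_nonneg (sq_nonneg _) (h0 _)
  have lhs : ENNReal.ofReal (∫ s in S'..S, I s) = ∫⁻ s in Set.Ioc S' S, ENNReal.ofReal (I s) := by
    rw [intervalIntegral.integral_of_le hS, ofReal_integral_eq_lintegral_ofReal]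
    · exact (cI.integrableOn_Icc (a := S') (b := S)).mono_set Set.Ioc_subset_Icc_self
    · exact Eventually.of_forall I0
  have rhs : ∫⁻ x in A, ENNReal.ofReal (f x) = ∫⁻ s in Set.Ioc S' S, ENNReal.ofReal (I s) := by
    have hmeas : Measurable fun x => ENNReal.ofReal (f x) := (hf.measurable).ennreal_ofReal
    rw [← lintegral_indicator mA, ← lintegral_add_left_eq_self _ z,
      ← Complex.lintegral_comp_polarCoord_symm]
    set g : ℂ → ENNReal := fun x => A.indicator (fun x => ENNReal.ofReal (f x)) (z + x) with hg
    have mg : Measurable g := (hmeas.indicator mA).comp (measurable_const_add z)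
    have htar : polarCoord.target = Set.Ioi (0:ℝ) ×ˢ Set.Ioo (-Real.pi) Real.pi := rfl
    have msym : Measurable fun p : ℝ × ℝ => (Complex.polarCoord.symm p : ℂ) := by
      simp only [Complex.polarCoord_symm_apply]
      fun_prop
    rw [htar, Measure.volume_eq_prod, setLIntegral_prod]
    · have himg : Set.Ioi (0:ℝ) = Real.exp '' Set.univ := by
        rw [Set.image_univ, Real.range_exp]
      rw [himg, lintegral_image_eq_lintegral_abs_deriv_mul MeasurableSet.univ
        (fun x _ => (Real.hasDerivAt_exp x).hasDerivWithinAt) Real.exp_injective.injOn,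
        Measure.restrict_univ, ← lintegral_indicator measurableSet_Ioc]
      refine lintegral_congr fun s => ?_
      have hsym : ∀ t, z + Complex.polarCoord.symm (Real.exp s, t) = polarMap z (s, t) := by
        intro t; simp [polarMap, Complex.polarCoord_symm_apply]
      by_cases hs : s ∈ Set.Ioc S' S
      · rw [Set.indicator_of_mem hs, hIl, ← lintegral_const_mul _ (by fun_prop)]
        refine lintegral_congr fun t => ?_
        have hmem : polarMap z (s, t) ∈ A := by
          simp only [hA, Set.mem_ofPred_eq, norm_polarMap_sub, Real.exp_lt_exp, Real.exp_le_exp]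
          exact hs
        simp only [smul_eq_mul, hsym]
        rw [Set.indicator_of_mem hmem, Real.abs_exp, ← mul_assoc, ← ENNReal.ofReal_mul (Real.exp_pos s).le,
          ← ENNReal.ofReal_mul (by positivity), sq]
      · rw [Set.indicator_of_notMem hs]
        have : ∀ t, polarMap z (s, t) ∉ A := by
          intro t
          simp only [hA, Set.mem_ofPred_eq, norm_polarMap_sub, Real.exp_lt_exp, Real.exp_le_exp]
          exact hs
        simp only [hsym, Set.indicator_of_notMem (this _), smul_zero, mul_zero, lintegral_zero]
    · refine (Measurable.aemeasurable ?_)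
      exact (by fun_prop : Measurable fun p : ℝ × ℝ => ENNReal.ofReal p.1).mul (mg.comp msym)
  rw [integral_eq_lintegral_of_nonneg_ae (Eventually.of_forall h0) hf.aestronglyMeasurable, rhs, ← lhs,
    ENNReal.toReal_ofReal (intervalIntegral.integral_nonneg hS fun s _ => I0 s)]

end Plane

section Discs

/-- Energy on the circle of radius `exp s` about `z`, per unit of logarithmic radius. -/
abbrev ringE (a b : ℂ → ℝ) (z : ℂ) : ℝ → ℝ :=
  circE (fun x => a (polarMap z x)) (fun x => b (polarMap z x))

/-- Circle integral of the stress tensor about `z`. -/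
abbrev ringA (a b : ℂ → ℝ) (z : ℂ) : ℝ → ℝ :=
  circA (fun x => a (polarMap z x)) (fun x => b (polarMap z x))

/-- Phase increment on the circle of radius `exp s` about `z`. -/
abbrev wind (a b : ℂ → ℝ) (z : ℂ) : ℝ → ℝ :=
  circWind (fun x => a (polarMap z x)) (fun x => b (polarMap z x))

/-- Potential energy (doubled) in a closed disc. -/
def pot (a b : ℂ → ℝ) (z : ℂ) (r : ℝ) : ℝ := ∫ x in closedBall z r, 1 / 2 * cw a b x ^ 2

variable {c : ℝ} {a b : ℂ → ℝ}

theorem integral_ringE (ha : ContDiff ℝ ∞ a) (hb : ContDiff ℝ ∞ b) (z : ℂ) {S' S : ℝ} (hS : S' ≤ S) :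
    ∫ s in S'..S, ringE a b z s =
      ∫ x in {x : ℂ | Real.exp S' < ‖x - z‖ ∧ ‖x - z‖ ≤ Real.exp S}, ed a b x := by
  rw [← integral_annulus (continuous_ed ha hb) ed_nonneg z hS]
  simp only [ringE, circE, polar_sE ha hb]

theorem continuous_ringE (ha : ContDiff ℝ ∞ a) (hb : ContDiff ℝ ∞ b) (z : ℂ) : Continuous (ringE a b z) :=
  continuous_circE (contDiff_polar ha z) (contDiff_polar hb z)

theorem ringE_nonneg (z : ℂ) (s : ℝ) : 0 ≤ ringE a b z s := circE_nonneg s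

theorem integral_ringE_le (ha : ContDiff ℝ ∞ a) (hb : ContDiff ℝ ∞ b) (hI : Integrable (ed a b))
    (z : ℂ) {S' S : ℝ} (hS : S' ≤ S) : ∫ s in S'..S, ringE a b z s ≤ ∫ x, ed a b x := by
  rw [integral_ringE ha hb z hS]
  exact setIntegral_le_integral hI (Eventually.of_forall ed_nonneg)

theorem integrable_cw_sq (ha : ContDiff ℝ ∞ a) (hb : ContDiff ℝ ∞ b) (hI : Integrable (ed a b)) :
    Integrable fun x => 1 / 2 * cw a b x ^ 2 := by
  have := continuous_cw ha hb
  refine (hI.const_mul 2).mono' (by fun_prop) (Eventually.of_forall fun x => ?_)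
  rw [Real.norm_eq_abs, abs_of_nonneg (by positivity)]
  linarith [cw_sq_le_ed (a := a) (b := b) x]

theorem pot_mono (ha : ContDiff ℝ ∞ a) (hb : ContDiff ℝ ∞ b) {z z' : ℂ} {r r' : ℝ}
    (h : closedBall z r ⊆ closedBall z' r') : pot a b z r ≤ pot a b z' r' := by
  have := continuous_cw ha hb
  refine setIntegral_mono_set ?_ (Eventually.of_forall fun x => ?_) h.eventuallyLE
  · exact (by fun_prop : Continuous fun x => 1 / 2 * cw a b x ^ 2).continuousOn.integrableOn_compact
      (isCompact_closedBall _ _)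
  · show (0:ℝ) ≤ 1 / 2 * cw a b x ^ 2
    positivity

theorem integral_circV (ha : ContDiff ℝ ∞ a) (hb : ContDiff ℝ ∞ b) (z : ℂ) {S' S : ℝ} (hS : S' ≤ S) :
    ∫ s in S'..S, circV (fun x => a (polarMap z x)) (fun x => b (polarMap z x)) s =
      pot a b z (Real.exp S) - pot a b z (Real.exp S') := by
  have cc := continuous_cw ha hb
  have hcont : Continuous fun x => 1 / 2 * cw a b x ^ 2 := by fun_prop
  have h1 := integral_annulus hcont (fun x => by positivity) z hS
  have h2 : ∀ s t, 1 / 2 * Real.exp s ^ 2 * sW (fun x => a (polarMap z x)) (fun x => b (polarMap z x)) (s, t) ^ 2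
      = Real.exp s ^ 2 * (1 / 2 * cw a b (polarMap z (s, t)) ^ 2) := by
    intro s t; simp only [sW, cw]; ring
  simp only [circV, h2]
  rw [h1]
  unfold pot
  have hset : {x : ℂ | Real.exp S' < ‖x - z‖ ∧ ‖x - z‖ ≤ Real.exp S} =
      closedBall z (Real.exp S) \ closedBall z (Real.exp S') := by
    ext x
    simp only [Set.mem_ofPred_eq, Set.mem_sdiff, mem_closedBall, dist_eq_norm, not_le]
    tauto
  rw [hset, setIntegral_sdiff isClosed_closedBall.measurableSet
    (hcont.continuousOn.integrableOn_compact (isCompact_closedBall _ _))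
    (closedBall_subset_closedBall (Real.exp_le_exp.2 hS))]

theorem tendsto_pot (ha : ContDiff ℝ ∞ a) (hb : ContDiff ℝ ∞ b) (z : ℂ) :
    Tendsto (fun s => pot a b z (Real.exp s)) atBot (𝓝 0) := by
  have cc := continuous_cw ha hb
  have hcont : Continuous fun x => 1 / 2 * cw a b x ^ 2 := by fun_prop
  have h := tendsto_setIntegral_of_antitone (μ := volume) (f := fun x => 1 / 2 * cw a b x ^ 2)
    (s := fun s : ℝ => closedBall z (Real.exp (-s)))
    (fun _ => isClosed_closedBall.measurableSet)
    (fun s s' h => closedBall_subset_closedBall (Real.exp_le_exp.2 (neg_le_neg h)))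
    ⟨0, hcont.continuousOn.integrableOn_compact (isCompact_closedBall _ _)⟩
  have hset : (⋂ s : ℝ, closedBall z (Real.exp (-s))) ⊆ {z} := by
    intro x hx
    rw [Set.mem_iInter] at hx
    have : ‖x - z‖ ≤ 0 := by
      refine ge_of_tendsto (Real.tendsto_exp_neg_atTop_nhds_zero) (Eventually.of_forall fun s => ?_)
      simpa [dist_eq_norm] using hx s
    simpa [sub_eq_zero] using this
  rw [setIntegral_measure_zero _ (measure_mono_null hset (measure_singleton z))] at h
  have := h.comp tendsto_neg_atBot_atTop
  refine this.congr fun s => ?_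
  simp [pot]

/-- Pohozaev identity on discs, up to the convective error. -/
theorem Sol.pohozaev (h : Sol c a b) (hc : 0 ≤ c) (hI : Integrable (ed a b)) (z : ℂ) (S : ℝ) :
    |ringA a b z S - pot a b z (Real.exp S)| ≤ c * Real.exp S * ∫ x, ed a b x := by
  have h1 := (h.strip z).tendsto_circA
  have h2 := tendsto_pot h.smooth_a h.smooth_b z
  have h3 : Tendsto (fun S' => |ringA a b z S - ringA a b z S' -
      (pot a b z (Real.exp S) - pot a b z (Real.exp S'))|) atBot
      (𝓝 |ringA a b z S - 0 - (pot a b z (Real.exp S) - 0)|) :=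
    ((tendsto_const_nhds.sub h1).sub (tendsto_const_nhds.sub h2)).abs
  rw [sub_zero, sub_zero] at h3
  refine le_of_tendsto h3 ?_
  filter_upwards [eventually_le_atBot S] with S' hS'
  rw [← integral_circV h.smooth_a h.smooth_b z hS']
  exact (h.strip z).pohozaev hc hS' (integral_ringE_le h.smooth_a h.smooth_b hI z hS')

/-- A window without zeros and without winding shields a disc with little potential energy. -/
theorem Sol.pot_le_of_wind_zero (h : Sol c a b) (hc : 0 ≤ c) (hc' : c ≤ 1 / 30) (hI : Integrable (ed a b))
    {z : ℂ} {x y : ℝ} (hx : 0 ≤ x) (hxy : x < y)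
    (hw : ∀ v, Real.exp x < ‖v - z‖ → ‖v - z‖ < Real.exp y → |cw a b v| ≤ 1 / 8)
    (hwind : ∀ s ∈ Set.Ioo x y, wind a b z s = 0) :
    pot a b z (Real.exp x) ≤ 2 / (y - x) * ((∫ v, ed a b v) * Real.exp (-((y - x) / 200)))
      + c * Real.exp y * ∫ v, ed a b v := by
  obtain ⟨s, hs, hle⟩ := (h.strip z).exists_small_circE hc hc' hx hxy
    (fun s hs t => hw _ (by rw [norm_polarMap_sub]; exact Real.exp_lt_exp.2 hs.1)
      (by rw [norm_polarMap_sub]; exact Real.exp_lt_exp.2 hs.2)) hwind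
    (integral_ringE_le h.smooth_a h.smooth_b hI z hxy.le)
  have h1 := circA_le_circE (contDiff_polar h.smooth_a z) (contDiff_polar h.smooth_b z) s
  have h2 := (abs_le.1 (h.pohozaev hc hI z s)).1
  have h3 : pot a b z (Real.exp x) ≤ pot a b z (Real.exp s) :=
    pot_mono h.smooth_a h.smooth_b (closedBall_subset_closedBall (Real.exp_le_exp.2 hs.1.le))
  have h4 : c * Real.exp s * (∫ v, ed a b v) ≤ c * Real.exp y * ∫ v, ed a b v :=
    mul_le_mul_of_nonneg_right (mul_le_mul_of_nonneg_left (Real.exp_le_exp.2 hs.2.le) hc)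
      (integral_nonneg ed_nonneg)
  simp only [ringA] at h2
  linarith

theorem normSq_pos_of_cw {v : ℂ} (h : |cw a b v| ≤ 1 / 8) : 0 < a v ^ 2 + b v ^ 2 := by
  have := (abs_le.1 h).2
  unfold cw at this
  linarith

/-- On a window where `|u|` is close to one the winding vanishes identically or nowhere. -/
theorem wind_dichotomy (ha : ContDiff ℝ ∞ a) (hb : ContDiff ℝ ∞ b) {z : ℂ} {x y : ℝ}
    (hw : ∀ v, Real.exp x < ‖v - z‖ → ‖v - z‖ < Real.exp y → |cw a b v| ≤ 1 / 8) :
    (∀ s ∈ Set.Ioo x y, wind a b z s = 0) ∨ ∀ s ∈ Set.Ioo x y, 2 * Real.pi ≤ |wind a b z s| := by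
  have pa : ∀ s t, a (polarMap z (s, t + 2 * Real.pi)) = a (polarMap z (s, t)) := by
    intro s t; simp [polarMap]
  have pb : ∀ s t, b (polarMap z (s, t + 2 * Real.pi)) = b (polarMap z (s, t)) := by
    intro s t; simp [polarMap]
  have hn : ∀ s ∈ Set.Ioo x y, ∀ t, 0 < a (polarMap z (s, t)) ^ 2 + b (polarMap z (s, t)) ^ 2 :=
    fun s hs t => normSq_pos_of_cw (hw _ (by rw [norm_polarMap_sub]; exact Real.exp_lt_exp.2 hs.1)
      (by rw [norm_polarMap_sub]; exact Real.exp_lt_exp.2 hs.2))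
  by_cases hne : (Set.Ioo x y).Nonempty
  · obtain ⟨s0, hs0⟩ := hne
    have hcst : ∀ s ∈ Set.Ioo x y, wind a b z s = wind a b z s0 := fun s hs =>
      circWind_const (contDiff_polar ha z) (contDiff_polar hb z) pa pb hn hs hs0
    rcases circWind_eq_zero_or (contDiff_polar ha z) (contDiff_polar hb z) pa pb (hn s0 hs0) with h | h
    · exact Or.inl fun s hs => (hcst s hs).trans h
    · exact Or.inr fun s hs => by rw [hcst s hs]; exact h
  · rw [Set.not_nonempty_iff_eq_empty] at hne
    left; simp [hne]

/-- There is no winding around a disc on which `|u|` is close to one. -/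
theorem Sol.wind_zero_of_disc (h : Sol c a b) {z : ℂ} {y : ℝ}
    (hw : ∀ v, ‖v - z‖ < Real.exp y → |cw a b v| ≤ 1 / 8) {s : ℝ} (hs : s < y) : wind a b z s = 0 := by
  obtain ⟨M, hM⟩ := (h.strip z).bound
  have M0 : 0 ≤ M := (abs_nonneg _).trans (hM 0 le_rfl 0).1
  have hlim : Tendsto (fun s : ℝ => 4 * M ^ 2 * Real.exp s) atBot (𝓝 0) := by
    simpa using Real.tendsto_exp_atBot.const_mul (4 * M ^ 2)
  obtain ⟨s', h1, h2, h3⟩ := ((hlim.eventually (gt_mem_nhds zero_lt_one)).and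
    ((eventually_lt_atBot s).and (eventually_le_atBot 0))).exists
  have hd := wind_dichotomy h.smooth_a h.smooth_b (x := s' - 1) fun v _ hv => hw v hv
  have hpsi : ∀ t, |sPsi (fun x => a (polarMap z x)) (fun x => b (polarMap z x)) (s', t)| ≤
      4 * M ^ 2 * Real.exp s' := by
    intro t
    obtain ⟨e1, e2, -, e4, -, e6⟩ := hM s' h3 t
    have hq := hw (polarMap z (s', t)) (by rw [norm_polarMap_sub]; exact Real.exp_lt_exp.2 (h2.trans hs))
    have hq' : 7 / 8 ≤ a (polarMap z (s', t)) ^ 2 + b (polarMap z (s', t)) ^ 2 := by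
      have := (abs_le.1 hq).2
      unfold cw at this
      linarith
    unfold sPsi
    rw [abs_div, abs_of_pos (show 0 < a (polarMap z (s', t)) ^ 2 + b (polarMap z (s', t)) ^ 2 by linarith),
      div_le_iff₀ (by linarith)]
    have i1 := mul_le_mul e1 e6 (abs_nonneg _) M0
    have i2 := mul_le_mul e2 e4 (abs_nonneg _) M0
    rw [← abs_mul] at i1 i2
    have i3 := abs_sub (a (polarMap z (s', t)) * Dt (fun x => b (polarMap z x)) (s', t))
      (b (polarMap z (s', t)) * Dt (fun x => a (polarMap z x)) (s', t))
    have hp : 0 ≤ M ^ 2 * Real.exp s' := by positivity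
    nlinarith
  have hsmall : |wind a b z s'| < 2 * Real.pi := by
    have := intervalIntegral.norm_integral_le_of_norm_le_const (a := (0:ℝ)) (b := 2 * Real.pi)
      (f := fun t => sPsi (fun x => a (polarMap z x)) (fun x => b (polarMap z x)) (s', t))
      (fun t _ => hpsi t)
    rw [sub_zero, abs_of_pos (by positivity), Real.norm_eq_abs] at this
    refine this.trans_lt ?_
    nlinarith [Real.pi_pos]
  rcases hd with hd | hd
  · exact hd s ⟨by linarith, hs⟩
  · exact absurd (hd s' ⟨by linarith, by linarith⟩) (not_le.2 hsmall)

/-- There is no winding around points of the symmetry axis. -/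
theorem wind_zero_of_axis (ha : ContDiff ℝ ∞ a) (hb : ContDiff ℝ ∞ b)
    (ea : ∀ z, a (-(starRingEnd ℂ z)) = a z) (eb : ∀ z, b (-(starRingEnd ℂ z)) = b z)
    {z : ℂ} (hz : z.re = 0) (s : ℝ) : wind a b z s = 0 := by
  have hrefl : ∀ t, polarMap z (s, Real.pi - t) = -(starRingEnd ℂ (polarMap z (s, t))) := by
    intro t
    unfold polarMap
    apply Complex.ext <;> simp [hz, add_comm]
  have key : ∀ f : ℂ → ℝ, ContDiff ℝ ∞ f → (∀ z, f (-(starRingEnd ℂ z)) = f z) → ∀ t,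
      Dt (fun x => f (polarMap z x)) (s, Real.pi - t) = -Dt (fun x => f (polarMap z x)) (s, t) := by
    intro f hf ef t
    have h1 := hasDerivAt_Dt (contDiff_polar hf z) s t
    have h2 := (hasDerivAt_Dt (contDiff_polar hf z) s (Real.pi - t)).comp t ((hasDerivAt_id t).const_sub Real.pi)
    have h3 : ((fun t => f (polarMap z (s, t))) ∘ HSub.hSub Real.pi) = fun t => f (polarMap z (s, t)) := by
      funext t
      simp only [Function.comp, hrefl, ef]
    rw [h3] at h2
    have := h1.unique h2
    linarith
  set psi : ℝ → ℝ := fun t => sPsi (fun x => a (polarMap z x)) (fun x => b (polarMap z x)) (s, t) with hpsi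
  have hodd : ∀ t, psi (Real.pi - t) = -psi t := by
    intro t
    simp only [hpsi, sPsi, key a ha ea, key b hb eb, hrefl, ea, eb]
    ring
  have hper : Function.Periodic psi (2 * Real.pi) := by
    intro t
    have := dd_periodic (f := fun x => a (polarMap z x)) (v := ((0:ℝ),(1:ℝ))) (T := 2 * Real.pi)
      (fun s t => by simp [polarMap]) s t
    have h' := dd_periodic (f := fun x => b (polarMap z x)) (v := ((0:ℝ),(1:ℝ))) (T := 2 * Real.pi)
      (fun s t => by simp [polarMap]) s t
    simp only [hpsi, sPsi, Dt, this, h']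
    simp [polarMap]
  have h1 : ∫ t in (0:ℝ)..2 * Real.pi, psi (Real.pi - t) = ∫ t in (0:ℝ)..2 * Real.pi, psi t := by
    rw [intervalIntegral.integral_comp_sub_left]
    have := hper.intervalIntegral_add_eq (Real.pi - 2 * Real.pi) 0
    rw [show Real.pi - 2 * Real.pi + 2 * Real.pi = Real.pi - 0 by ring, zero_add] at this
    exact this
  simp only [hodd, intervalIntegral.integral_neg] at h1
  have : wind a b z s = ∫ t in (0:ℝ)..2 * Real.pi, psi t := rfl
  rw [this]
  linarith

/-- Circle estimates in the presence of winding. -/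
theorem ringE_of_wind (ha : ContDiff ℝ ∞ a) (hb : ContDiff ℝ ∞ b) {z : ℂ} {s τ : ℝ} (hτ : τ < 1)
    (hw : ∀ v, ‖v - z‖ = Real.exp s → |cw a b v| ≤ τ) (hwind : 2 * Real.pi ≤ |wind a b z s|) :
    (1 - τ) * Real.pi ≤ ringE a b z s ∧ 2 * (1 - τ) * Real.pi - ringE a b z s ≤ ringA a b z s :=
  circE_of_wind (contDiff_polar ha z) (contDiff_polar hb z) hτ
    (fun t => hw _ (norm_polarMap_sub z s t)) hwind

theorem ringA_le_ringE (ha : ContDiff ℝ ∞ a) (hb : ContDiff ℝ ∞ b) (z : ℂ) (s : ℝ) :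
    ringA a b z s ≤ ringE a b z s :=
  circA_le_circE (contDiff_polar ha z) (contDiff_polar hb z) s

end Discs

section Bernstein

/-- Laplacian of a real function on the plane. -/
def Lap (f : ℂ → ℝ) (z : ℂ) : ℝ := dd 1 (dd 1 f) z + dd Complex.I (dd Complex.I f) z

theorem hasDerivAt_dd_line {E : Type*} [NormedAddCommGroup E] [NormedSpace ℝ E] {f : E → ℝ}
    (hf : ContDiff ℝ ∞ f) (x v : E) (r : ℝ) :
    HasDerivAt (fun r : ℝ => f (x + r • v)) (dd v f (x + r • v)) r := by
  have h1 : HasDerivAt (fun r : ℝ => x + r • v) v r := by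
    simpa using ((hasDerivAt_id r).smul_const v).const_add x
  exact (smooth_differentiable hf (x + r • v)).hasFDerivAt.comp_hasDerivAt r h1

theorem dd_dd_nonpos_of_isLocalMax {E : Type*} [NormedAddCommGroup E] [NormedSpace ℝ E] {f : E → ℝ}
    (hf : ContDiff ℝ ∞ f) {x : E} (h : IsLocalMax f x) (v : E) : dd v (dd v f) x ≤ 0 := by
  set g : ℝ → ℝ := fun r => f (x + r • v) with hg
  have d1 : deriv g = fun r => dd v f (x + r • v) := funext fun r => (hasDerivAt_dd_line hf x v r).deriv
  have d2 : deriv (deriv g) 0 = dd v (dd v f) x := by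
    rw [d1, (hasDerivAt_dd_line (contDiff_dd hf) x v 0).deriv]; simp
  have gmax : IsLocalMax g 0 := by
    have hc : ContinuousAt (fun r : ℝ => x + r • v) 0 := by fun_prop
    have h' : IsLocalMax f (x + (0:ℝ) • v) := by simpa using h
    exact hc.tendsto.eventually h'
  by_contra! hpos
  have gc : Continuous g := by
    have := hf.continuous
    simp only [hg]; fun_prop
  have gmin : IsLocalMin g 0 := isLocalMin_of_deriv_deriv_pos (by rw [d2]; exact hpos) gmax.deriv_eq_zero gc.continuousAt
  have heq : g =ᶠ[𝓝 0] fun _ => g 0 := by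
    filter_upwards [gmax, gmin] with r h1 h2
    exact le_antisymm h1 h2
  have := (heq.deriv).deriv_eq
  rw [d2] at this
  simp at this
  linarith

theorem Lap_nonpos_of_isLocalMax {f : ℂ → ℝ} (hf : ContDiff ℝ ∞ f) {x : ℂ} (h : IsLocalMax f x) :
    Lap f x ≤ 0 := by
  have h1 := dd_dd_nonpos_of_isLocalMax hf h 1
  have h2 := dd_dd_nonpos_of_isLocalMax hf h Complex.I
  unfold Lap
  linarith

theorem dd_zero_of_isLocalMax {f : ℂ → ℝ} {x : ℂ} (h : IsLocalMax f x) (v : ℂ) : dd v f x = 0 := by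
  unfold dd
  rw [h.fderiv_eq_zero]
  rfl

variable {f g : ℂ → ℝ}

theorem dd_dd_mul {v : ℂ} (hf : ContDiff ℝ ∞ f) (hg : ContDiff ℝ ∞ g) (z : ℂ) :
    dd v (dd v (fun x => f x * g x)) z =
      dd v (dd v f) z * g z + 2 * (dd v f z * dd v g z) + f z * dd v (dd v g) z := by
  have hf1 : ContDiff ℝ ∞ (dd v f) := contDiff_dd hf
  have hg1 : ContDiff ℝ ∞ (dd v g) := contDiff_dd hg
  rw [dd_mul hf hg, dd_add (hf1.mul hg) (hf.mul hg1), dd_mul hf1 hg, dd_mul hf hg1]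
  ring

theorem Lap_mul (hf : ContDiff ℝ ∞ f) (hg : ContDiff ℝ ∞ g) (z : ℂ) :
    Lap (fun x => f x * g x) z = Lap f z * g z
      + 2 * (dd 1 f z * dd 1 g z + dd Complex.I f z * dd Complex.I g z) + f z * Lap g z := by
  unfold Lap
  rw [dd_dd_mul hf hg, dd_dd_mul hf hg]
  ring

theorem Lap_add (hf : ContDiff ℝ ∞ f) (hg : ContDiff ℝ ∞ g) (z : ℂ) :
    Lap (fun x => f x + g x) z = Lap f z + Lap g z := by
  unfold Lap
  rw [dd_add hf hg, dd_add hf hg, dd_add (contDiff_dd hf) (contDiff_dd hg),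
    dd_add (contDiff_dd hf) (contDiff_dd hg)]
  ring

/-- Quadratic cutoff profile. -/
def bump2 (z : ℂ) (R : ℝ) (x : ℂ) : ℝ := R - ((x.re - z.re) ^ 2 + (x.im - z.im) ^ 2)

theorem contDiff_bump2 (z : ℂ) (R : ℝ) : ContDiff ℝ ∞ (bump2 z R) := by
  have h1 : ContDiff ℝ ∞ (fun x : ℂ => x.re) := Complex.reCLM.contDiff
  have h2 : ContDiff ℝ ∞ (fun x : ℂ => x.im) := Complex.imCLM.contDiff
  unfold bump2
  fun_prop

theorem bump2_eq (z : ℂ) (R : ℝ) (x : ℂ) : bump2 z R x = R - ‖x - z‖ ^ 2 := by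
  rw [Complex.sq_norm, Complex.normSq_apply]
  simp [bump2]; ring

theorem dd_one_bump2 (z : ℂ) (R : ℝ) : dd 1 (bump2 z R) = fun x => -2 * (x.re - z.re) := by
  funext x
  refine dd_eq_of_hasDerivAt (contDiff_bump2 z R) ?_
  unfold bump2
  have h1 : HasDerivAt (fun r : ℝ => x.re + r - z.re) 1 0 := ((hasDerivAt_id 0).const_add x.re).sub_const z.re
  have := ((h1.pow 2).add_const ((x.im - z.im) ^ 2)).const_sub R
  refine (this.congr_deriv ?_).congr_of_eventuallyEq (Eventually.of_forall fun r => ?_)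
  · simp
  · simp

theorem dd_I_bump2 (z : ℂ) (R : ℝ) : dd Complex.I (bump2 z R) = fun x => -2 * (x.im - z.im) := by
  funext x
  refine dd_eq_of_hasDerivAt (contDiff_bump2 z R) ?_
  unfold bump2
  have h1 : HasDerivAt (fun r : ℝ => x.im + r - z.im) 1 0 := ((hasDerivAt_id 0).const_add x.im).sub_const z.im
  have := ((h1.pow 2).const_add ((x.re - z.re) ^ 2)).const_sub R
  refine (this.congr_deriv ?_).congr_of_eventuallyEq (Eventually.of_forall fun r => ?_)
  · simp
  · simp

theorem Lap_bump2 (z : ℂ) (R : ℝ) (x : ℂ) : Lap (bump2 z R) x = -4 := by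
  unfold Lap
  rw [dd_one_bump2, dd_I_bump2]
  have h1 : ContDiff ℝ ∞ (fun x : ℂ => -2 * (x.re - z.re)) :=
    contDiff_const.mul (Complex.reCLM.contDiff.sub contDiff_const)
  have h2 : ContDiff ℝ ∞ (fun x : ℂ => -2 * (x.im - z.im)) :=
    contDiff_const.mul (Complex.imCLM.contDiff.sub contDiff_const)
  have e1 : dd 1 (fun x : ℂ => -2 * (x.re - z.re)) x = -2 := by
    refine dd_eq_of_hasDerivAt h1 ?_
    have h : HasDerivAt (fun r : ℝ => x.re + r - z.re) 1 0 := ((hasDerivAt_id 0).const_add x.re).sub_const z.re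
    refine ((h.const_mul (-2)).congr_deriv (by norm_num)).congr_of_eventuallyEq (Eventually.of_forall fun r => ?_)
    simp
  have e2 : dd Complex.I (fun x : ℂ => -2 * (x.im - z.im)) x = -2 := by
    refine dd_eq_of_hasDerivAt h2 ?_
    have h : HasDerivAt (fun r : ℝ => x.im + r - z.im) 1 0 := ((hasDerivAt_id 0).const_add x.im).sub_const z.im
    refine ((h.const_mul (-2)).congr_deriv (by norm_num)).congr_of_eventuallyEq (Eventually.of_forall fun r => ?_)
    simp
  rw [e1, e2]; norm_num

/-- Squared cutoff. -/
def zeta2 (z : ℂ) (R : ℝ) (x : ℂ) : ℝ := bump2 z R x * bump2 z R x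

theorem contDiff_zeta2 (z : ℂ) (R : ℝ) : ContDiff ℝ ∞ (zeta2 z R) :=
  (contDiff_bump2 z R).mul (contDiff_bump2 z R)

theorem dd_zeta2 (z : ℂ) (R : ℝ) (v x : ℂ) :
    dd v (zeta2 z R) x = 2 * bump2 z R x * dd v (bump2 z R) x := by
  unfold zeta2
  rw [dd_mul (contDiff_bump2 z R) (contDiff_bump2 z R)]
  ring

theorem Lap_zeta2 (z : ℂ) (R : ℝ) (x : ℂ) :
    Lap (zeta2 z R) x = 8 * ((x.re - z.re) ^ 2 + (x.im - z.im) ^ 2) - 8 * bump2 z R x := by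
  unfold zeta2
  rw [Lap_mul (contDiff_bump2 z R) (contDiff_bump2 z R), Lap_bump2, dd_one_bump2, dd_I_bump2]
  ring

variable {c : ℝ} {a b : ℂ → ℝ}

/-- `|u|²`. -/
def modSq (a b : ℂ → ℝ) (z : ℂ) : ℝ := a z * a z + b z * b z

theorem cw_eq (z : ℂ) : cw a b z = 1 - modSq a b z := by unfold cw modSq; ring

theorem contDiff_modSq (ha : ContDiff ℝ ∞ a) (hb : ContDiff ℝ ∞ b) : ContDiff ℝ ∞ (modSq a b) :=
  (ha.mul ha).add (hb.mul hb)

/-- `|∇u|²`. -/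
def gSq (a b : ℂ → ℝ) (z : ℂ) : ℝ :=
  dd 1 a z ^ 2 + dd 1 b z ^ 2 + dd Complex.I a z ^ 2 + dd Complex.I b z ^ 2

theorem dd_modSq (ha : ContDiff ℝ ∞ a) (hb : ContDiff ℝ ∞ b) (v z : ℂ) :
    dd v (modSq a b) z = 2 * (a z * dd v a z + b z * dd v b z) := by
  unfold modSq
  rw [dd_add (ha.mul ha) (hb.mul hb), dd_mul ha ha, dd_mul hb hb]
  ring

theorem Sol.Lap_modSq (h : Sol c a b) (z : ℂ) :
    Lap (modSq a b) z = 2 * (gSq a b z + c * (a z * dd Complex.I b z - b z * dd Complex.I a z)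
      - (1 - modSq a b z) * modSq a b z) := by
  have ha := h.smooth_a
  have hb := h.smooth_b
  have e1 : Lap a z = _ := h.eq_a z
  have e2 : Lap b z = _ := h.eq_b z
  have : Lap (modSq a b) z = Lap (fun x => a x * a x) z + Lap (fun x => b x * b x) z :=
    Lap_add (ha.mul ha) (hb.mul hb) z
  rw [this, Lap_mul ha ha, Lap_mul hb hb, e1, e2]
  unfold gSq modSq
  ring

theorem modSq_nonneg (z : ℂ) : 0 ≤ modSq a b z := by
  unfold modSq; nlinarith [sq_nonneg (a z), sq_nonneg (b z)]

theorem gSq_nonneg (z : ℂ) : 0 ≤ gSq a b z := by unfold gSq; positivity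

/-- Interior maximum on a disc. -/
theorem exists_max_disc {F : ℂ → ℝ} (hF : Continuous F) (z : ℂ) {r : ℝ} (hr : 0 ≤ r) :
    ∃ y, ‖y - z‖ ≤ r ∧ F z ≤ F y ∧ (‖y - z‖ < r → IsLocalMax F y) := by
  obtain ⟨y, hy, hmax⟩ := (isCompact_closedBall z r).exists_isMaxOn ⟨z, mem_closedBall_self hr⟩ hF.continuousOn
  refine ⟨y, by simpa [dist_eq_norm] using hy, hmax (mem_closedBall_self hr), fun hlt => ?_⟩
  exact hmax.isLocalMax (closedBall_mem_nhds_of_mem (by simpa [dist_eq_norm] using hlt))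

theorem cutoff_algebra {R η X Y q q1 q2 lq κ : ℝ} (hR : 0 < R) (hη : 0 < η) (hηR : η ≤ R) (hq : 0 ≤ q)
    (hκ : 0 ≤ κ) (e : η = R - (X ^ 2 + Y ^ 2)) (g1 : 2 * η * (-2 * X) * q + η * η * q1 = 0)
    (g2 : 2 * η * (-2 * Y) * q + η * η * q2 = 0)
    (L : (8 * (X ^ 2 + Y ^ 2) - 8 * η) * q + 2 * (2 * η * (-2 * X) * q1 + 2 * η * (-2 * Y) * q2) + η * η * lq ≤ 0)
    (hlq : 2 * q * (q - κ) ≤ lq) : η * η * q ≤ κ * R ^ 2 + 12 * R := by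
  have k1 : η * q1 = 4 * X * q := mul_left_cancel₀ hη.ne' (by linarith)
  have k2 : η * q2 = 4 * Y * q := mul_left_cancel₀ hη.ne' (by linarith)
  rcases hq.lt_or_eq with hqpos | hq0
  swap
  · rw [← hq0, mul_zero]; positivity
  have L2 : η * η * lq ≤ q * (24 * R) := by
    have e' : 2 * (2 * η * (-2 * X) * q1 + 2 * η * (-2 * Y) * q2) = -8 * (X * (η * q1) + Y * (η * q2)) := by ring
    rw [e', k1, k2] at L
    have e'' : X ^ 2 + Y ^ 2 = R - η := by linarith
    nlinarith [mul_nonneg hq hη.le]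
  have L3 : q * (η * η * (q - κ)) ≤ q * (12 * R) := by
    have := mul_le_mul_of_nonneg_left hlq (mul_pos hη hη).le
    linarith
  have L4 := le_of_mul_le_mul_left L3 hqpos
  have h5 : η * η ≤ R ^ 2 := by nlinarith
  have h6 := mul_le_mul_of_nonneg_left h5 hκ
  linarith

theorem Sol.modSq_le_aux (h : Sol c a b) (z : ℂ) {R : ℝ} (hR : 0 < R) :
    R ^ 2 * modSq a b z ≤ (1 + c ^ 2 / 4) * R ^ 2 + 12 * R := by
  have hq := contDiff_modSq h.smooth_a h.smooth_b
  have hζ := contDiff_zeta2 z R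
  obtain ⟨y, hy, hmax, hloc⟩ := exists_max_disc (hζ.mul hq).continuous z (Real.sqrt_nonneg R)
  have hz : zeta2 z R z = R ^ 2 := by simp [zeta2, bump2]; ring
  rw [hz] at hmax
  refine hmax.trans ?_
  set η := bump2 z R y with hη
  have hbump : η = R - ‖y - z‖ ^ 2 := bump2_eq z R y
  have hζy : zeta2 z R y = η * η := rfl
  have hq0 := modSq_nonneg (a := a) (b := b) y
  rcases hy.lt_or_eq with hlt | heq
  swap
  · have : η = 0 := by rw [hbump, heq, Real.sq_sqrt hR.le, sub_self]
    rw [hζy, this]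
    have : 0 ≤ (1 + c ^ 2 / 4) * R ^ 2 + 12 * R := by positivity
    simpa using this
  have ηpos : 0 < η := by
    rw [hbump]
    have := (sq_lt_sq₀ (norm_nonneg (y - z)) (Real.sqrt_nonneg R)).2 hlt
    rw [Real.sq_sqrt hR.le] at this
    linarith
  have ηle : η ≤ R := by rw [hbump]; nlinarith [norm_nonneg (y - z)]
  have hLm := hloc hlt
  have L := Lap_nonpos_of_isLocalMax (hζ.mul hq) hLm
  have g1 := dd_zero_of_isLocalMax hLm 1
  have g2 := dd_zero_of_isLocalMax hLm Complex.I
  rw [Lap_mul hζ hq, Lap_zeta2, dd_zeta2, dd_zeta2, hζy] at L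
  rw [dd_mul hζ hq] at g1 g2
  simp only [dd_zeta2, hζy, dd_one_bump2, dd_I_bump2, ← hη] at g1 g2 L
  have hLq : 2 * modSq a b y * (modSq a b y - (1 + c ^ 2 / 4)) ≤ Lap (modSq a b) y := by
    rw [h.Lap_modSq]
    have hg : dd Complex.I a y ^ 2 + dd Complex.I b y ^ 2 ≤ gSq a b y := by
      unfold gSq; nlinarith [sq_nonneg (dd 1 a y), sq_nonneg (dd 1 b y)]
    have hm : modSq a b y = a y * a y + b y * b y := rfl
    nlinarith [sq_nonneg (dd Complex.I b y + c / 2 * a y), sq_nonneg (dd Complex.I a y - c / 2 * b y)]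
  rw [hζy]
  exact cutoff_algebra hR ηpos ηle hq0 (by positivity) rfl g1 g2 L hLq

/-- Pointwise bound on the modulus. -/
theorem Sol.modSq_le (h : Sol c a b) (z : ℂ) : modSq a b z ≤ 1 + c ^ 2 / 4 := by
  refine le_of_forall_pos_le_add fun ε hε => ?_
  have := h.modSq_le_aux z (R := 12 / ε) (by positivity)
  have hR : 0 < (12 / ε) ^ 2 := by positivity
  refine le_of_mul_le_mul_left (this.trans_eq ?_) hR
  field_simp

end Bernstein

section Gradient

variable {c : ℝ} {a b : ℂ → ℝ}

theorem dd_Lap {f : ℂ → ℝ} (hf : ContDiff ℝ ∞ f) (v z : ℂ) : Lap (dd v f) z = dd v (Lap f) z := by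
  have h1 : ContDiff ℝ ∞ (dd 1 f) := contDiff_dd hf
  have h2 : ContDiff ℝ ∞ (dd Complex.I f) := contDiff_dd hf
  unfold Lap
  rw [dd_add (contDiff_dd h1) (contDiff_dd h2), dd_comm (v := 1) (v' := v) hf,
    dd_comm (v := Complex.I) (v' := v) hf, dd_comm (v := 1) (v' := v) h1,
    dd_comm (v := Complex.I) (v' := v) h2]

theorem dd_const_mul {f : ℂ → ℝ} (hf : ContDiff ℝ ∞ f) (r : ℝ) (v : ℂ) :
    dd v (fun x => r * f x) = fun x => r * dd v f x := by
  rw [dd_mul (f := fun _ => r) contDiff_const hf, dd_const]; simp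

theorem dd_cw (ha : ContDiff ℝ ∞ a) (hb : ContDiff ℝ ∞ b) (v z : ℂ) :
    dd v (cw a b) z = -2 * (a z * dd v a z + b z * dd v b z) := by
  have : cw a b = fun x => 1 + (-1) * modSq a b x := by funext x; rw [cw_eq]; ring
  have hm := contDiff_modSq ha hb
  rw [this, dd_add (f := fun _ => 1) contDiff_const (contDiff_const.mul hm), dd_const, dd_const_mul hm]
  simp only [dd_modSq ha hb]
  ring

theorem contDiff_cw (ha : ContDiff ℝ ∞ a) (hb : ContDiff ℝ ∞ b) : ContDiff ℝ ∞ (cw a b) := by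
  have : cw a b = fun x => 1 - modSq a b x := by funext x; rw [cw_eq]
  rw [this]
  exact contDiff_const.sub (contDiff_modSq ha hb)

theorem Sol.Lap_dd_a (h : Sol c a b) (v z : ℂ) :
    Lap (dd v a) z = c * dd v (dd Complex.I b) z - cw a b z * dd v a z
      + 2 * (a z * dd v a z + b z * dd v b z) * a z := by
  have hw := contDiff_cw h.smooth_a h.smooth_b
  have h2 : ContDiff ℝ ∞ (dd Complex.I b) := contDiff_dd h.smooth_b
  have e : Lap a = fun x => c * dd Complex.I b x + (-1) * (cw a b x * a x) := by
    funext x; rw [show Lap a x = _ from h.eq_a x]; unfold cw; ring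
  rw [dd_Lap h.smooth_a, e, dd_add (contDiff_const.mul h2) (contDiff_const.mul (hw.mul h.smooth_a)),
    dd_const_mul h2, dd_const_mul (hw.mul h.smooth_a), dd_mul hw h.smooth_a]
  simp only [dd_cw h.smooth_a h.smooth_b]
  ring

theorem Sol.Lap_dd_b (h : Sol c a b) (v z : ℂ) :
    Lap (dd v b) z = -c * dd v (dd Complex.I a) z - cw a b z * dd v b z
      + 2 * (a z * dd v a z + b z * dd v b z) * b z := by
  have hw := contDiff_cw h.smooth_a h.smooth_b
  have h2 : ContDiff ℝ ∞ (dd Complex.I a) := contDiff_dd h.smooth_a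
  have e : Lap b = fun x => (-c) * dd Complex.I a x + (-1) * (cw a b x * b x) := by
    funext x; rw [show Lap b x = _ from h.eq_b x]; unfold cw; ring
  rw [dd_Lap h.smooth_b, e, dd_add (contDiff_const.mul h2) (contDiff_const.mul (hw.mul h.smooth_b)),
    dd_const_mul h2, dd_const_mul (hw.mul h.smooth_b), dd_mul hw h.smooth_b]
  simp only [dd_cw h.smooth_a h.smooth_b]
  ring

/-- Squared norm of the Hessian of a real function. -/
def hSq (f : ℂ → ℝ) (z : ℂ) : ℝ :=
  dd 1 (dd 1 f) z ^ 2 + 2 * dd 1 (dd Complex.I f) z ^ 2 + dd Complex.I (dd Complex.I f) z ^ 2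

theorem hSq_nonneg (f : ℂ → ℝ) (z : ℂ) : 0 ≤ hSq f z := by unfold hSq; positivity

theorem contDiff_gSq (ha : ContDiff ℝ ∞ a) (hb : ContDiff ℝ ∞ b) : ContDiff ℝ ∞ (gSq a b) := by
  have h1 : ContDiff ℝ ∞ (dd 1 a) := contDiff_dd ha
  have h2 : ContDiff ℝ ∞ (dd Complex.I a) := contDiff_dd ha
  have h3 : ContDiff ℝ ∞ (dd 1 b) := contDiff_dd hb
  have h4 : ContDiff ℝ ∞ (dd Complex.I b) := contDiff_dd hb
  unfold gSq
  fun_prop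

theorem gSq_split : gSq a b = fun x => dd 1 a x * dd 1 a x + dd 1 b x * dd 1 b x +
    (dd Complex.I a x * dd Complex.I a x + dd Complex.I b x * dd Complex.I b x) := by
  funext x; unfold gSq; ring

theorem dd_gSq (ha : ContDiff ℝ ∞ a) (hb : ContDiff ℝ ∞ b) (v z : ℂ) :
    dd v (gSq a b) z = 2 * (dd 1 a z * dd v (dd 1 a) z + dd 1 b z * dd v (dd 1 b) z
      + dd Complex.I a z * dd v (dd Complex.I a) z + dd Complex.I b z * dd v (dd Complex.I b) z) := by
  have h1 : ContDiff ℝ ∞ (dd 1 a) := contDiff_dd ha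
  have h2 : ContDiff ℝ ∞ (dd Complex.I a) := contDiff_dd ha
  have h3 : ContDiff ℝ ∞ (dd 1 b) := contDiff_dd hb
  have h4 : ContDiff ℝ ∞ (dd Complex.I b) := contDiff_dd hb
  rw [gSq_split, dd_add ((h1.mul h1).add (h3.mul h3)) ((h2.mul h2).add (h4.mul h4)),
    dd_add (h1.mul h1) (h3.mul h3), dd_add (h2.mul h2) (h4.mul h4), dd_mul h1 h1, dd_mul h2 h2,
    dd_mul h3 h3, dd_mul h4 h4]
  ring

theorem Lap_gSq (ha : ContDiff ℝ ∞ a) (hb : ContDiff ℝ ∞ b) (z : ℂ) :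
    Lap (gSq a b) z = 2 * (hSq a z + hSq b z + (dd 1 a z * Lap (dd 1 a) z + dd 1 b z * Lap (dd 1 b) z
      + dd Complex.I a z * Lap (dd Complex.I a) z + dd Complex.I b z * Lap (dd Complex.I b) z)) := by
  have h1 : ContDiff ℝ ∞ (dd 1 a) := contDiff_dd ha
  have h2 : ContDiff ℝ ∞ (dd Complex.I a) := contDiff_dd ha
  have h3 : ContDiff ℝ ∞ (dd 1 b) := contDiff_dd hb
  have h4 : ContDiff ℝ ∞ (dd Complex.I b) := contDiff_dd hb
  rw [gSq_split, Lap_add ((h1.mul h1).add (h3.mul h3)) ((h2.mul h2).add (h4.mul h4)),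
    Lap_add (h1.mul h1) (h3.mul h3), Lap_add (h2.mul h2) (h4.mul h4), Lap_mul h1 h1, Lap_mul h2 h2,
    Lap_mul h3 h3, Lap_mul h4 h4]
  have ca : dd Complex.I (dd 1 a) = dd 1 (dd Complex.I a) := dd_comm ha
  have cb : dd Complex.I (dd 1 b) = dd 1 (dd Complex.I b) := dd_comm hb
  simp only [ca, cb, hSq]
  ring

/-- Bochner-type inequality. -/
theorem Sol.Lap_gSq_ge (h : Sol c a b) (hc : 0 ≤ c) (hc' : c ≤ 1) (z : ℂ) :
    hSq a z + hSq b z - 3 * gSq a b z ≤ Lap (gSq a b) z := by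
  rw [Lap_gSq h.smooth_a h.smooth_b, h.Lap_dd_a, h.Lap_dd_a, h.Lap_dd_b, h.Lap_dd_b]
  have hw : cw a b z ≤ 1 := by rw [cw_eq]; linarith [modSq_nonneg (a := a) (b := b) z]
  unfold hSq gSq
  have key : ∀ p q : ℝ, -(p ^ 2 + q ^ 2) ≤ 2 * (c * (p * q)) := fun p q => by
    nlinarith [sq_nonneg (p + c * q), mul_nonneg hc (sq_nonneg q), sq_nonneg q, mul_le_mul hc' hc' hc zero_le_one]
  have key' : ∀ p q : ℝ, -(p ^ 2 + q ^ 2) ≤ -(2 * (c * (p * q))) := fun p q => by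
    have := key (-p) q; nlinarith
  have k1 := key (dd 1 a z) (dd 1 (dd Complex.I b) z)
  have k2 := key (dd Complex.I a z) (dd Complex.I (dd Complex.I b) z)
  have k3 := key' (dd 1 b z) (dd 1 (dd Complex.I a) z)
  have k4 := key' (dd Complex.I b z) (dd Complex.I (dd Complex.I a) z)
  have s1 := sq_nonneg (a z * dd 1 a z + b z * dd 1 b z)
  have s2 := sq_nonneg (a z * dd Complex.I a z + b z * dd Complex.I b z)
  have w1 := mul_le_mul_of_nonneg_right hw (sq_nonneg (dd 1 a z))
  have w2 := mul_le_mul_of_nonneg_right hw (sq_nonneg (dd 1 b z))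
  have w3 := mul_le_mul_of_nonneg_right hw (sq_nonneg (dd Complex.I a z))
  have w4 := mul_le_mul_of_nonneg_right hw (sq_nonneg (dd Complex.I b z))
  have q1 := sq_nonneg (dd 1 (dd 1 a) z)
  have q2 := sq_nonneg (dd 1 (dd 1 b) z)
  have q3 := sq_nonneg (dd Complex.I (dd Complex.I a) z)
  have q4 := sq_nonneg (dd Complex.I (dd Complex.I b) z)
  have q5 := sq_nonneg (dd 1 (dd Complex.I a) z)
  have q6 := sq_nonneg (dd 1 (dd Complex.I b) z)
  linear_combination k1 + k2 + k3 + k4 + 4 * s1 + 4 * s2 + 2 * w1 + 2 * w2 + 2 * w3 + 2 * w4 + q1 + q2 + q5 + q6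

theorem Sol.modSq_le_five_fourths (h : Sol c a b) (hc : 0 ≤ c) (hc' : c ≤ 1) (z : ℂ) :
    modSq a b z ≤ 5 / 4 := by
  have := h.modSq_le z
  nlinarith

theorem Sol.Lap_modSq_ge (h : Sol c a b) (hc : 0 ≤ c) (hc' : c ≤ 1) (z : ℂ) :
    gSq a b z - 4 ≤ Lap (modSq a b) z := by
  rw [h.Lap_modSq]
  have hm := h.modSq_le_five_fourths hc hc' z
  have hq : modSq a b z = a z * a z + b z * b z := rfl
  have hq0 := modSq_nonneg (a := a) (b := b) z
  have hc2 : c ^ 2 ≤ 1 := by nlinarith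
  have k1 : -(dd Complex.I b z ^ 2 + a z ^ 2) ≤ 2 * (c * (a z * dd Complex.I b z)) := by
    nlinarith [sq_nonneg (dd Complex.I b z + c * a z), mul_le_mul_of_nonneg_right hc2 (sq_nonneg (a z))]
  have k2 : -(dd Complex.I a z ^ 2 + b z ^ 2) ≤ -(2 * (c * (b z * dd Complex.I a z))) := by
    nlinarith [sq_nonneg (dd Complex.I a z - c * b z), mul_le_mul_of_nonneg_right hc2 (sq_nonneg (b z))]
  have e : gSq a b z = dd 1 a z ^ 2 + dd 1 b z ^ 2 + dd Complex.I a z ^ 2 + dd Complex.I b z ^ 2 := rfl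
  have := sq_nonneg (dd 1 a z)
  have := sq_nonneg (dd 1 b z)
  nlinarith [mul_nonneg hq0 hq0]

theorem gradient_algebra {η X Y G q H G1 G2 lG lq : ℝ} (hη1 : η ≤ 1) (hη : 0 ≤ η)
    (e : η = 1 - (X ^ 2 + Y ^ 2)) (hG : 0 ≤ G) (hH : 0 ≤ H) (hq : q ≤ 5 / 4)
    (c1 : G1 ^ 2 + G2 ^ 2 ≤ 4 * G * H)
    (L : (8 * (X ^ 2 + Y ^ 2) - 8 * η) * G + 2 * (2 * η * (-2 * X) * G1 + 2 * η * (-2 * Y) * G2)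
      + η * η * lG + 76 * lq ≤ 0)
    (h1 : H - 3 * G ≤ lG) (h2 : G - 4 ≤ lq) : η * η * G + 76 * q ≤ 400 := by
  have hX : X ^ 2 + Y ^ 2 ≤ 1 := by linarith
  have cs : (X * G1 + Y * G2) ^ 2 ≤ 4 * G * H := by
    have : (X * G1 + Y * G2) ^ 2 ≤ (X ^ 2 + Y ^ 2) * (G1 ^ 2 + G2 ^ 2) := by
      nlinarith [sq_nonneg (X * G2 - Y * G1)]
    nlinarith [mul_nonneg hG hH, sq_nonneg G1, sq_nonneg G2]
  have cs' : 8 * (η * (X * G1 + Y * G2)) ≤ η * η * H + 64 * G := by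
    by_contra! hlt
    have h0 : 0 ≤ η * η * H + 64 * G := by positivity
    have : (η * η * H + 64 * G) ^ 2 < (8 * (η * (X * G1 + Y * G2))) ^ 2 := pow_lt_pow_left₀ hlt h0 two_ne_zero
    have : (8 * (η * (X * G1 + Y * G2))) ^ 2 ≤ 256 * (η * η) * G * H := by
      have := mul_le_mul_of_nonneg_left cs (mul_nonneg hη hη)
      nlinarith
    nlinarith [sq_nonneg (η * η * H - 64 * G)]
  have h1' := mul_le_mul_of_nonneg_left h1 (mul_nonneg hη hη)
  have hηη : η * η ≤ 1 := by nlinarith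
  have i1 : 0 ≤ G * (1 - η * η) := mul_nonneg hG (sub_nonneg.2 hηη)
  have i2 : 0 ≤ G * (1 - η) := mul_nonneg hG (sub_nonneg.2 hη1)
  have e1 : X ^ 2 + Y ^ 2 = 1 - η := by linarith
  rw [e1] at L
  have h3 : G ≤ 304 := by nlinarith
  nlinarith

/-- Universal gradient bound. -/
theorem Sol.gSq_le (h : Sol c a b) (hc : 0 ≤ c) (hc' : c ≤ 1) (z : ℂ) : gSq a b z ≤ 400 := by
  have hq := contDiff_modSq h.smooth_a h.smooth_b
  have hG := contDiff_gSq h.smooth_a h.smooth_b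
  have hζ := contDiff_zeta2 z 1
  have hF : ContDiff ℝ ∞ (fun x => zeta2 z 1 x * gSq a b x + 76 * modSq a b x) :=
    (hζ.mul hG).add (contDiff_const.mul hq)
  obtain ⟨y, hy, hmax, hloc⟩ := exists_max_disc hF.continuous z zero_le_one
  have hz : zeta2 z 1 z = 1 := by simp [zeta2, bump2]
  rw [hz, one_mul] at hmax
  suffices hs : zeta2 z 1 y * gSq a b y + 76 * modSq a b y ≤ 400 by
    linarith [modSq_nonneg (a := a) (b := b) z]
  have hm := h.modSq_le_five_fourths hc hc' y
  set η := bump2 z 1 y with hη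
  have hbump : η = 1 - ‖y - z‖ ^ 2 := bump2_eq z 1 y
  have hζy : zeta2 z 1 y = η * η := rfl
  rcases hy.lt_or_eq with hlt | heq
  swap
  · have : η = 0 := by rw [hbump, heq]; norm_num
    rw [hζy, this]
    linarith
  have L := Lap_nonpos_of_isLocalMax hF (hloc hlt)
  have eL : Lap (fun x => 76 * modSq a b x) y = 76 * Lap (modSq a b) y := by
    rw [Lap_mul (f := fun _ => (76:ℝ)) contDiff_const hq]
    simp [Lap, dd_const]
  rw [Lap_add (hζ.mul hG) (contDiff_const.mul hq), Lap_mul hζ hG, Lap_zeta2, dd_zeta2, dd_zeta2, hζy, eL] at L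
  simp only [dd_one_bump2, dd_I_bump2, ← hη] at L
  rw [hζy]
  refine gradient_algebra (X := y.re - z.re) (Y := y.im - z.im) (by rw [hbump]; nlinarith [norm_nonneg (y - z)])
    (by rw [hbump]; nlinarith [norm_nonneg (y - z)]) rfl (gSq_nonneg y)
    (add_nonneg (hSq_nonneg a y) (hSq_nonneg b y)) hm ?_ L (h.Lap_gSq_ge hc hc' y) (h.Lap_modSq_ge hc hc' y)
  rw [dd_gSq h.smooth_a h.smooth_b, dd_gSq h.smooth_a h.smooth_b]
  have ca : dd Complex.I (dd 1 a) = dd 1 (dd Complex.I a) := dd_comm h.smooth_a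
  have cb : dd Complex.I (dd 1 b) = dd 1 (dd Complex.I b) := dd_comm h.smooth_b
  simp only [ca, cb, hSq, gSq]
  have cs : ∀ p q r s x y z w : ℝ, (2 * (p * x + q * y + r * z + s * w)) ^ 2 ≤
      4 * (p ^ 2 + q ^ 2 + r ^ 2 + s ^ 2) * (x ^ 2 + y ^ 2 + z ^ 2 + w ^ 2) := fun p q r s x y z w => by
    nlinarith [sq_nonneg (p * y - q * x), sq_nonneg (p * z - r * x), sq_nonneg (p * w - s * x),
      sq_nonneg (q * z - r * y), sq_nonneg (q * w - s * y), sq_nonneg (r * w - s * z)]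
  refine (add_le_add (cs _ _ _ _ _ _ _ _) (cs _ _ _ _ _ _ _ _)).trans_eq ?_
  ring

theorem Sol.abs_cw_le_one (h : Sol c a b) (hc : 0 ≤ c) (hc' : c ≤ 1) (z : ℂ) : |cw a b z| ≤ 1 := by
  have h1 := h.modSq_le_five_fourths hc hc' z
  have h2 := modSq_nonneg (a := a) (b := b) z
  rw [cw_eq, abs_le]
  constructor <;> linarith

theorem Sol.cw_lipschitz (h : Sol c a b) (hc : 0 ≤ c) (hc' : c ≤ 1) (x y : ℂ) :
    |cw a b x - cw a b y| ≤ 45 * ‖x - y‖ := by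
  have hw := contDiff_cw h.smooth_a h.smooth_b
  have hd : ∀ z, ‖fderiv ℝ (cw a b) z‖ ≤ 45 := by
    intro z
    refine ContinuousLinearMap.opNorm_le_bound _ (by norm_num) fun v => ?_
    change ‖dd v (cw a b) z‖ ≤ _
    have hm := h.modSq_le_five_fourths hc hc' z
    have hm0 := modSq_nonneg (a := a) (b := b) z
    have hg := h.gSq_le hc hc' z
    rw [dd_vec, dd_cw h.smooth_a h.smooth_b, dd_cw h.smooth_a h.smooth_b, Real.norm_eq_abs]
    refine abs_le_of_sq_le_sq ?_ (by positivity)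
    have hv : ‖v‖ ^ 2 = v.re ^ 2 + v.im ^ 2 := by rw [Complex.sq_norm, Complex.normSq_apply]; ring
    set A := a z * dd 1 a z + b z * dd 1 b z with hA
    set B := a z * dd Complex.I a z + b z * dd Complex.I b z with hB
    have h1 : (v.re * A + v.im * B) ^ 2 ≤ (v.re ^ 2 + v.im ^ 2) * (A ^ 2 + B ^ 2) := by
      nlinarith [sq_nonneg (v.re * B - v.im * A)]
    have h2 : A ^ 2 + B ^ 2 ≤ modSq a b z * gSq a b z := by
      simp only [hA, hB, modSq, gSq]
      nlinarith [sq_nonneg (a z * dd 1 b z - b z * dd 1 a z),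
        sq_nonneg (a z * dd Complex.I b z - b z * dd Complex.I a z)]
    have h3 : modSq a b z * gSq a b z ≤ 5 / 4 * 400 := mul_le_mul hm hg (gSq_nonneg z) (by norm_num)
    have h4 : 0 ≤ v.re ^ 2 + v.im ^ 2 := by positivity
    rw [mul_pow, hv]
    nlinarith [mul_le_mul_of_nonneg_left (h2.trans h3) h4]
  have := Convex.norm_image_sub_le_of_norm_fderiv_le (𝕜 := ℝ) (f := cw a b) (C := 45) (s := Set.univ)
    (fun z _ => smooth_differentiable hw z) (fun z _ => hd z) convex_univ (Set.mem_univ y) (Set.mem_univ x)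
  simpa using this

/-- A deviation of the modulus costs potential energy. -/
theorem Sol.cw_pow_le_pot (h : Sol c a b) (hc : 0 ≤ c) (hc' : c ≤ 1) (z : ℂ) :
    cw a b z ^ 4 ≤ 100000 * pot a b z 1 := by
  set t := |cw a b z| with ht
  have t1 : t ≤ 1 := h.abs_cw_le_one hc hc' z
  have t0 : 0 ≤ t := abs_nonneg _
  have hcont : Continuous fun x => 1 / 2 * cw a b x ^ 2 := by
    have := continuous_cw h.smooth_a h.smooth_b; fun_prop
  have h1 : pot a b z (t / 90) ≤ pot a b z 1 :=
    pot_mono h.smooth_a h.smooth_b (closedBall_subset_closedBall (by linarith))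
  have h2 : (t ^ 2 / 8) * (Real.pi * (t / 90) ^ 2) ≤ pot a b z (t / 90) := by
    have hv : volume.real (closedBall z (t / 90)) = Real.pi * (t / 90) ^ 2 := by
      rw [Measure.real, Complex.volume_closedBall, ENNReal.toReal_mul, ENNReal.toReal_pow,
        ENNReal.toReal_ofReal (by positivity), ENNReal.coe_toReal, NNReal.coe_real_pi]
      ring
    have := setIntegral_mono_on (μ := volume) (s := closedBall z (t / 90)) (f := fun _ => t ^ 2 / 8)
      (g := fun x => 1 / 2 * cw a b x ^ 2)
      (integrableOn_const (isCompact_closedBall _ _).measure_lt_top.ne)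
      (hcont.continuousOn.integrableOn_compact (isCompact_closedBall _ _))
      isClosed_closedBall.measurableSet ?_
    · rw [setIntegral_const, smul_eq_mul, hv] at this
      unfold pot
      linarith
    · intro x hx
      rw [mem_closedBall, dist_eq_norm] at hx
      have l := h.cw_lipschitz hc hc' z x
      rw [norm_sub_rev] at l
      have : t ≤ |cw a b x| + |cw a b z - cw a b x| := by
        have := abs_add_le (cw a b x) (cw a b z - cw a b x)
        rwa [add_sub_cancel] at this
      have h5 : t / 2 ≤ |cw a b x| := by linarith
      have := pow_le_pow_left₀ (by positivity) h5 2
      rw [sq_abs] at this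
      show t ^ 2 / 8 ≤ 1 / 2 * cw a b x ^ 2
      linarith
  have h3 : cw a b z ^ 4 = t ^ 4 := by
    rw [ht, show (4:ℕ) = 2 * 2 from rfl, pow_mul, pow_mul, sq_abs]
  rw [h3]
  have h4 := Real.pi_gt_three
  nlinarith [pow_nonneg t0 4]

end Gradient

section Divergence

/-- A fixed smooth cutoff on the line. -/
def cut : ContDiffBump (0 : ℝ) := ⟨1, 2, one_pos, one_lt_two⟩

theorem contDiff_cut : ContDiff ℝ ∞ (cut : ℝ → ℝ) := cut.contDiff

theorem cut_one {s : ℝ} (h : |s| ≤ 1) : cut s = 1 :=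
  cut.one_of_mem_closedBall (by simpa [cut, dist_eq_norm] using h)

theorem cut_zero {s : ℝ} (h : 2 ≤ |s|) : cut s = 0 :=
  cut.zero_of_le_dist (by simpa [cut, dist_eq_norm] using h)

theorem cut_abs_le (s : ℝ) : |cut s| ≤ 1 := by
  rw [abs_of_nonneg cut.nonneg]; exact cut.le_one

theorem cut_deriv_zero {s : ℝ} (h : 2 < |s|) : deriv cut s = 0 := by
  have : (cut : ℝ → ℝ) =ᶠ[𝓝 s] fun _ => 0 := by
    filter_upwards [(isOpen_lt continuous_const continuous_abs).mem_nhds h] with t ht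
    exact cut_zero (le_of_lt ht)
  rw [this.deriv_eq]; simp

theorem exists_cut_deriv_bound : ∃ N, 0 ≤ N ∧ ∀ s, |deriv cut s| ≤ N := by
  have hc : Continuous (deriv cut) := contDiff_cut.continuous_deriv (by simp)
  obtain ⟨N, hN⟩ := (isCompact_closedBall (0:ℝ) 2).exists_bound_of_continuousOn hc.continuousOn
  refine ⟨|N|, abs_nonneg N, fun s => ?_⟩
  by_cases h : 2 < |s|
  · rw [cut_deriv_zero h]; simp
  · exact (hN s (by simpa using h)).trans (le_abs_self N)

theorem dd_comp_clm {E : Type*} [NormedAddCommGroup E] [NormedSpace ℝ E] {k : ℝ → ℝ}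
    (hk : ContDiff ℝ ∞ k) (l : E →L[ℝ] ℝ) (v x : E) :
    dd v (fun x => k (l x)) x = deriv k (l x) * l v := by
  have h1 : HasDerivAt k (deriv k (l x)) (l x) := (hk.differentiable (by simp) _).hasDerivAt
  have := (h1.comp_hasFDerivAt x l.hasFDerivAt).fderiv
  unfold dd
  erw [this]
  simp

theorem integral_dd_mul_compact {P φ : ℂ → ℝ} (hP : ContDiff ℝ ∞ P) (hφ : ContDiff ℝ ∞ φ)
    (hs : HasCompactSupport φ) (v : ℂ) : ∫ x, dd v P x * φ x = -∫ x, P x * dd v φ x := by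
  have cP := hP.continuous
  have cφ := hφ.continuous
  have cP' := (contDiff_dd (v := v) hP).continuous
  have cφ' := (contDiff_dd (v := v) hφ).continuous
  have hs' : HasCompactSupport (dd v φ) := by
    have : HasCompactSupport (fun x => fderiv ℝ φ x v) := hs.fderiv_apply (𝕜 := ℝ) v
    exact this
  have := integral_mul_fderiv_eq_neg_fderiv_mul_of_integrable (𝕜 := ℝ) (μ := (volume : Measure ℂ)) (v := v) (f := P) (g := φ)
    ((cP'.mul cφ).integrable_of_hasCompactSupport hs.mul_left)
    ((cP.mul cφ').integrable_of_hasCompactSupport hs'.mul_left)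
    ((cP.mul cφ).integrable_of_hasCompactSupport hs.mul_left)
    (fun x _ => smooth_differentiable hP x) (fun x _ => smooth_differentiable hφ x)
  unfold dd
  rw [this, neg_neg]

theorem sqrt_le_young {g m : ℝ} (hg : 0 ≤ g) (hm : 0 < m) : Real.sqrt g ≤ m * g + 1 / m := by
  have h := Real.sq_sqrt hg
  have h1 : 0 ≤ (m * Real.sqrt g - 1) ^ 2 / m := by positivity
  have h2 : (m * Real.sqrt g - 1) ^ 2 / m = m * g - 2 * Real.sqrt g + 1 / m := by
    field_simp
    linear_combination m ^ 2 * h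
  have := Real.sqrt_nonneg g
  linarith

/-- A pair of orthogonal coordinates on the plane. -/
structure Coords (v v' : ℂ) (l l' : ℂ →L[ℝ] ℝ) : Prop where
  l_v : l v = 1
  l_v' : l v' = 0
  l'_v : l' v = 0
  l'_v' : l' v' = 1
  norm_le : ∀ x, ‖x‖ ≤ |l x| + |l' x|
  vol : ∀ A B : ℝ, 0 ≤ A → 0 ≤ B → volume {x : ℂ | |l x| ≤ A ∧ |l' x| ≤ B} = ENNReal.ofReal (4 * A * B)

theorem volume_box (A B : ℝ) (hA : 0 ≤ A) :
    volume {x : ℂ | |x.re| ≤ A ∧ |x.im| ≤ B} = ENNReal.ofReal (4 * A * B) := by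
  have h := Complex.volume_preserving_equiv_real_prod.measure_preimage
    (s := Set.Icc (-A) A ×ˢ Set.Icc (-B) B) (measurableSet_Icc.prod measurableSet_Icc).nullMeasurableSet
  rw [Measure.volume_eq_prod, Measure.prod_prod, Real.volume_Icc, Real.volume_Icc,
    ← ENNReal.ofReal_mul (by linarith)] at h
  rw [show 4 * A * B = (A - -A) * (B - -B) by ring, ← h]
  congr 1
  ext x
  simp [Complex.measurableEquivRealProd_apply, abs_le, and_assoc]
  tauto

theorem coords_re_im : Coords 1 Complex.I Complex.reCLM Complex.imCLM where
  l_v := by simp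
  l_v' := by simp
  l'_v := by simp
  l'_v' := by simp
  norm_le x := by simpa using Complex.norm_le_abs_re_add_abs_im x
  vol A B hA _ := by simpa using volume_box A B hA

theorem coords_im_re : Coords Complex.I 1 Complex.imCLM Complex.reCLM where
  l_v := by simp
  l_v' := by simp
  l'_v := by simp
  l'_v' := by simp
  norm_le x := by simpa [add_comm] using Complex.norm_le_abs_re_add_abs_im x
  vol A B _ hB := by
    have := volume_box B A hB
    simp only [Complex.imCLM_apply, Complex.reCLM_apply]
    rw [show 4 * A * B = 4 * B * A by ring, ← this]
    congr 1; ext x; simp [and_comm]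

/-- A closed field whose relevant component is integrable has zero flux. -/
theorem integral_eq_zero_of_closed {v v' : ℂ} {l l' : ℂ →L[ℝ] ℝ} (hco : Coords v v' l l')
    {P Q g : ℂ → ℝ} (hP : ContDiff ℝ ∞ P) (hQ : ContDiff ℝ ∞ Q) (hPQ : ∀ x, dd v P x = dd v' Q x)
    (hPI : Integrable P) (hg : Integrable g) (hg0 : ∀ x, 0 ≤ g x) {K : ℝ} (hK : 0 ≤ K)
    (hQg : ∀ x, |Q x| ≤ K * (g x + Real.sqrt (g x))) : ∫ x, P x = 0 := by
  obtain ⟨N, N0, hN⟩ := exists_cut_deriv_bound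
  set R : ℕ → ℝ := fun n => n + 1 with hR
  have R1 : ∀ n, 1 ≤ R n := fun n => by simp [hR]
  have Rlim : Tendsto R atTop atTop :=
    tendsto_atTop_add_const_right _ _ tendsto_natCast_atTop_atTop
  set F1 : ℕ → ℝ → ℝ := fun n s => s * cut (s / R n) with hF1
  set F2 : ℕ → ℝ → ℝ := fun n s => cut (s / R n ^ 5) with hF2
  have sF1 : ∀ n, ContDiff ℝ ∞ (F1 n) := fun n => contDiff_id.mul (contDiff_cut.comp (contDiff_id.div_const _))
  have sF2 : ∀ n, ContDiff ℝ ∞ (F2 n) := fun n => contDiff_cut.comp (contDiff_id.div_const _)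
  have dF1 : ∀ n s, deriv (F1 n) s = cut (s / R n) + s / R n * deriv cut (s / R n) := by
    intro n s
    have h1 : HasDerivAt cut (deriv cut (s / R n)) (s / R n) := (contDiff_cut.differentiable (by simp) _).hasDerivAt
    have h2 := (hasDerivAt_id s).mul (h1.comp s ((hasDerivAt_id s).div_const (R n)))
    rw [show F1 n = (id * (cut ∘ fun s => id s / R n)) from rfl, h2.deriv]
    simp only [id, Function.comp]
    have := (lt_of_lt_of_le one_pos (R1 n)).ne'
    field_simp
  have dF2 : ∀ n s, deriv (F2 n) s = deriv cut (s / R n ^ 5) / R n ^ 5 := by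
    intro n s
    have h1 : HasDerivAt cut (deriv cut (s / R n ^ 5)) (s / R n ^ 5) :=
      (contDiff_cut.differentiable (by simp) _).hasDerivAt
    have h2 := h1.comp s ((hasDerivAt_id s).div_const (R n ^ 5))
    rw [show F2 n = (cut ∘ fun s => id s / R n ^ 5) from rfl, h2.deriv]
    simp [div_eq_mul_inv]
  set φ : ℕ → ℂ → ℝ := fun n x => F1 n (l x) * F2 n (l' x) with hφ
  have s1 : ∀ n, ContDiff ℝ ∞ fun x => F1 n (l x) := fun n => (sF1 n).comp l.contDiff
  have s2 : ∀ n, ContDiff ℝ ∞ fun x => F2 n (l' x) := fun n => (sF2 n).comp l'.contDiff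
  have sφ : ∀ n, ContDiff ℝ ∞ (φ n) := fun n => (s1 n).mul (s2 n)
  have dφ : ∀ n x, dd v (φ n) x = deriv (F1 n) (l x) * F2 n (l' x) := by
    intro n x
    simp only [hφ]
    rw [dd_mul (s1 n) (s2 n)]
    simp only [dd_comp_clm (sF1 n), dd_comp_clm (sF2 n), hco.l_v, hco.l'_v]; ring
  have dφ' : ∀ n x, dd v' (φ n) x = F1 n (l x) * deriv (F2 n) (l' x) := by
    intro n x
    simp only [hφ]
    rw [dd_mul (s1 n) (s2 n)]
    simp only [dd_comp_clm (sF1 n), dd_comp_clm (sF2 n), hco.l_v', hco.l'_v']; ring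
  have Rpos : ∀ n, 0 < R n := fun n => lt_of_lt_of_le one_pos (R1 n)
  have habs : ∀ (s r : ℝ), 0 < r → |s / r| = |s| / r := fun s r hr => by rw [abs_div, abs_of_pos hr]
  have F1z : ∀ n s, 2 * R n ≤ |s| → F1 n s = 0 := by
    intro n s h
    simp only [hF1]
    rw [cut_zero (by rw [habs _ _ (Rpos n), le_div_iff₀ (Rpos n)]; exact h), mul_zero]
  have F2z : ∀ n s, 2 * R n ^ 5 ≤ |s| → F2 n s = 0 := by
    intro n s h
    have := pow_pos (Rpos n) 5
    simp only [hF2]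
    exact cut_zero (by rw [habs _ _ this, le_div_iff₀ this]; exact h)
  have cs : ∀ n, HasCompactSupport (φ n) := by
    intro n
    refine HasCompactSupport.intro (isCompact_closedBall (0:ℂ) (2 * R n + 2 * R n ^ 5)) fun x hx => ?_
    rw [mem_closedBall, dist_zero_right, not_le] at hx
    have := hco.norm_le x
    by_cases h : 2 * R n ≤ |l x|
    · simp only [hφ, F1z n _ h, zero_mul]
    · have : 2 * R n ^ 5 ≤ |l' x| := by linarith [not_le.1 h]
      simp only [hφ, F2z n _ this, mul_zero]
  have ident : ∀ n, ∫ x, P x * dd v (φ n) x = ∫ x, Q x * dd v' (φ n) x := by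
    intro n
    have e1 := integral_dd_mul_compact hP (sφ n) (cs n) v
    have e2 := integral_dd_mul_compact hQ (sφ n) (cs n) v'
    simp only [hPQ] at e1
    linarith
  have lim1 : Tendsto (fun n => ∫ x, P x * dd v (φ n) x) atTop (𝓝 (∫ x, P x)) := by
    refine tendsto_integral_of_dominated_convergence (fun x => (1 + 2 * N) * |P x|) ?_ ?_ ?_ ?_
    · intro n
      exact (hP.continuous.mul (contDiff_dd (sφ n)).continuous).aestronglyMeasurable
    · exact hPI.abs.const_mul _
    · intro n
      refine Eventually.of_forall fun x => ?_
      rw [Real.norm_eq_abs, abs_mul, mul_comm]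
      refine mul_le_mul_of_nonneg_right ?_ (abs_nonneg _)
      rw [dφ, abs_mul]
      have i1 : |deriv (F1 n) (l x)| ≤ 1 + 2 * N := by
        rw [dF1]
        refine (abs_add_le _ _).trans (add_le_add (cut_abs_le _) ?_)
        rw [abs_mul]
        by_cases h : 2 < |l x / R n|
        · rw [cut_deriv_zero h]; simp; exact N0
        · exact mul_le_mul (not_lt.1 h) (hN _) (abs_nonneg _) (by norm_num)
      have i2 : |F2 n (l' x)| ≤ 1 := cut_abs_le _
      have := mul_le_mul i1 i2 (abs_nonneg _) (by positivity)
      linarith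
    · refine Eventually.of_forall fun x => ?_
      have : ∀ᶠ n in atTop, P x * dd v (φ n) x = P x := by
        filter_upwards [Rlim.eventually_gt_atTop (|l x| + |l' x|)] with n hn
        have h1 : |l x| < R n := by linarith [abs_nonneg (l' x)]
        have h2 : |l' x| ≤ R n ^ 5 := by
          have : R n ≤ R n ^ 5 := le_self_pow₀ (R1 n) (by norm_num)
          linarith [abs_nonneg (l x)]
        have e1 : deriv (F1 n) (l x) = 1 := by
          have : F1 n =ᶠ[𝓝 (l x)] id := by
            filter_upwards [(isOpen_lt continuous_abs continuous_const).mem_nhds h1] with s hs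
            simp only [hF1, id]
            rw [cut_one (by rw [habs _ _ (Rpos n), div_le_one (Rpos n)]; exact le_of_lt hs), mul_one]
          rw [this.deriv_eq]; simp
        have e2 : F2 n (l' x) = 1 := by
          have := pow_pos (Rpos n) 5
          exact cut_one (by rw [habs _ _ this, div_le_one this]; exact h2)
        rw [dφ, e1, e2, mul_one, mul_one]
      exact tendsto_const_nhds.congr' (this.mono fun n hn => hn.symm)
  have lim2 : Tendsto (fun n => ∫ x, Q x * dd v' (φ n) x) atTop (𝓝 0) := by
    have hbound : ∀ n, |∫ x, Q x * dd v' (φ n) x| ≤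
        2 * K * N * (2 * (∫ x, g x) + 16) * (R n)⁻¹ := by
      intro n
      have hr := Rpos n
      set Bx : Set ℂ := {x : ℂ | |l x| ≤ 2 * R n ∧ |l' x| ≤ 2 * R n ^ 5} with hBx
      have mB : MeasurableSet Bx :=
        ((isClosed_le (f := fun x : ℂ => |l x|) (by fun_prop) continuous_const).inter
          (isClosed_le (f := fun x : ℂ => |l' x|) (by fun_prop) continuous_const)).measurableSet
      have vB : volume Bx = ENNReal.ofReal (4 * (2 * R n) * (2 * R n ^ 5)) :=
        hco.vol _ _ (by positivity) (by positivity)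
      have iB : Integrable (Bx.indicator fun _ => (1:ℝ)) :=
        (integrableOn_const (by rw [vB]; exact ENNReal.ofReal_ne_top)).integrable_indicator mB
      have IB : ∫ x, Bx.indicator (fun _ => (1:ℝ)) x = 16 * R n ^ 6 := by
        rw [integral_indicator mB, setIntegral_const, Measure.real, vB, ENNReal.toReal_ofReal (by positivity)]
        simp; ring
      have pw : ∀ x, ‖Q x * dd v' (φ n) x‖ ≤
          2 * K * N * (R n ^ 4)⁻¹ * (2 * R n ^ 3 * g x + (R n ^ 3)⁻¹ * Bx.indicator (fun _ => (1:ℝ)) x) := by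
        intro x
        have hR3 : 1 ≤ R n ^ 3 := one_le_pow₀ (R1 n)
        by_cases hx : x ∈ Bx
        · rw [Set.indicator_of_mem hx, Real.norm_eq_abs, abs_mul, dφ', abs_mul, dF2]
          have i1 : |F1 n (l x)| ≤ 2 * R n := by
            simp only [hF1]
            rw [abs_mul]
            have := mul_le_mul hx.1 (cut_abs_le (l x / R n)) (abs_nonneg _) (by positivity)
            linarith
          have i2 : |deriv cut (l' x / R n ^ 5) / R n ^ 5| ≤ N / R n ^ 5 := by
            rw [abs_div, abs_of_pos (pow_pos hr 5)]
            gcongr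
            exact hN _
          have i3 : |Q x| ≤ K * (2 * R n ^ 3 * g x + (R n ^ 3)⁻¹) := by
            refine (hQg x).trans (mul_le_mul_of_nonneg_left ?_ hK)
            have := sqrt_le_young (hg0 x) (lt_of_lt_of_le one_pos hR3)
            rw [one_div] at this
            nlinarith [mul_nonneg (sub_nonneg.2 hR3) (hg0 x)]
          have i4 := mul_le_mul i1 i2 (abs_nonneg _) (by positivity)
          have i5 := mul_le_mul i3 i4 (by positivity) (by have := hg0 x; positivity)
          refine i5.trans_eq ?_
          field_simp
        · have : dd v' (φ n) x = 0 := by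
            rw [dφ']
            by_cases h : 2 * R n ≤ |l x|
            · rw [F1z n _ h, zero_mul]
            · have h' : 2 * R n ^ 5 < |l' x| := by
                by_contra! hcon
                exact hx ⟨(not_le.1 h).le, hcon⟩
              have hp := pow_pos hr 5
              rw [dF2, cut_deriv_zero (by rw [habs _ _ hp, lt_div_iff₀ hp]; exact h'), zero_div, mul_zero]
          rw [this, Set.indicator_of_notMem hx]
          have := hg0 x
          simp only [mul_zero, norm_zero]
          positivity
      have hint : Integrable fun x => 2 * K * N * (R n ^ 4)⁻¹ *
          (2 * R n ^ 3 * g x + (R n ^ 3)⁻¹ * Bx.indicator (fun _ => (1:ℝ)) x) :=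
        ((hg.const_mul _).add (iB.const_mul _)).const_mul _
      have := norm_integral_le_of_norm_le hint (Eventually.of_forall pw)
      rw [integral_const_mul, integral_add (hg.const_mul _) (iB.const_mul _), integral_const_mul,
        integral_const_mul, IB, Real.norm_eq_abs] at this
      refine this.trans_eq ?_
      field_simp
    have hz : Tendsto (fun n => 2 * K * N * (2 * (∫ x, g x) + 16) * (R n)⁻¹) atTop (𝓝 0) := by
      simpa using (tendsto_inv_atTop_zero.comp Rlim).const_mul (2 * K * N * (2 * (∫ x, g x) + 16))
    exact squeeze_zero_norm hbound hz
  simp only [ident] at lim1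
  exact tendsto_nhds_unique lim1 lim2

end Divergence

section Global
variable {c : ℝ} {a b : ℂ → ℝ}

/-- Momentum density in the direction `v`. -/
def md (a b : ℂ → ℝ) (v z : ℂ) : ℝ := dd v a z * b z - dd v b z * (a z - 1)

theorem contDiff_ed (ha : ContDiff ℝ ∞ a) (hb : ContDiff ℝ ∞ b) : ContDiff ℝ ∞ (ed a b) := by
  have h1 : ContDiff ℝ ∞ (dd 1 a) := contDiff_dd ha
  have h2 : ContDiff ℝ ∞ (dd Complex.I a) := contDiff_dd ha
  have h3 : ContDiff ℝ ∞ (dd 1 b) := contDiff_dd hb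
  have h4 : ContDiff ℝ ∞ (dd Complex.I b) := contDiff_dd hb
  have h5 := contDiff_cw ha hb
  unfold ed
  fun_prop

theorem contDiff_md (ha : ContDiff ℝ ∞ a) (hb : ContDiff ℝ ∞ b) (v : ℂ) : ContDiff ℝ ∞ (md a b v) := by
  have h1 : ContDiff ℝ ∞ (dd v a) := contDiff_dd ha
  have h3 : ContDiff ℝ ∞ (dd v b) := contDiff_dd hb
  unfold md
  fun_prop

theorem dd_sq {f : ℂ → ℝ} (hf : ContDiff ℝ ∞ f) (v : ℂ) :
    dd v (fun x => f x ^ 2) = fun x => 2 * (f x * dd v f x) := by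
  have : (fun x => f x ^ 2) = fun x => f x * f x := by funext x; ring
  rw [this, dd_mul hf hf]; funext x; ring

theorem dd_sub {f g : ℂ → ℝ} (hf : ContDiff ℝ ∞ f) (hg : ContDiff ℝ ∞ g) (v : ℂ) :
    dd v (fun x => f x - g x) = fun x => dd v f x - dd v g x := by
  have : (fun x => f x - g x) = fun x => f x + (-1) * g x := by funext x; ring
  rw [this, dd_add hf (contDiff_const.mul hg), dd_const_mul hg]; funext x; ring

theorem dd_ed (ha : ContDiff ℝ ∞ a) (hb : ContDiff ℝ ∞ b) (v z : ℂ) :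
    dd v (ed a b) z = dd 1 a z * dd v (dd 1 a) z + dd 1 b z * dd v (dd 1 b) z
      + dd Complex.I a z * dd v (dd Complex.I a) z + dd Complex.I b z * dd v (dd Complex.I b) z
      - cw a b z * (a z * dd v a z + b z * dd v b z) := by
  have hg := contDiff_gSq ha hb
  have hw := contDiff_cw ha hb
  have e : ed a b = fun x => 1 / 2 * gSq a b x + 1 / 4 * (cw a b x ^ 2) := by
    funext x; unfold ed gSq; ring
  rw [e, dd_add (contDiff_const.mul hg) (contDiff_const.mul (hw.pow 2)), dd_const_mul hg,
    dd_const_mul (hw.pow 2), dd_sq hw]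
  beta_reduce
  rw [dd_gSq ha hb, dd_cw ha hb]
  ring

theorem dd_md (ha : ContDiff ℝ ∞ a) (hb : ContDiff ℝ ∞ b) (v v' z : ℂ) :
    dd v (md a b v') z = dd v (dd v' a) z * b z + dd v' a z * dd v b z
      - dd v (dd v' b) z * (a z - 1) - dd v' b z * dd v a z := by
  have h1 : ContDiff ℝ ∞ (dd v' a) := contDiff_dd ha
  have h3 : ContDiff ℝ ∞ (dd v' b) := contDiff_dd hb
  have ha1 : ContDiff ℝ ∞ (fun x => a x - 1) := ha.sub contDiff_const
  unfold md
  rw [dd_sub (h1.mul hb) (h3.mul ha1), dd_mul h1 hb, dd_mul h3 ha1, dd_sub ha contDiff_const, dd_const]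
  ring

theorem gSq_le_ed (z : ℂ) : gSq a b z ≤ 2 * ed a b z := by
  unfold ed gSq; nlinarith [sq_nonneg (cw a b z)]

theorem integrable_of_le_ed (hI : Integrable (ed a b)) {f : ℂ → ℝ} (hf : Continuous f) {K : ℝ}
    (h : ∀ z, |f z| ≤ K * ed a b z) : Integrable f :=
  (hI.const_mul K).mono' hf.aestronglyMeasurable (Eventually.of_forall h)

/-- The flux of the horizontal stress. -/
theorem Sol.pohozaev_one (h : Sol c a b) (hI : Integrable (ed a b)) (hm : Integrable (md a b Complex.I)) :
    ∫ z, (ed a b z - (dd 1 a z ^ 2 + dd 1 b z ^ 2)) = c / 2 * ∫ z, md a b Complex.I z := by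
  have ha := h.smooth_a
  have hb := h.smooth_b
  have a1 : ContDiff ℝ ∞ (dd 1 a) := contDiff_dd ha
  have a2 : ContDiff ℝ ∞ (dd Complex.I a) := contDiff_dd ha
  have b1 : ContDiff ℝ ∞ (dd 1 b) := contDiff_dd hb
  have b2 : ContDiff ℝ ∞ (dd Complex.I b) := contDiff_dd hb
  have he := contDiff_ed ha hb
  have m1 := contDiff_md ha hb 1
  have m2 := contDiff_md ha hb Complex.I
  set P : ℂ → ℝ := fun z => (ed a b z - (dd 1 a z ^ 2 + dd 1 b z ^ 2)) - c / 2 * md a b Complex.I z with hP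
  set Q : ℂ → ℝ := fun z => (dd 1 a z * dd Complex.I a z + dd 1 b z * dd Complex.I b z) - c / 2 * md a b 1 z with hQ
  have i1 : Integrable fun z => ed a b z - (dd 1 a z ^ 2 + dd 1 b z ^ 2) := by
    refine integrable_of_le_ed (K := 2) hI (by have := he.continuous; have := a1.continuous; have := b1.continuous; fun_prop) fun z => ?_
    rw [abs_le]
    have := gSq_le_ed (a := a) (b := b) z
    unfold gSq at this
    have := ed_nonneg (a := a) (b := b) z
    constructor <;> nlinarith [sq_nonneg (dd 1 a z), sq_nonneg (dd 1 b z), sq_nonneg (dd Complex.I a z),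
      sq_nonneg (dd Complex.I b z)]
  have i2 : Integrable fun z => c / 2 * md a b Complex.I z := hm.const_mul _
  have key : ∫ z, P z = 0 := by
    refine integral_eq_zero_of_closed (g := ed a b) (K := 1 + |c| * (3 + c ^ 2)) coords_re_im (P := P) (Q := Q) (by fun_prop) (by fun_prop) ?_ (i1.sub i2) hI ed_nonneg (by positivity) ?_
    · intro x
      rw [hP, hQ, dd_sub (he.sub ((a1.pow 2).add (b1.pow 2))) (contDiff_const.mul m2), dd_const_mul m2,
        dd_sub he ((a1.pow 2).add (b1.pow 2)), dd_add (a1.pow 2) (b1.pow 2), dd_sq a1, dd_sq b1,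
        dd_sub ((a1.mul a2).add (b1.mul b2)) (contDiff_const.mul m1), dd_const_mul m1,
        dd_add (a1.mul a2) (b1.mul b2), dd_mul a1 a2, dd_mul b1 b2]
      beta_reduce
      rw [dd_ed ha hb, dd_md ha hb, dd_md ha hb]
      rw [dd_comm (v := 1) (v' := Complex.I) ha, dd_comm (v := 1) (v' := Complex.I) hb]
      have ea := h.eq_a x
      have eb := h.eq_b x
      unfold cw
      linear_combination (-(dd 1 a x)) * ea - dd 1 b x * eb
    · intro x
      have hq := h.modSq_le x
      have hg := gSq_le_ed (a := a) (b := b) x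
      have h0 := ed_nonneg (a := a) (b := b) x
      unfold modSq at hq
      unfold gSq at hg
      set S := Real.sqrt (ed a b x) with hS
      have hSq : S ^ 2 = ed a b x := Real.sq_sqrt h0
      have hS0 : 0 ≤ S := Real.sqrt_nonneg _
      have t1 : |dd 1 a x * dd Complex.I a x + dd 1 b x * dd Complex.I b x| ≤ ed a b x := by
        rw [abs_le]
        constructor <;> nlinarith [sq_nonneg (dd 1 a x - dd Complex.I a x), sq_nonneg (dd 1 a x + dd Complex.I a x),
          sq_nonneg (dd 1 b x - dd Complex.I b x), sq_nonneg (dd 1 b x + dd Complex.I b x)]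
      have t2 : |md a b 1 x| ≤ 2 * (3 + c ^ 2) * S := by
        refine abs_le_of_sq_le_sq ?_ (by positivity)
        have e1 : md a b 1 x ^ 2 ≤ (dd 1 a x ^ 2 + dd 1 b x ^ 2) * (b x ^ 2 + (a x - 1) ^ 2) := by
          unfold md
          nlinarith [sq_nonneg (dd 1 a x * (a x - 1) + dd 1 b x * b x)]
        have e2 : b x ^ 2 + (a x - 1) ^ 2 ≤ 2 * (3 + c ^ 2) := by nlinarith [sq_nonneg (a x + 1), sq_nonneg (b x), sq_nonneg c]
        have e3 : dd 1 a x ^ 2 + dd 1 b x ^ 2 ≤ 2 * ed a b x := by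
          nlinarith [sq_nonneg (dd Complex.I a x), sq_nonneg (dd Complex.I b x)]
        have e4 := mul_le_mul e3 e2 (by positivity) (by positivity)
        calc md a b 1 x ^ 2 ≤ 2 * ed a b x * (2 * (3 + c ^ 2)) := e1.trans e4
          _ ≤ (2 * (3 + c ^ 2) * S) ^ 2 := by
            rw [mul_pow, hSq]
            have : 0 ≤ ed a b x * (c ^ 2 * (c ^ 2 + 5)) := by positivity
            nlinarith
      have t3 : |c / 2 * md a b 1 x| ≤ |c| * (3 + c ^ 2) * S := by
        rw [abs_mul, abs_div, abs_two]
        have := mul_le_mul_of_nonneg_left t2 (by positivity : 0 ≤ |c| / 2)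
        linarith
      have t4 := abs_sub (dd 1 a x * dd Complex.I a x + dd 1 b x * dd Complex.I b x) (c / 2 * md a b 1 x)
      have t5 : 0 ≤ |c| * (3 + c ^ 2) * ed a b x := by positivity
      simp only [hQ]
      nlinarith
  rw [hP] at key
  rw [integral_sub i1 i2, integral_const_mul] at key
  linarith

/-- The flux of the vertical stress. -/
theorem Sol.pohozaev_two (h : Sol c a b) (hI : Integrable (ed a b)) :
    ∫ z, (ed a b z - (dd Complex.I a z ^ 2 + dd Complex.I b z ^ 2)) = 0 := by
  have ha := h.smooth_a
  have hb := h.smooth_b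
  have a1 : ContDiff ℝ ∞ (dd 1 a) := contDiff_dd ha
  have a2 : ContDiff ℝ ∞ (dd Complex.I a) := contDiff_dd ha
  have b1 : ContDiff ℝ ∞ (dd 1 b) := contDiff_dd hb
  have b2 : ContDiff ℝ ∞ (dd Complex.I b) := contDiff_dd hb
  have he := contDiff_ed ha hb
  refine integral_eq_zero_of_closed (g := ed a b) (K := 1) coords_im_re
    (Q := fun z => dd 1 a z * dd Complex.I a z + dd 1 b z * dd Complex.I b z) (by fun_prop) (by fun_prop) ?_ ?_ hI ed_nonneg zero_le_one ?_
  · intro x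
    rw [dd_sub he ((a2.pow 2).add (b2.pow 2)), dd_add (a2.pow 2) (b2.pow 2), dd_sq a2, dd_sq b2,
      dd_add (a1.mul a2) (b1.mul b2), dd_mul a1 a2, dd_mul b1 b2]
    beta_reduce
    rw [dd_ed ha hb]
    rw [dd_comm (v := 1) (v' := Complex.I) ha, dd_comm (v := 1) (v' := Complex.I) hb]
    have ea := h.eq_a x
    have eb := h.eq_b x
    unfold cw
    linear_combination (-(dd Complex.I a x)) * ea - dd Complex.I b x * eb
  · refine integrable_of_le_ed (K := 2) hI (by have := he.continuous; have := a2.continuous; have := b2.continuous; fun_prop) fun z => ?_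
    rw [abs_le]
    have := gSq_le_ed (a := a) (b := b) z
    unfold gSq at this
    have := ed_nonneg (a := a) (b := b) z
    constructor <;> nlinarith [sq_nonneg (dd 1 a z), sq_nonneg (dd 1 b z), sq_nonneg (dd Complex.I a z),
      sq_nonneg (dd Complex.I b z)]
  · intro x
    have hg := gSq_le_ed (a := a) (b := b) x
    unfold gSq at hg
    have : 0 ≤ Real.sqrt (ed a b x) := Real.sqrt_nonneg _
    rw [abs_le]
    constructor <;> nlinarith [sq_nonneg (dd 1 a x - dd Complex.I a x), sq_nonneg (dd 1 a x + dd Complex.I a x),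
      sq_nonneg (dd 1 b x - dd Complex.I b x), sq_nonneg (dd 1 b x + dd Complex.I b x)]

/-- The global Pohozaev identity. -/
theorem Sol.integral_cw_sq (h : Sol c a b) (hI : Integrable (ed a b)) (hm : Integrable (md a b Complex.I)) :
    ∫ z, 1 / 2 * cw a b z ^ 2 = c / 2 * ∫ z, md a b Complex.I z := by
  have e1 := h.pohozaev_one hI hm
  have e2 := h.pohozaev_two hI
  have ha := h.smooth_a
  have hb := h.smooth_b
  have i1 : ∀ v : ℂ, v = 1 ∨ v = Complex.I → Integrable fun z => ed a b z - (dd v a z ^ 2 + dd v b z ^ 2) := by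
    intro v hv
    have a1 : ContDiff ℝ ∞ (dd v a) := contDiff_dd ha
    have b1 : ContDiff ℝ ∞ (dd v b) := contDiff_dd hb
    refine integrable_of_le_ed (K := 2) hI (by have := continuous_ed ha hb; have := a1.continuous; have := b1.continuous; fun_prop) fun z => ?_
    have := gSq_le_ed (a := a) (b := b) z
    unfold gSq at this
    have := ed_nonneg (a := a) (b := b) z
    rw [abs_le]
    rcases hv with rfl | rfl <;>
    constructor <;> nlinarith [sq_nonneg (dd 1 a z), sq_nonneg (dd 1 b z), sq_nonneg (dd Complex.I a z),
      sq_nonneg (dd Complex.I b z)]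
  have e3 := integral_add (i1 1 (Or.inl rfl)) (i1 _ (Or.inr rfl))
  rw [e1, e2, add_zero] at e3
  rw [← e3]
  congr 1; funext z; unfold ed; ring

/-- If the modulus stays close to one, the momentum is controlled by the energy. -/
theorem momentum_le_of_no_vortex (ha : ContDiff ℝ ∞ a) (hb : ContDiff ℝ ∞ b) (hI : Integrable (ed a b)) (hm : Integrable (md a b Complex.I))
    (hw : ∀ z, |cw a b z| ≤ 1 / 8) :
    |∫ z, md a b Complex.I z| ≤ 2 * ∫ z, ed a b z := by
  have hq := contDiff_modSq ha hb
  have q0 : ∀ z, 7 / 8 ≤ modSq a b z ∧ modSq a b z ≤ 9 / 8 := fun z => by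
    have := abs_le.1 (hw z)
    rw [cw_eq] at this
    constructor <;> linarith
  have hqi : ContDiff ℝ ∞ fun z => (modSq a b z)⁻¹ := hq.inv fun z => by linarith [(q0 z).1]
  have dqi : ∀ v z, dd v (fun z => (modSq a b z)⁻¹) z = - dd v (modSq a b) z * (modSq a b z)⁻¹ ^ 2 := by
    intro v z
    refine dd_eq_of_hasDerivAt hqi ?_
    have h1 := hasDerivAt_line (v := v) hq z
    have h0 : modSq a b (z + (0:ℝ) • v) = modSq a b z := by simp
    have := h1.fun_inv (by rw [h0]; linarith [(q0 z).1])
    rw [h0] at this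
    rw [div_eq_mul_inv, ← inv_pow] at this
    exact this
  have sh : ∀ v, ContDiff ℝ ∞ fun z => dd v b z - (a z * dd v b z - b z * dd v a z) * (modSq a b z)⁻¹ := by
    intro v
    have h1 : ContDiff ℝ ∞ (dd v a) := contDiff_dd ha
    have h3 : ContDiff ℝ ∞ (dd v b) := contDiff_dd hb
    fun_prop
  have bd : ∀ v : ℂ, v = 1 ∨ v = Complex.I → ∀ z, |dd v b z - (a z * dd v b z - b z * dd v a z) * (modSq a b z)⁻¹ - md a b v z| ≤ 2 * ed a b z := by
    intro v hv z
    have e : dd v b z - (a z * dd v b z - b z * dd v a z) * (modSq a b z)⁻¹ - md a b v z =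
        -((a z * dd v b z - b z * dd v a z) * cw a b z) * (modSq a b z)⁻¹ := by
      have : modSq a b z ≠ 0 := by linarith [(q0 z).1]
      rw [cw_eq]; unfold md; field_simp; ring
    rw [e, abs_mul, abs_inv, abs_of_nonneg (modSq_nonneg z), ← div_eq_mul_inv, div_le_iff₀ (by linarith [(q0 z).1])]
    have t : |-((a z * dd v b z - b z * dd v a z) * cw a b z)| ≤ 3 / 2 * ed a b z := by
      refine abs_le_of_sq_le_sq ?_ (by have := ed_nonneg (a := a) (b := b) z; positivity)
      have e1 : (a z * dd v b z - b z * dd v a z) ^ 2 ≤ 9 / 8 * gSq a b z := by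
        have e0 : (a z * dd v b z - b z * dd v a z) ^ 2 ≤ modSq a b z * (dd v a z ^ 2 + dd v b z ^ 2) := by
          unfold modSq; nlinarith [sq_nonneg (a z * dd v a z + b z * dd v b z)]
        refine e0.trans (mul_le_mul (q0 z).2 ?_ (by positivity) (by norm_num))
        unfold gSq
        rcases hv with rfl | rfl <;> nlinarith [sq_nonneg (dd 1 a z), sq_nonneg (dd 1 b z), sq_nonneg (dd Complex.I a z),
          sq_nonneg (dd Complex.I b z)]
      have e2 : ed a b z = 1 / 2 * gSq a b z + 1 / 4 * cw a b z ^ 2 := by unfold ed gSq; ring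
      rw [neg_sq, mul_pow, e2]
      have := mul_le_mul_of_nonneg_right e1 (sq_nonneg (cw a b z))
      nlinarith [sq_nonneg (1 / 2 * gSq a b z - 1 / 4 * cw a b z ^ 2)]
    nlinarith [(q0 z).1, ed_nonneg (a := a) (b := b) z]
  set D : ℂ → ℝ := fun z => (dd Complex.I b z - (a z * dd Complex.I b z - b z * dd Complex.I a z) * (modSq a b z)⁻¹) - md a b Complex.I z with hD
  have iD : Integrable D := by
    refine integrable_of_le_ed (K := 2) hI ?_ (bd _ (Or.inr rfl))
    exact ((sh Complex.I).sub (contDiff_md ha hb _)).continuous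
  have key : ∫ z, (dd Complex.I b z - (a z * dd Complex.I b z - b z * dd Complex.I a z) * (modSq a b z)⁻¹) = 0 := by
    refine integral_eq_zero_of_closed (g := ed a b) (K := 10) coords_re_im
      (Q := fun z => dd 1 b z - (a z * dd 1 b z - b z * dd 1 a z) * (modSq a b z)⁻¹) (sh _) (sh _) ?_ ?_ hI ed_nonneg (by norm_num) ?_
    · intro x
      have a1 : ContDiff ℝ ∞ (dd 1 a) := contDiff_dd ha
      have a2 : ContDiff ℝ ∞ (dd Complex.I a) := contDiff_dd ha
      have b1 : ContDiff ℝ ∞ (dd 1 b) := contDiff_dd hb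
      have b2 : ContDiff ℝ ∞ (dd Complex.I b) := contDiff_dd hb
      rw [dd_sub b2 (((ha.mul b2).sub (hb.mul a2)).mul hqi), dd_sub b1 (((ha.mul b1).sub (hb.mul a1)).mul hqi),
        dd_mul ((ha.mul b2).sub (hb.mul a2)) hqi, dd_mul ((ha.mul b1).sub (hb.mul a1)) hqi,
        dd_sub (ha.mul b2) (hb.mul a2), dd_sub (ha.mul b1) (hb.mul a1), dd_mul ha b2, dd_mul hb a2, dd_mul ha b1, dd_mul hb a1]
      beta_reduce
      rw [dqi, dqi, dd_modSq ha hb, dd_modSq ha hb, dd_comm (v := 1) (v' := Complex.I) ha, dd_comm (v := 1) (v' := Complex.I) hb]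
      have : modSq a b x ≠ 0 := by linarith [(q0 x).1]
      field_simp
      unfold modSq
      ring
    · have : Integrable fun z => D z + md a b Complex.I z := iD.add hm
      simpa [hD] using this
    · intro x
      have h1 := bd 1 (Or.inl rfl) x
      have hg := gSq_le_ed (a := a) (b := b) x
      have h0 := ed_nonneg (a := a) (b := b) x
      have hS0 : 0 ≤ Real.sqrt (ed a b x) := Real.sqrt_nonneg _
      have hSq : Real.sqrt (ed a b x) ^ 2 = ed a b x := Real.sq_sqrt h0
      have t2 : |md a b 1 x| ≤ 10 * Real.sqrt (ed a b x) := by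
        refine abs_le_of_sq_le_sq ?_ (by positivity)
        have e1 : md a b 1 x ^ 2 ≤ (dd 1 a x ^ 2 + dd 1 b x ^ 2) * (b x ^ 2 + (a x - 1) ^ 2) := by
          unfold md
          nlinarith [sq_nonneg (dd 1 a x * (a x - 1) + dd 1 b x * b x)]
        have e2 : b x ^ 2 + (a x - 1) ^ 2 ≤ 10 := by
          have := (q0 x).2
          unfold modSq at this
          nlinarith [sq_nonneg (a x + 1), sq_nonneg (b x)]
        have e3 : dd 1 a x ^ 2 + dd 1 b x ^ 2 ≤ 2 * ed a b x := by
          unfold gSq at hg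
          nlinarith [sq_nonneg (dd Complex.I a x), sq_nonneg (dd Complex.I b x)]
        have e4 := mul_le_mul e3 e2 (by positivity) (by positivity)
        rw [mul_pow, hSq]
        linarith
      have t4 := abs_add_le (dd 1 b x - (a x * dd 1 b x - b x * dd 1 a x) * (modSq a b x)⁻¹ - md a b 1 x) (md a b 1 x)
      rw [sub_add_cancel] at t4
      linarith
  have e : ∫ z, md a b Complex.I z = - ∫ z, D z := by
    rw [hD, integral_sub _ hm, key]; · ring
    have : Integrable fun z => D z + md a b Complex.I z := iD.add hm
    simpa [hD] using this
  rw [e, abs_neg, ← integral_const_mul]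
  refine (norm_integral_le_of_norm_le (f := D) (hI.const_mul 2) (Eventually.of_forall fun z => ?_))
  exact bd _ (Or.inr rfl) z

end Global

section Exterior
variable {c : ℝ} {a b : ℂ → ℝ}

theorem integral_dd_of_compact {φ : ℂ → ℝ} (hφ : ContDiff ℝ ∞ φ) (hs : HasCompactSupport φ) (v : ℂ) :
    ∫ x, dd v φ x = 0 := by
  have := integral_dd_mul_compact (P := fun _ => 1) contDiff_const hφ hs v
  rw [dd_const] at this
  simp only [zero_mul, integral_zero, one_mul] at this
  linarith

theorem Lap_cw (ha : ContDiff ℝ ∞ a) (hb : ContDiff ℝ ∞ b) (z : ℂ) :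
    Lap (cw a b) z = - Lap (modSq a b) z := by
  have hm := contDiff_modSq ha hb
  have : cw a b = fun x => 1 - modSq a b x := by funext x; rw [cw_eq]
  unfold Lap
  rw [this, dd_sub contDiff_const hm, dd_sub contDiff_const hm, dd_const, dd_const]
  have e : ∀ v : ℂ, (fun x => (0:ℝ) - dd v (modSq a b) x) = fun x => (-1) * dd v (modSq a b) x := by
    intro v; funext x; ring
  rw [e, e, dd_const_mul (contDiff_dd hm), dd_const_mul (contDiff_dd hm)]
  ring

theorem abs_cw_mul_sqrt_gSq_le (x : ℂ) : |cw a b x| * Real.sqrt (gSq a b x) ≤ 3 / 2 * ed a b x := by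
  have h1 := Real.sq_sqrt (gSq_nonneg (a := a) (b := b) x)
  have h2 := sq_abs (cw a b x)
  have h3 : ed a b x = 1 / 2 * gSq a b x + 1 / 4 * cw a b x ^ 2 := by unfold ed gSq; ring
  have h4 := gSq_nonneg (a := a) (b := b) x
  rw [h3, ← h1, ← h2, Real.sqrt_sq (Real.sqrt_nonneg _)]
  nlinarith [sq_nonneg (|cw a b x| - Real.sqrt (gSq a b x) * 1.4), sq_nonneg (Real.sqrt (gSq a b x)), sq_nonneg (cw a b x)]

theorem grad_cw_sq_le (ha : ContDiff ℝ ∞ a) (hb : ContDiff ℝ ∞ b) {x : ℂ} (hρ : modSq a b x ≤ 3 / 2) :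
    dd 1 (cw a b) x ^ 2 + dd Complex.I (cw a b) x ^ 2 ≤ 6 * gSq a b x := by
  rw [dd_cw ha hb, dd_cw ha hb]
  have t : ∀ v : ℂ, (-2 * (a x * dd v a x + b x * dd v b x)) ^ 2 ≤ 4 * modSq a b x * (dd v a x ^ 2 + dd v b x ^ 2) := by
    intro v
    unfold modSq
    nlinarith [sq_nonneg (a x * dd v b x - b x * dd v a x)]
  have t1 := t 1
  have t2 := t Complex.I
  have t3 : 4 * modSq a b x * gSq a b x ≤ 6 * gSq a b x :=
    mul_le_mul_of_nonneg_right (by linarith) (gSq_nonneg x)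
  have t4 : 4 * modSq a b x * gSq a b x = 4 * modSq a b x * (dd 1 a x ^ 2 + dd 1 b x ^ 2)
      + 4 * modSq a b x * (dd Complex.I a x ^ 2 + dd Complex.I b x ^ 2) := by
    unfold gSq; ring
  linarith

theorem current_sq_le {x : ℂ} (hρ : modSq a b x ≤ 3 / 2) :
    |a x * dd Complex.I b x - b x * dd Complex.I a x| ≤ 5 / 4 * Real.sqrt (gSq a b x) := by
  have hg0 := gSq_nonneg (a := a) (b := b) x
  refine abs_le_of_sq_le_sq ?_ (by positivity)
  rw [mul_pow, Real.sq_sqrt hg0]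
  have t1 : (a x * dd Complex.I b x - b x * dd Complex.I a x) ^ 2 ≤ modSq a b x * (dd Complex.I a x ^ 2 + dd Complex.I b x ^ 2) := by
    unfold modSq
    nlinarith [sq_nonneg (a x * dd Complex.I a x + b x * dd Complex.I b x)]
  have t2 : dd Complex.I a x ^ 2 + dd Complex.I b x ^ 2 ≤ gSq a b x := by
    unfold gSq; nlinarith [sq_nonneg (dd 1 a x), sq_nonneg (dd 1 b x)]
  have t3 := mul_le_mul hρ t2 (by positivity) (by norm_num)
  linarith

theorem abs_inner_le {p q r s δ G : ℝ} (hδ : 0 ≤ δ) (hG : 0 ≤ G) (h1 : p ^ 2 + q ^ 2 ≤ δ ^ 2)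
    (h2 : r ^ 2 + s ^ 2 ≤ 6 * G) : |p * r + q * s| ≤ 5 / 2 * δ * Real.sqrt G := by
  refine abs_le_of_sq_le_sq ?_ (by positivity)
  have c1 := mul_le_mul h1 h2 (by positivity) (by positivity)
  rw [mul_pow, mul_pow, Real.sq_sqrt hG]
  nlinarith [sq_nonneg (p * s - q * r), mul_nonneg (sq_nonneg δ) hG]

theorem mul_le_of_le_one_of_le {k r B : ℝ} (hk : 0 ≤ k) (hk1 : k ≤ 1) (hr : r ≤ B) (hB : 0 ≤ B) : k * r ≤ B := by
  nlinarith

/-- The pointwise inequality behind `Sol.integral_cutoff_le`. -/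
theorem Sol.cutoff_pointwise (h : Sol c a b) (hc : 0 ≤ c) {ξ : ℂ → ℝ} {x : ℂ} {T : ℝ}
    (h0 : 0 ≤ ξ x) (h1 : ξ x ≤ 1) {δ τ : ℝ} (hδ : 0 ≤ δ) (hτ : τ ≤ 1 / 2) (hτ0 : 0 ≤ τ)
    (hd : dd 1 ξ x ^ 2 + dd Complex.I ξ x ^ 2 ≤ δ ^ 2) (hwx : |cw a b x| ≤ τ)
    (expand : T = ξ x ^ 2 * (dd 1 (cw a b) x ^ 2 + dd Complex.I (cw a b) x ^ 2) + ξ x ^ 2 * cw a b x * Lap (cw a b) x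
        + 2 * ξ x * cw a b x * (dd 1 ξ x * dd 1 (cw a b) x + dd Complex.I ξ x * dd Complex.I (cw a b) x)) :
    ξ x ^ 2 * cw a b x ^ 2 ≤ T + 8 * (τ + c + δ) * ed a b x := by
  have ha := h.smooth_a
  have hb := h.smooth_b
  have e0 := ed_nonneg (a := a) (b := b) x
  have hwx' := abs_le.1 hwx
  have hg : gSq a b x ≤ 2 * ed a b x := gSq_le_ed x
  have hg0 : 0 ≤ gSq a b x := gSq_nonneg x
  have hρ : modSq a b x = 1 - cw a b x := by rw [cw_eq]; ring
  have hρ1 : modSq a b x ≤ 3 / 2 := by linarith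
  have hgw := abs_cw_mul_sqrt_gSq_le (a := a) (b := b) x
  have hcross : |cw a b x * (dd 1 ξ x * dd 1 (cw a b) x + dd Complex.I ξ x * dd Complex.I (cw a b) x)| ≤ 4 * δ * ed a b x := by
    rw [abs_mul]
    have s1 := mul_le_mul_of_nonneg_left (abs_inner_le hδ hg0 hd (grad_cw_sq_le ha hb hρ1)) (abs_nonneg (cw a b x))
    have s2 := mul_le_mul_of_nonneg_left hgw hδ
    have s3 := mul_nonneg hδ e0
    linarith
  have hj : |cw a b x * (a x * dd Complex.I b x - b x * dd Complex.I a x)| ≤ 2 * ed a b x := by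
    rw [abs_mul]
    have s1 := mul_le_mul_of_nonneg_left (current_sq_le hρ1) (abs_nonneg (cw a b x))
    linarith
  rw [Lap_cw ha hb, h.Lap_modSq, ← cw_eq] at expand
  generalize a x * dd Complex.I b x - b x * dd Complex.I a x = j at *
  generalize dd 1 ξ x * dd 1 (cw a b) x + dd Complex.I ξ x * dd Complex.I (cw a b) x = k at *
  have hξ2 : ξ x ^ 2 ≤ 1 := pow_le_one₀ h0 h1
  have hξ0 : 0 ≤ ξ x ^ 2 := sq_nonneg _
  have hte : 0 ≤ τ * ed a b x := mul_nonneg hτ0 e0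
  have hde : 0 ≤ δ * ed a b x := mul_nonneg hδ e0
  have hce : 0 ≤ c * ed a b x := mul_nonneg hc e0
  have q1 : ξ x ^ 2 * (cw a b x * gSq a b x) ≤ 2 * (τ * ed a b x) := by
    refine mul_le_of_le_one_of_le hξ0 hξ2 ?_ (by linarith)
    have := mul_le_mul_of_nonneg_right hwx'.2 hg0
    have := mul_le_mul_of_nonneg_left hg hτ0
    linarith
  have q2 : ξ x ^ 2 * (cw a b x * j) ≤ 2 * ed a b x :=
    mul_le_of_le_one_of_le hξ0 hξ2 (abs_le.1 hj).2 (by linarith)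
  have q3 : ξ x * -(cw a b x * k) ≤ 4 * δ * ed a b x :=
    mul_le_of_le_one_of_le h0 h1 (by linarith [(abs_le.1 hcross).1]) (by linarith)
  have q4 : 0 ≤ ξ x ^ 2 * (dd 1 (cw a b) x ^ 2 + dd Complex.I (cw a b) x ^ 2) := by positivity
  have q5 : 0 ≤ ξ x ^ 2 * cw a b x ^ 2 * (2 * modSq a b x - 1) :=
    mul_nonneg (by positivity) (by linarith)
  have q6 := mul_le_mul_of_nonneg_left q2 hc
  have q7 : T = ξ x ^ 2 * (dd 1 (cw a b) x ^ 2 + dd Complex.I (cw a b) x ^ 2)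
      - 2 * (ξ x ^ 2 * (cw a b x * gSq a b x)) - 2 * (c * (ξ x ^ 2 * (cw a b x * j)))
      + ξ x ^ 2 * cw a b x ^ 2 * (2 * modSq a b x - 1) + ξ x ^ 2 * cw a b x ^ 2
      - 2 * (ξ x * -(cw a b x * k)) := by
    rw [expand]; ring
  rw [q7]
  linarith

/-- A weighted bound for the potential where the modulus is close to one. -/
theorem Sol.integral_cutoff_le (h : Sol c a b) (hc : 0 ≤ c) (hI : Integrable (ed a b)) {ξ : ℂ → ℝ}
    (hξ : ContDiff ℝ ∞ ξ) (hs : HasCompactSupport ξ) (h0 : ∀ x, 0 ≤ ξ x) (h1 : ∀ x, ξ x ≤ 1) {δ τ : ℝ} (hδ : 0 ≤ δ)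
    (hτ : τ ≤ 1 / 2) (hτ0 : 0 ≤ τ)
    (hd : ∀ x, dd 1 ξ x ^ 2 + dd Complex.I ξ x ^ 2 ≤ δ ^ 2) (hw : ∀ x, ξ x ≠ 0 → |cw a b x| ≤ τ) :
    ∫ x, ξ x ^ 2 * cw a b x ^ 2 ≤ 8 * (τ + c + δ) * ∫ x, ed a b x := by
  have ha := h.smooth_a
  have hb := h.smooth_b
  have hwc := contDiff_cw ha hb
  have hw1 : ContDiff ℝ ∞ (dd 1 (cw a b)) := contDiff_dd hwc
  have hw2 : ContDiff ℝ ∞ (dd Complex.I (cw a b)) := contDiff_dd hwc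
  have key : ∀ v : ℂ, ContDiff ℝ ∞ (fun x => ξ x ^ 2 * (cw a b x * dd v (cw a b) x)) ∧
      HasCompactSupport (fun x => ξ x ^ 2 * (cw a b x * dd v (cw a b) x)) := by
    intro v
    have hv : ContDiff ℝ ∞ (dd v (cw a b)) := contDiff_dd hwc
    refine ⟨by fun_prop, ?_⟩
    refine hs.mono' fun x hx => subset_tsupport _ ?_
    contrapose! hx
    simp only [Function.mem_support, not_not] at hx ⊢
    rw [hx]; ring
  set T : ℂ → ℝ := fun x => dd 1 (fun x => ξ x ^ 2 * (cw a b x * dd 1 (cw a b) x)) x +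
    dd Complex.I (fun x => ξ x ^ 2 * (cw a b x * dd Complex.I (cw a b) x)) x with hT
  have iT : ∀ v : ℂ, Integrable (dd v (fun x => ξ x ^ 2 * (cw a b x * dd v (cw a b) x))) := by
    intro v
    refine (contDiff_dd (key v).1).continuous.integrable_of_hasCompactSupport ?_
    have : HasCompactSupport (fun x => fderiv ℝ (fun x => ξ x ^ 2 * (cw a b x * dd v (cw a b) x)) x v) :=
      (key v).2.fderiv_apply (𝕜 := ℝ) v
    exact this
  have IT : ∫ x, T x = 0 := by
    rw [hT, integral_add (iT 1) (iT _), integral_dd_of_compact (key 1).1 (key 1).2,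
      integral_dd_of_compact (key _).1 (key _).2, add_zero]
  have pw : ∀ x, ξ x ^ 2 * cw a b x ^ 2 ≤ T x + 8 * (τ + c + δ) * ed a b x := by
    intro x
    have e0 := ed_nonneg (a := a) (b := b) x
    have expand : T x = ξ x ^ 2 * (dd 1 (cw a b) x ^ 2 + dd Complex.I (cw a b) x ^ 2) + ξ x ^ 2 * cw a b x * Lap (cw a b) x
        + 2 * ξ x * cw a b x * (dd 1 ξ x * dd 1 (cw a b) x + dd Complex.I ξ x * dd Complex.I (cw a b) x) := by
      simp only [hT]
      rw [dd_mul (hξ.pow 2) (hwc.mul hw1), dd_mul (hξ.pow 2) (hwc.mul hw2), dd_mul hwc hw1, dd_mul hwc hw2,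
        dd_sq hξ, dd_sq hξ]
      unfold Lap
      ring
    by_cases hx : ξ x = 0
    · rw [expand, hx]
      have : 0 ≤ 8 * (τ + c + δ) * ed a b x := by positivity
      simpa using this
    exact h.cutoff_pointwise hc (h0 x) (h1 x) hδ hτ hτ0 (hd x) (hw x hx) expand
  have i1 : Integrable fun x => ξ x ^ 2 * cw a b x ^ 2 := by
    refine integrable_of_le_ed (K := 4) hI (by have := hξ.continuous; have := hwc.continuous; fun_prop) fun z => ?_
    rw [abs_of_nonneg (by positivity)]
    have := cw_sq_le_ed (a := a) (b := b) z
    have h2 : ξ z ^ 2 ≤ 1 := by nlinarith [h0 z, h1 z]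
    nlinarith [mul_le_mul_of_nonneg_right h2 (sq_nonneg (cw a b z))]
  have iT' : Integrable T := (iT 1).add (iT _)
  have := integral_mono i1 (iT'.add (hI.const_mul (8 * (τ + c + δ)))) pw
  simp only [Pi.add_apply] at this
  rw [integral_add iT' (hI.const_mul _), IT, integral_const_mul] at this
  linarith

end Exterior

section DiscCutoff

/-- A smooth cutoff of the disc of radius `r` around `z`. -/
def disc (z : ℂ) (r : ℝ) (x : ℂ) : ℝ := cut (bump2 z 0 x / r ^ 2)

theorem contDiff_disc (z : ℂ) (r : ℝ) : ContDiff ℝ ∞ (disc z r) :=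
  contDiff_cut.comp ((contDiff_bump2 z 0).div_const _)

theorem abs_bump2_div (z : ℂ) (r : ℝ) (x : ℂ) : |bump2 z 0 x / r ^ 2| = ‖x - z‖ ^ 2 / r ^ 2 := by
  rw [bump2_eq, zero_sub, neg_div, abs_neg, abs_of_nonneg (by positivity)]

theorem disc_nonneg (z : ℂ) (r : ℝ) (x : ℂ) : 0 ≤ disc z r x := cut.nonneg

theorem disc_le_one (z : ℂ) (r : ℝ) (x : ℂ) : disc z r x ≤ 1 := cut.le_one

theorem disc_eq_one {z : ℂ} {r : ℝ} (hr : 0 < r) {x : ℂ} (h : ‖x - z‖ ≤ r) : disc z r x = 1 := by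
  refine cut_one ?_
  rw [abs_bump2_div, div_le_one (by positivity)]
  exact pow_le_pow_left₀ (norm_nonneg _) h 2

theorem disc_eq_zero {z : ℂ} {r : ℝ} (hr : 0 < r) {x : ℂ} (h : 2 * r ≤ ‖x - z‖) : disc z r x = 0 := by
  refine cut_zero ?_
  rw [abs_bump2_div, le_div_iff₀ (by positivity)]
  nlinarith

theorem abs_dd_disc_le {N : ℝ} (N0 : 0 ≤ N) (hN : ∀ s, |deriv cut s| ≤ N) (z : ℂ) {r : ℝ} (hr : 0 < r)
    (x : ℂ) {v : ℂ} (hv : v = 1 ∨ v = Complex.I) : |dd v (disc z r) x| ≤ 3 * N / r := by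
  have h1 : HasDerivAt cut (deriv cut (bump2 z 0 x / r ^ 2)) (bump2 z 0 x / r ^ 2) :=
    (contDiff_cut.differentiable (by simp) _).hasDerivAt
  have h2 : HasDerivAt (fun s : ℝ => bump2 z 0 (x + s • v) / r ^ 2) (dd v (bump2 z 0) x / r ^ 2) 0 :=
    (hasDerivAt_line (contDiff_bump2 z 0) x).div_const _
  have h3 : HasDerivAt (fun s : ℝ => disc z r (x + s • v))
      (deriv cut (bump2 z 0 x / r ^ 2) * (dd v (bump2 z 0) x / r ^ 2)) 0 := by
    refine HasDerivAt.comp (h₂ := cut) (0:ℝ) ?_ h2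
    simpa using h1
  rw [dd_eq_of_hasDerivAt (contDiff_disc z r) h3, abs_mul]
  by_cases hx : 2 < |bump2 z 0 x / r ^ 2|
  · rw [cut_deriv_zero hx, abs_zero, zero_mul]; positivity
  · have hx' : ‖x - z‖ ^ 2 ≤ 2 * r ^ 2 := by
      rw [abs_bump2_div, not_lt, div_le_iff₀ (by positivity)] at hx
      exact hx
    have hx2 : ‖x - z‖ ≤ 3 / 2 * r := by nlinarith [norm_nonneg (x - z)]
    have hb : |dd v (bump2 z 0) x| ≤ 3 * r := by
      have i1 := Complex.abs_re_le_norm (x - z)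
      have i2 := Complex.abs_im_le_norm (x - z)
      simp only [Complex.sub_re, Complex.sub_im] at i1 i2
      rcases hv with rfl | rfl
      · rw [dd_one_bump2, abs_mul]; norm_num; linarith
      · rw [dd_I_bump2, abs_mul]; norm_num; linarith
    have : |dd v (bump2 z 0) x / r ^ 2| ≤ 3 / r := by
      rw [abs_div, abs_of_pos (by positivity : 0 < r ^ 2), div_le_div_iff₀ (by positivity) hr]
      nlinarith [mul_le_mul_of_nonneg_right hb hr.le]
    refine (mul_le_mul (hN _) this (abs_nonneg _) N0).trans_eq (by ring)

end DiscCutoff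

section Exterior

theorem dd_mul_abs_le {f g : ℂ → ℝ} (hf : ContDiff ℝ ∞ f) (hg : ContDiff ℝ ∞ g) {v x : ℂ} {A B : ℝ}
    (f1 : |f x| ≤ 1) (g1 : |g x| ≤ 1) (fA : |dd v f x| ≤ A) (gB : |dd v g x| ≤ B) :
    |dd v (fun x => f x * g x) x| ≤ A + B := by
  rw [dd_mul hf hg]
  refine (abs_add_le _ _).trans (add_le_add ?_ ?_)
  · rw [abs_mul]
    have := mul_le_mul fA g1 (abs_nonneg _) ((abs_nonneg _).trans fA)
    linarith
  · rw [abs_mul]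
    have := mul_le_mul f1 gB (abs_nonneg _) zero_le_one
    linarith

/-- Outside two discs the potential is small if the modulus is close to one there. -/
theorem exists_exterior_bound : ∃ C, 0 < C ∧ ∀ {c : ℝ} {a b : ℂ → ℝ}, Sol c a b → 0 ≤ c → Integrable (ed a b) →
    ∀ {z₁ z₂ : ℂ} {r τ : ℝ}, 0 < r → 0 ≤ τ → τ ≤ 1 / 2 →
    (∀ x, r < ‖x - z₁‖ → r < ‖x - z₂‖ → |cw a b x| ≤ τ) →
    ∫ x in {x | 2 * r < ‖x - z₁‖ ∧ 2 * r < ‖x - z₂‖}, cw a b x ^ 2 ≤ C * (τ + c + 1 / r) * ∫ x, ed a b x := by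
  obtain ⟨N, N0, hN⟩ := exists_cut_deriv_bound
  refine ⟨8 * (1 + 13 * N), by positivity, ?_⟩
  intro c a b h hc hI z₁ z₂ r τ hr hτ0 hτ hw
  have ha := h.smooth_a
  have hb := h.smooth_b
  set A : Set ℂ := {x | 2 * r < ‖x - z₁‖ ∧ 2 * r < ‖x - z₂‖} with hA
  have mA : MeasurableSet A :=
    ((isOpen_lt (g := fun x : ℂ => ‖x - z₁‖) continuous_const (by fun_prop)).inter
      (isOpen_lt (g := fun x : ℂ => ‖x - z₂‖) continuous_const (by fun_prop))).measurableSet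
  have hIw : Integrable (fun x => cw a b x ^ 2) :=
    ((integrable_cw_sq ha hb hI).const_mul 2).congr (Eventually.of_forall fun x => by ring)
  have E0 : 0 ≤ ∫ x, ed a b x := integral_nonneg fun x => ed_nonneg x
  have main : ∀ R, r ≤ R → ∫ x in closedBall 0 R, A.indicator (fun x => cw a b x ^ 2) x ≤
      8 * (1 + 13 * N) * (τ + c + 1 / r) * ∫ x, ed a b x := by
    intro R hR
    have hR0 : 0 < R := hr.trans_le hR
    set ξ : ℂ → ℝ := fun x => disc 0 R x * ((1 - disc z₁ r x) * (1 - disc z₂ r x)) with hξ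
    have d0 := contDiff_disc 0 R
    have d1 : ContDiff ℝ ∞ fun x => 1 - disc z₁ r x := contDiff_const.sub (contDiff_disc z₁ r)
    have d2 : ContDiff ℝ ∞ fun x => 1 - disc z₂ r x := contDiff_const.sub (contDiff_disc z₂ r)
    have sξ : ContDiff ℝ ∞ ξ := d0.mul (d1.mul d2)
    have b0 : ∀ x, 0 ≤ disc 0 R x ∧ disc 0 R x ≤ 1 := fun x => ⟨disc_nonneg _ _ _, disc_le_one _ _ _⟩
    have b1 : ∀ z x, 0 ≤ 1 - disc z r x ∧ 1 - disc z r x ≤ 1 := fun z x =>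
      ⟨by linarith [disc_le_one z r x], by linarith [disc_nonneg z r x]⟩
    have ξ0 : ∀ x, 0 ≤ ξ x := fun x => mul_nonneg (b0 x).1 (mul_nonneg (b1 _ x).1 (b1 _ x).1)
    have ξ1 : ∀ x, ξ x ≤ 1 := fun x => mul_le_one₀ (b0 x).2 (mul_nonneg (b1 _ x).1 (b1 _ x).1)
      (mul_le_one₀ (b1 _ x).2 (b1 _ x).1 (b1 _ x).2)
    have cs : HasCompactSupport ξ := by
      refine HasCompactSupport.intro (isCompact_closedBall (0:ℂ) (2 * R)) fun x hx => ?_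
      rw [mem_closedBall, dist_eq_norm, not_le] at hx
      simp only [hξ]
      rw [disc_eq_zero hR0 hx.le, zero_mul]
    have grad : ∀ x v, v = 1 ∨ v = Complex.I → |dd v ξ x| ≤ 9 * N / r := by
      intro x v hv
      have g1 : ∀ z, |dd v (fun x => 1 - disc z r x) x| ≤ 3 * N / r := by
        intro z
        rw [dd_sub contDiff_const (contDiff_disc z r), dd_const]
        beta_reduce
        rw [zero_sub, abs_neg]
        exact abs_dd_disc_le N0 hN z hr x hv
      have g0 : |dd v (disc 0 R) x| ≤ 3 * N / r :=
        (abs_dd_disc_le N0 hN 0 hR0 x hv).trans (by gcongr)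
      have a1 : ∀ z, |1 - disc z r x| ≤ 1 := fun z => by rw [abs_of_nonneg (b1 z x).1]; exact (b1 z x).2
      have a0 : |disc 0 R x| ≤ 1 := by rw [abs_of_nonneg (b0 x).1]; exact (b0 x).2
      have := dd_mul_abs_le (f := disc 0 R) (g := fun x => (1 - disc z₁ r x) * (1 - disc z₂ r x)) d0 (d1.mul d2) (v := v) (x := x) a0 (by
        rw [abs_mul]; exact mul_le_one₀ (a1 _) (abs_nonneg _) (a1 _)) g0
        (dd_mul_abs_le (f := fun x => 1 - disc z₁ r x) (g := fun x => 1 - disc z₂ r x) d1 d2 (a1 _) (a1 _) (g1 _) (g1 _))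
      refine this.trans_eq (by ring)
    have grad2 : ∀ x, dd 1 ξ x ^ 2 + dd Complex.I ξ x ^ 2 ≤ (13 * N / r) ^ 2 := by
      intro x
      have g1 := sq_le_sq' (abs_le.1 (grad x 1 (Or.inl rfl))).1 (abs_le.1 (grad x 1 (Or.inl rfl))).2
      have g2 := sq_le_sq' (abs_le.1 (grad x _ (Or.inr rfl))).1 (abs_le.1 (grad x _ (Or.inr rfl))).2
      have : (13 * N / r) ^ 2 = 169 / 81 * (9 * N / r) ^ 2 := by ring
      nlinarith [sq_nonneg (9 * N / r)]
    have hwξ : ∀ x, ξ x ≠ 0 → |cw a b x| ≤ τ := by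
      intro x hx
      refine hw x ?_ ?_
      · by_contra! hcon
        exact hx (by simp only [hξ]; rw [disc_eq_one hr hcon]; ring)
      · by_contra! hcon
        exact hx (by simp only [hξ]; rw [disc_eq_one hr hcon]; ring)
    have fin := h.integral_cutoff_le hc hI sξ cs ξ0 ξ1 (δ := 13 * N / r) (by positivity) hτ hτ0 grad2 hwξ
    have le1 : ∫ x in closedBall 0 R, A.indicator (fun x => cw a b x ^ 2) x ≤ ∫ x, ξ x ^ 2 * cw a b x ^ 2 := by
      rw [← integral_indicator measurableSet_closedBall]
      refine integral_mono ((hIw.indicator mA).indicator measurableSet_closedBall) ?_ ?_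
      · refine hIw.mono' (((sξ.continuous.pow 2).mul ((continuous_cw ha hb).pow 2)).aestronglyMeasurable) (Eventually.of_forall fun x => ?_)
        rw [Real.norm_eq_abs, abs_of_nonneg (by positivity)]
        have : ξ x ^ 2 ≤ 1 := pow_le_one₀ (ξ0 x) (ξ1 x)
        nlinarith [sq_nonneg (cw a b x)]
      · intro x
        by_cases hx : x ∈ closedBall (0:ℂ) R
        · by_cases hxA : x ∈ A
          · rw [Set.indicator_of_mem hx, Set.indicator_of_mem hxA]
            have : ξ x = 1 := by
              simp only [hξ]
              rw [disc_eq_one hR0 (by simpa [dist_eq_norm] using hx), disc_eq_zero hr hxA.1.le, disc_eq_zero hr hxA.2.le]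
              ring
            simp [this]
          · rw [Set.indicator_of_mem hx, Set.indicator_of_notMem hxA]
            positivity
        · rw [Set.indicator_of_notMem hx]
          positivity
    refine le1.trans (fin.trans ?_)
    refine mul_le_mul_of_nonneg_right ?_ E0
    have e1 : 0 ≤ N * (τ + c) := by positivity
    have e2 : 0 ≤ 1 / r := by positivity
    have e3 : 13 * N / r = 13 * N * (1 / r) := by ring
    rw [e3]
    nlinarith
  have lim := (aecover_closedBall (μ := (volume : Measure ℂ)) (x := (0:ℂ)) (tendsto_id (α := ℝ) (x := atTop))).integral_tendsto_of_countably_generated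
    (hIw.indicator mA)
  rw [integral_indicator mA] at lim
  exact le_of_tendsto lim (by filter_upwards [eventually_ge_atTop r] with R hR using main R hR)

end Exterior

/-- Quantitative smallness relations between the scales of the problem. The scales are
logarithmic: `U` separates clusters, `ℓ` is the length of a cell, `Y` is the largest scale used. -/
structure Regime (c : ℝ) (a b : ℂ → ℝ) (τ μ ℓ U Y : ℝ) (N : ℕ) : Prop where
  sol : Sol c a b
  c_nonneg : 0 ≤ c
  c_le : c ≤ 1 / 30
  int : Integrable (ed a b)
  even_a : ∀ z, a (-(starRingEnd ℂ z)) = a z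
  even_b : ∀ z, b (-(starRingEnd ℂ z)) = b z
  τ_pos : 0 < τ
  τ_le : τ ≤ 1 / 8
  μ_eq : μ = τ ^ 4 / 100000
  ℓ_pos : 0 < ℓ
  U_pos : 0 < U
  cells : (2 * N + 1) * ℓ ≤ U
  gap : 4 * Real.exp (-U) < ℓ
  le_Y : 3 * U ≤ Y
  decay : 2 / ℓ * ((∫ x, ed a b x) * Real.exp (-(ℓ / 200))) + c * Real.exp Y * ∫ x, ed a b x < μ
  drift : c * Real.exp Y * ∫ x, ed a b x ≤ μ / 2
  energy : ∫ x, ed a b x < (N + 1) * (μ / 2 * U)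

section Regime
variable {c τ μ ℓ U Y : ℝ} {a b : ℂ → ℝ} {N : ℕ}

theorem ed_total_nonneg : 0 ≤ ∫ x, ed a b x := integral_nonneg fun x => ed_nonneg x

namespace Regime

theorem μ_pos (R : Regime c a b τ μ ℓ U Y N) : 0 < μ := by
  have := R.τ_pos
  rw [R.μ_eq]; positivity

theorem μ_le_pot (R : Regime c a b τ μ ℓ U Y N) {z : ℂ} (hz : τ ≤ |cw a b z|) : μ ≤ pot a b z 1 := by
  have h1 := R.sol.cw_pow_le_pot R.c_nonneg (R.c_le.trans (by norm_num)) z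
  have h2 : τ ^ 4 ≤ |cw a b z| ^ 4 := pow_le_pow_left₀ R.τ_pos.le hz 4
  have h3 : |cw a b z| ^ 4 = cw a b z ^ 4 := Even.pow_abs (by decide) _
  rw [R.μ_eq]
  linarith

/-- Around a cluster of vortices every clean annulus carries a non-trivial winding. -/
theorem wind_lower (R : Regime c a b τ μ ℓ U Y N) {z v : ℂ} {x y : ℝ} (hx : 0 ≤ x) (hxy : x + ℓ ≤ y)
    (hy : y ≤ Y) (hw : ∀ v, Real.exp x < ‖v - z‖ → ‖v - z‖ < Real.exp y → |cw a b v| < τ)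
    (hv : τ ≤ |cw a b v|) (hvz : ‖v - z‖ + 1 ≤ Real.exp x) :
    ∀ s ∈ Set.Ioo x y, 2 * Real.pi ≤ |wind a b z s| := by
  have ha := R.sol.smooth_a
  have hb := R.sol.smooth_b
  have hE := ed_total_nonneg (a := a) (b := b)
  have hℓ := R.ℓ_pos
  have hw' : ∀ v, Real.exp x < ‖v - z‖ → ‖v - z‖ < Real.exp y → |cw a b v| ≤ 1 / 8 := fun v h1 h2 =>
    (hw v h1 h2).le.trans R.τ_le
  rcases wind_dichotomy ha hb hw' with h0 | h0
  · exfalso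
    have h1 := R.sol.pot_le_of_wind_zero R.c_nonneg R.c_le R.int hx (by linarith) hw' h0
    have h2 := R.μ_le_pot hv
    have h3 : pot a b v 1 ≤ pot a b z (Real.exp x) := by
      refine pot_mono ha hb (closedBall_subset_closedBall' ?_)
      rw [dist_eq_norm]; linarith
    have h4 := R.decay
    have h5 : 2 / (y - x) * ((∫ x, ed a b x) * Real.exp (-((y - x) / 200))) ≤
        2 / ℓ * ((∫ x, ed a b x) * Real.exp (-(ℓ / 200))) := by
      have : ℓ ≤ y - x := by linarith
      gcongr
    have h6 : c * Real.exp y * ∫ x, ed a b x ≤ c * Real.exp Y * ∫ x, ed a b x := by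
      have := R.c_nonneg
      gcongr
    linarith
  · exact h0

theorem ringE_lower (R : Regime c a b τ μ ℓ U Y N) {z v : ℂ} {x y : ℝ} (hx : 0 ≤ x) (hxy : x + ℓ ≤ y)
    (hy : y ≤ Y) (hw : ∀ v, Real.exp x < ‖v - z‖ → ‖v - z‖ < Real.exp y → |cw a b v| < τ)
    (hv : τ ≤ |cw a b v|) (hvz : ‖v - z‖ + 1 ≤ Real.exp x) {s : ℝ} (hs : s ∈ Set.Ioo x y) :
    (1 - τ) * Real.pi ≤ ringE a b z s ∧ 2 * (1 - τ) * Real.pi - ringE a b z s ≤ ringA a b z s := by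
  refine ringE_of_wind R.sol.smooth_a R.sol.smooth_b (by linarith [R.τ_le]) (fun v hv => ?_)
    (R.wind_lower hx hxy hy hw hv hvz s hs)
  refine (hw v ?_ ?_).le
  · rw [hv]; exact Real.exp_lt_exp.2 hs.1
  · rw [hv]; exact Real.exp_lt_exp.2 hs.2

/-- A vortex carries a definite amount of energy in a disc of logarithmic size `U`. -/
theorem energy_ball_lower (R : Regime c a b τ μ ℓ U Y N) {z : ℂ} (hz : τ ≤ |cw a b z|) :
    μ / 2 * U ≤ ∫ x in closedBall z (Real.exp U), ed a b x := by
  have ha := R.sol.smooth_a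
  have hb := R.sol.smooth_b
  have hU := R.U_pos
  have hE := ed_total_nonneg (a := a) (b := b)
  have h1 := integral_ringE ha hb z hU.le
  have h2 : ∫ x in {x | Real.exp 0 < ‖x - z‖ ∧ ‖x - z‖ ≤ Real.exp U}, ed a b x ≤ ∫ x in closedBall z (Real.exp U), ed a b x := by
    refine setIntegral_mono_set R.int.integrableOn (Eventually.of_forall fun x => ed_nonneg x) (LE.le.eventuallyLE ?_)
    intro x hx
    rw [mem_closedBall, dist_eq_norm]
    exact hx.2
  rw [← h1] at h2
  refine le_trans ?_ h2
  have h3 : ∫ s in (0:ℝ)..U, μ / 2 ≤ ∫ s in (0:ℝ)..U, ringE a b z s := by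
    refine intervalIntegral.integral_mono_on hU.le (by simp) ((continuous_ringE ha hb z).intervalIntegrable _ _) fun s hs => ?_
    have p1 := (abs_le.1 (R.sol.pohozaev R.c_nonneg R.int z s)).1
    have p2 := ringA_le_ringE ha hb z s
    have p3 := R.μ_le_pot hz
    have p4 : pot a b z 1 ≤ pot a b z (Real.exp s) := by
      refine pot_mono ha hb (closedBall_subset_closedBall ?_)
      exact Real.one_le_exp hs.1
    have p5 : c * Real.exp s * ∫ x, ed a b x ≤ c * Real.exp Y * ∫ x, ed a b x := by
      have := R.c_nonneg
      have : s ≤ Y := by linarith [hs.2, R.le_Y]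
      gcongr
    linarith [R.drift]
  rw [intervalIntegral.integral_const] at h3
  simp only [sub_zero, smul_eq_mul] at h3
  linarith

theorem card_le (R : Regime c a b τ μ ℓ U Y N) {s : Finset ℂ} (hs : ∀ z ∈ s, τ ≤ |cw a b z|)
    (hsep : ∀ z ∈ s, ∀ z' ∈ s, z ≠ z' → 2 * Real.exp U < ‖z - z'‖) : s.card ≤ N := by
  have h1 : ∑ z ∈ s, ∫ x in closedBall z (Real.exp U), ed a b x = ∫ x in ⋃ z ∈ s, closedBall z (Real.exp U), ed a b x := by
    rw [integral_biUnion_finset s (fun z _ => measurableSet_closedBall) ?_ (fun z _ => R.int.integrableOn)]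
    intro z hz z' hz' hne
    refine closedBall_disjoint_closedBall ?_
    rw [dist_eq_norm]
    linarith [hsep z hz z' hz' hne]
  have h2 : ∫ x in ⋃ z ∈ s, closedBall z (Real.exp U), ed a b x ≤ ∫ x, ed a b x :=
    setIntegral_le_integral R.int (Eventually.of_forall fun x => ed_nonneg x)
  have h3 : ∑ z ∈ s, μ / 2 * U ≤ ∑ z ∈ s, ∫ x in closedBall z (Real.exp U), ed a b x :=
    Finset.sum_le_sum fun z hz => R.energy_ball_lower (hs z hz)
  rw [Finset.sum_const, nsmul_eq_mul] at h3
  have h4 := R.energy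
  have h5 : 0 < μ / 2 * U := by have := R.μ_pos; have := R.U_pos; positivity
  by_contra! hcon
  have h6 : ((N : ℝ) + 1) ≤ s.card := by exact_mod_cast hcon
  have := mul_le_mul_of_nonneg_right h6 h5.le
  linarith

/-- The vortices are covered by few discs of logarithmic size `U`. -/
theorem exists_cover (R : Regime c a b τ μ ℓ U Y N) :
    ∃ s : Finset ℂ, s.card ≤ N ∧ ∀ v, τ ≤ |cw a b v| → ∃ z ∈ s, ‖v - z‖ ≤ 2 * Real.exp U := by
  classical
  set P : ℕ → Prop := fun n => ∃ s : Finset ℂ, s.card = n ∧ (∀ z ∈ s, τ ≤ |cw a b z|) ∧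
    (∀ z ∈ s, ∀ z' ∈ s, z ≠ z' → 2 * Real.exp U < ‖z - z'‖) with hP
  have h0 : P 0 := ⟨∅, by simp⟩
  have hspec : P (Nat.findGreatest P N) := Nat.findGreatest_spec (Nat.zero_le N) h0
  obtain ⟨s, hs, hs1, hs2⟩ := hspec
  refine ⟨s, R.card_le hs1 hs2, fun v hv => ?_⟩
  by_contra! hcon
  have hvs : v ∉ s := fun hmem => by
    have := hcon v hmem
    simp only [sub_self, norm_zero] at this
    linarith [Real.exp_pos U]
  have b1 : ∀ z ∈ insert v s, τ ≤ |cw a b z| := by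
    intro z hz
    rcases Finset.mem_insert.1 hz with rfl | hz
    · exact hv
    · exact hs1 z hz
  have b2 : ∀ z ∈ insert v s, ∀ z' ∈ insert v s, z ≠ z' → 2 * Real.exp U < ‖z - z'‖ := by
    intro z hz z' hz' hne
    rcases Finset.mem_insert.1 hz with hz1 | hz1 <;> rcases Finset.mem_insert.1 hz' with hz2 | hz2
    · exact absurd (hz1.trans hz2.symm) hne
    · rw [hz1]; exact hcon z' hz2
    · rw [hz2, norm_sub_rev]; exact hcon z hz1
    · exact hs2 z hz1 z' hz2 hne
  have hPn : P (insert v s).card := ⟨_, rfl, b1, b2⟩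
  have := Nat.le_findGreatest (R.card_le b1 b2) hPn
  rw [Finset.card_insert_of_notMem hvs, hs] at this
  omega

/-- The annulus `exp x < |v - z| < exp y` contains no vortex. -/
def Clean (a b : ℂ → ℝ) (τ : ℝ) (z : ℂ) (x y : ℝ) : Prop :=
  ∀ v, Real.exp x < ‖v - z‖ → ‖v - z‖ < Real.exp y → |cw a b v| < τ

theorem hit_adjacent {ℓ U S : ℝ} (hℓ : 0 < ℓ) (gap : 4 * Real.exp (-U) < ℓ) (hS : 2 * U ≤ S) {z y v v' : ℂ}
    (hv : ‖v - y‖ ≤ 2 * Real.exp U) (hv' : ‖v' - y‖ ≤ 2 * Real.exp U) {k k' : ℕ}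
    (h1 : ‖v - z‖ < Real.exp (S + (k + 1) * ℓ)) (h1' : Real.exp (S + k' * ℓ) < ‖v' - z‖) :
    k' ≤ k + 1 := by
  by_contra! hcon
  have hk : (k : ℝ) + 2 ≤ k' := by exact_mod_cast hcon
  have e1 : ‖v' - z‖ ≤ ‖v - z‖ + 4 * Real.exp U := by
    have : v' - z = (v' - y) - (v - y) + (v - z) := by ring
    rw [this]
    refine (norm_add_le _ _).trans ?_
    have := norm_sub_le (v' - y) (v - y)
    linarith
  have e2 : Real.exp (S + (k + 1) * ℓ) * Real.exp ℓ ≤ Real.exp (S + k' * ℓ) := by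
    rw [← Real.exp_add]
    refine Real.exp_le_exp.2 ?_
    nlinarith
  have e3 : Real.exp U ≤ Real.exp (S + (k + 1) * ℓ) * Real.exp (-U) := by
    rw [← Real.exp_add]
    refine Real.exp_le_exp.2 ?_
    have : 0 ≤ ((k:ℝ) + 1) * ℓ := by positivity
    linarith
  have e4 := Real.add_one_le_exp ℓ
  have e5 := Real.exp_pos (S + (k + 1) * ℓ)
  nlinarith

theorem exists_clean (R : Regime c a b τ μ ℓ U Y N) (z : ℂ) {S : ℝ} (hS : 2 * U ≤ S) (n : ℕ) :
    ∃ G : Finset ℕ, G ⊆ Finset.range n ∧ n ≤ G.card + 2 * N ∧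
      ∀ k ∈ G, Clean a b τ z (S + k * ℓ) (S + (k + 1) * ℓ) := by
  classical
  obtain ⟨s, hs, hcov⟩ := R.exists_cover
  set H : ℂ → Finset ℕ := fun y => (Finset.range n).filter fun k =>
    ∃ v, ‖v - y‖ ≤ 2 * Real.exp U ∧ Real.exp (S + k * ℓ) < ‖v - z‖ ∧ ‖v - z‖ < Real.exp (S + (k + 1) * ℓ) with hH
  have cH : ∀ y, (H y).card ≤ 2 := by
    intro y
    by_cases hne : (H y).Nonempty
    · have sub : H y ⊆ {(H y).min' hne, (H y).min' hne + 1} := by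
        intro k hk
        have hm := Finset.min'_mem _ hne
        have hle := Finset.min'_le _ k hk
        obtain ⟨v, q1, q2, q3⟩ := (Finset.mem_filter.1 hm).2
        obtain ⟨v', q1', q2', q3'⟩ := (Finset.mem_filter.1 hk).2
        have := hit_adjacent R.ℓ_pos R.gap hS q1 q1' q3 q2'
        rw [Finset.mem_insert, Finset.mem_singleton]
        omega
      exact (Finset.card_le_card sub).trans Finset.card_le_two
    · rw [Finset.not_nonempty_iff_eq_empty.1 hne]; simp
  refine ⟨Finset.range n \ s.biUnion H, Finset.sdiff_subset, ?_, ?_⟩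
  · have h1 := Finset.card_biUnion_le_card_mul s H 2 fun y _ => cH y
    have h2 := Finset.le_card_sdiff (s.biUnion H) (Finset.range n)
    rw [Finset.card_range] at h2
    omega
  · intro k hk v h1 h2
    rw [Finset.mem_sdiff] at hk
    by_contra! hbad
    obtain ⟨y, hy, hvy⟩ := hcov v hbad
    exact hk.2 (Finset.mem_biUnion.2 ⟨y, hy, Finset.mem_filter.2 ⟨hk.1, v, hvy, h1, h2⟩⟩)

/-- Lower bound for the energy in an annulus around a vortex. -/
theorem annulus_lower (R : Regime c a b τ μ ℓ U Y N) {z : ℂ} (hz : τ ≤ |cw a b z|) {S S' : ℝ}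
    (hS : 2 * U ≤ S) (hSS : S ≤ S') (hS' : S' ≤ Y) :
    (1 - τ) * Real.pi * (S' - S - U) ≤ ∫ s in S..S', ringE a b z s := by
  have ha := R.sol.smooth_a
  have hb := R.sol.smooth_b
  have hℓ := R.ℓ_pos
  have hU := R.U_pos
  have hcont := continuous_ringE ha hb z
  set n : ℕ := ⌊(S' - S) / ℓ⌋₊ with hn
  have hn1 : n * ℓ ≤ S' - S := by
    rw [← le_div_iff₀ hℓ]
    exact Nat.floor_le (by have := sub_nonneg.2 hSS; positivity)
  have hn2 : S' - S < (n + 1) * ℓ := by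
    rw [← div_lt_iff₀ hℓ]
    exact Nat.lt_floor_add_one _
  obtain ⟨G, hG, hcard, hclean⟩ := R.exists_clean z hS n
  have q0 : 0 ≤ (1 - τ) * Real.pi := mul_nonneg (by linarith [R.τ_le]) Real.pi_pos.le
  have cell : ∀ k ∈ G, (1 - τ) * Real.pi * ℓ ≤ ∫ s in (S + k * ℓ)..(S + (k + 1 : ℕ) * ℓ), ringE a b z s := by
    intro k hk
    have hkn : ((k:ℝ) + 1) ≤ n := by exact_mod_cast Finset.mem_range.1 (hG hk)
    have hle : S + (k:ℝ) * ℓ ≤ S + (k + 1 : ℕ) * ℓ := by push_cast; nlinarith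
    have h0 : ∫ s in (S + k * ℓ)..(S + (k + 1 : ℕ) * ℓ), (1 - τ) * Real.pi ≤ ∫ s in (S + k * ℓ)..(S + (k + 1 : ℕ) * ℓ), ringE a b z s := by
      refine intervalIntegral.integral_mono_on_of_le_Ioo hle (by simp) (hcont.intervalIntegrable _ _) fun s hs => ?_
      have hk0 : 0 ≤ (k:ℝ) * ℓ := by positivity
      have hk1 : ((k:ℝ) + 1) * ℓ ≤ n * ℓ := mul_le_mul_of_nonneg_right hkn hℓ.le
      push_cast at hs
      refine (R.ringE_lower (v := z) (x := S + k * ℓ) (y := S + (k + 1) * ℓ) ?_ ?_ ?_ (hclean k hk) hz ?_ hs).1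
      · linarith
      · linarith
      · linarith
      · simp only [sub_self, norm_zero, zero_add]
        exact Real.one_le_exp (by linarith)
    rw [intervalIntegral.integral_const] at h0
    push_cast at h0 ⊢
    simp only [smul_eq_mul] at h0
    linarith
  have sum1 : ∑ k ∈ Finset.range n, ∫ s in (S + k * ℓ)..(S + (k + 1 : ℕ) * ℓ), ringE a b z s = ∫ s in S..(S + n * ℓ), ringE a b z s := by
    have := intervalIntegral.sum_integral_adjacent_intervals (f := ringE a b z) (μ := volume) (a := fun k : ℕ => S + k * ℓ) (n := n)
      fun k _ => hcont.intervalIntegrable _ _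
    simpa using this
  have nonneg : ∀ x y : ℝ, x ≤ y → 0 ≤ ∫ s in x..y, ringE a b z s := fun x y hxy =>
    intervalIntegral.integral_nonneg hxy fun s _ => ringE_nonneg z s
  have sum2 : ∑ k ∈ G, ∫ s in (S + k * ℓ)..(S + (k + 1 : ℕ) * ℓ), ringE a b z s ≤
      ∑ k ∈ Finset.range n, ∫ s in (S + k * ℓ)..(S + (k + 1 : ℕ) * ℓ), ringE a b z s := by
    refine Finset.sum_le_sum_of_subset_of_nonneg hG fun k _ _ => nonneg _ _ ?_
    push_cast; nlinarith
  have sum3 := Finset.sum_le_sum cell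
  rw [Finset.sum_const, nsmul_eq_mul] at sum3
  have split := intervalIntegral.integral_add_adjacent_intervals (μ := volume)
    (hcont.intervalIntegrable S (S + n * ℓ)) (hcont.intervalIntegrable (S + n * ℓ) S')
  have tail := nonneg (S + n * ℓ) S' (by linarith)
  have hc' : (n : ℝ) ≤ G.card + 2 * N := by exact_mod_cast hcard
  have hcells := R.cells
  have : S' - S - U ≤ G.card * ℓ := by nlinarith
  have := mul_le_mul_of_nonneg_left this q0
  linarith

/-- Vortices are far from the symmetry axis. -/
theorem far_from_axis (R : Regime c a b τ μ ℓ U Y N) {y : ℂ} (hy : τ ≤ |cw a b y|) :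
    Real.exp (Y - U) < |y.re| + 1 := by
  by_contra! hcon
  have hℓ := R.ℓ_pos
  have hU := R.U_pos
  have hY := R.le_Y
  obtain ⟨G, hG, hcard, hclean⟩ := R.exists_clean (y.im * Complex.I) (S := Y - U) (by linarith) (2 * N + 1)
  have hne : G.Nonempty := by
    rw [← Finset.card_pos]; omega
  obtain ⟨k, hk⟩ := hne
  have hkn : ((k:ℝ) + 1) ≤ 2 * N + 1 := by exact_mod_cast Finset.mem_range.1 (hG hk)
  have hk0 : 0 ≤ (k:ℝ) * ℓ := by positivity
  have hk1 : ((k:ℝ) + 1) * ℓ ≤ (2 * N + 1) * ℓ := mul_le_mul_of_nonneg_right hkn hℓ.le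
  have hcells := R.cells
  have hnorm : ‖y - y.im * Complex.I‖ = |y.re| := by
    rw [show y - y.im * Complex.I = (y.re : ℂ) by
      apply Complex.ext <;> simp]
    rw [Complex.norm_real, Real.norm_eq_abs]
  have := R.wind_lower (v := y) (x := Y - U + k * ℓ) (y := Y - U + (k + 1) * ℓ) (by linarith) (by linarith) (by linarith)
    (hclean k hk) hy (by
      rw [hnorm]
      exact hcon.trans (Real.exp_le_exp.2 (by linarith)))
    (Y - U + k * ℓ + ℓ / 2) ⟨by linarith, by linarith⟩
  rw [wind_zero_of_axis R.sol.smooth_a R.sol.smooth_b R.even_a R.even_b (by simp), abs_zero] at this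
  linarith [Real.pi_pos]

end Regime

end Regime

/-- The reflection across the imaginary axis. -/
def reflect : ℂ ≃ₗᵢ[ℝ] ℂ := Complex.conjLIE.trans (LinearIsometryEquiv.neg ℝ)

theorem reflect_apply (z : ℂ) : reflect z = -(starRingEnd ℂ z) := rfl

theorem reflect_re (z : ℂ) : (reflect z).re = -z.re := by simp [reflect_apply]

theorem reflect_reflect (z : ℂ) : reflect (reflect z) = z := by simp [reflect_apply]

section Reflect
variable {a b : ℂ → ℝ}

theorem dd_reflect {f : ℂ → ℝ} (hf : ContDiff ℝ ∞ f) (ef : ∀ z, f (-(starRingEnd ℂ z)) = f z) (v z : ℂ) :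
    dd (reflect v) f (reflect z) = dd v f z := by
  have h1 : f ∘ reflect = f := funext ef
  have h2 : fderiv ℝ (f ∘ reflect) z = _ :=
    fderiv_comp z ((smooth_differentiable hf) _) reflect.differentiableAt
  rw [h1] at h2
  unfold dd
  rw [h2, ContinuousLinearMap.comp_apply]
  congr 1
  rw [show (fderiv ℝ (⇑reflect) z) = (reflect.toContinuousLinearEquiv : ℂ →L[ℝ] ℂ) from
    reflect.toContinuousLinearEquiv.fderiv]
  rfl

theorem cw_reflect (ea : ∀ z, a (-(starRingEnd ℂ z)) = a z) (eb : ∀ z, b (-(starRingEnd ℂ z)) = b z) (z : ℂ) :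
    cw a b (reflect z) = cw a b z := by
  unfold cw
  rw [reflect_apply, ea, eb]

theorem ed_reflect (ha : ContDiff ℝ ∞ a) (hb : ContDiff ℝ ∞ b) (ea : ∀ z, a (-(starRingEnd ℂ z)) = a z)
    (eb : ∀ z, b (-(starRingEnd ℂ z)) = b z) (z : ℂ) : ed a b (reflect z) = ed a b z := by
  have h1 : reflect 1 = (-1 : ℂ) := by simp [reflect_apply]
  have hI : reflect Complex.I = Complex.I := by simp [reflect_apply]
  have key : ∀ {f : ℂ → ℝ}, ContDiff ℝ ∞ f → (∀ z, f (-(starRingEnd ℂ z)) = f z) →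
      dd 1 f (reflect z) ^ 2 = dd 1 f z ^ 2 ∧ dd Complex.I f (reflect z) = dd Complex.I f z := by
    intro f hf ef
    have e1 := dd_reflect hf ef 1 z
    have e2 := dd_reflect hf ef Complex.I z
    rw [h1] at e1
    rw [hI] at e2
    refine ⟨?_, e2⟩
    rw [← e1]
    unfold dd
    rw [map_neg, neg_sq]
  unfold ed
  rw [(key ha ea).1, (key ha ea).2, (key hb eb).1, (key hb eb).2, cw_reflect ea eb]

theorem setIntegral_reflect (f : ℂ → ℝ) (s : Set ℂ) :
    ∫ x in reflect ⁻¹' s, f (reflect x) = ∫ x in s, f x :=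
  reflect.measurePreserving.setIntegral_preimage_emb reflect.toHomeomorph.measurableEmbedding f s

theorem pot_reflect (ea : ∀ z, a (-(starRingEnd ℂ z)) = a z) (eb : ∀ z, b (-(starRingEnd ℂ z)) = b z) (z : ℂ)
    (r : ℝ) : pot a b (reflect z) r = pot a b z r := by
  unfold pot
  rw [← setIntegral_reflect]
  simp only [cw_reflect ea eb]
  congr 2
  ext x
  simp only [Set.mem_preimage, mem_closedBall]
  rw [reflect.dist_map]

/-- By symmetry the right half-plane carries at most half of the energy. -/
theorem integral_ed_right_le (ha : ContDiff ℝ ∞ a) (hb : ContDiff ℝ ∞ b) (hI : Integrable (ed a b))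
    (ea : ∀ z, a (-(starRingEnd ℂ z)) = a z) (eb : ∀ z, b (-(starRingEnd ℂ z)) = b z) :
    2 * ∫ x in {x : ℂ | 0 < x.re}, ed a b x ≤ ∫ x, ed a b x := by
  have h1 : ∫ x in {x : ℂ | x.re < 0}, ed a b x = ∫ x in {x : ℂ | 0 < x.re}, ed a b x := by
    rw [← setIntegral_reflect]
    simp only [ed_reflect ha hb ea eb]
    congr 2
    ext x
    simp [reflect_re]
  have h2 : ∫ x in {x : ℂ | 0 < x.re} ∪ {x : ℂ | x.re < 0}, ed a b x ≤ ∫ x, ed a b x :=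
    setIntegral_le_integral hI (Eventually.of_forall fun x => ed_nonneg x)
  rw [setIntegral_union _ (isOpen_lt Complex.continuous_re continuous_const).measurableSet
    hI.integrableOn hI.integrableOn, h1] at h2
  · linarith
  · rw [Set.disjoint_left]
    intro x hx hx'
    exact absurd (show 0 < x.re from hx) (not_lt.2 (show x.re < 0 from hx').le)

end Reflect

/-- The annulus `exp x < |v - z| ≤ exp y`. -/
def annulus (z : ℂ) (x y : ℝ) : Set ℂ := {v | Real.exp x < ‖v - z‖ ∧ ‖v - z‖ ≤ Real.exp y}

theorem measurableSet_annulus (z : ℂ) (x y : ℝ) : MeasurableSet (annulus z x y) := by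
  have h : Continuous fun v : ℂ => ‖v - z‖ := by fun_prop
  exact (isOpen_lt continuous_const h).measurableSet.inter (isClosed_le h continuous_const).measurableSet

/-- A `Regime` in which the energy is at most that of two vortices at the largest scale. -/
structure Pinched (c : ℝ) (a b : ℂ → ℝ) (β μ ℓ U L Λ : ℝ) (N : ℕ) : Prop where
  reg : Regime c a b β μ ℓ U (L - U) N
  β_le : β ≤ 1 / 1000
  U_eq : U = β * L
  Λ_nonneg : 0 ≤ Λ
  U_ge : 3 + Λ ≤ U
  energy_le : ∫ x, ed a b x ≤ 2 * Real.pi * L + Λ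

namespace Pinched
variable {c : ℝ} {a b : ℂ → ℝ} {β μ ℓ U L Λ : ℝ} {N : ℕ}

theorem U_le (R : Pinched c a b β μ ℓ U L Λ N) : 1000 * U ≤ L := by
  have h1 := R.reg.τ_pos
  have h2 := R.reg.U_pos
  have h3 : 0 < L := by
    have := R.U_eq
    by_contra! h
    nlinarith
  have := R.U_eq
  have := R.β_le
  nlinarith

theorem right_le (R : Pinched c a b β μ ℓ U L Λ N) :
    ∫ x in {x : ℂ | 0 < x.re}, ed a b x ≤ Real.pi * L + Λ / 2 := by
  have h1 := integral_ed_right_le R.reg.sol.smooth_a R.reg.sol.smooth_b R.reg.int R.reg.even_a R.reg.even_b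
  have h2 := R.energy_le
  linarith

theorem abs_re (R : Pinched c a b β μ ℓ U L Λ N) {y : ℂ} (hy : β ≤ |cw a b y|) :
    Real.exp (L - 3 * U) < |y.re| := by
  have h1 := R.reg.far_from_axis hy
  have h2 := R.U_ge
  have h3 := R.Λ_nonneg
  have h4 := R.U_le
  have e1 : Real.exp (L - U - U) = Real.exp (L - 3 * U) * Real.exp U := by
    rw [← Real.exp_add]; congr 1; ring
  have e2 := Real.add_one_le_exp U
  have e3 : 1 ≤ Real.exp (L - 3 * U) := Real.one_le_exp (by linarith)
  nlinarith

theorem annulus_lower (R : Pinched c a b β μ ℓ U L Λ N) {z : ℂ} (hz : β ≤ |cw a b z|) {S S' : ℝ}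
    (hS : 2 * U ≤ S) (hSS : S ≤ S') (hS' : S' ≤ L - 3 * U) :
    (1 - β) * Real.pi * (S' - S - U) ≤ ∫ x in annulus z S S', ed a b x := by
  refine (R.reg.annulus_lower hz hS hSS (by linarith [R.reg.U_pos])).trans_eq ?_
  exact integral_ringE R.reg.sol.smooth_a R.reg.sol.smooth_b z hSS

theorem annulus_subset {z : ℂ} {S S' T : ℝ} (hz : Real.exp T < z.re) (hS : S' ≤ T) :
    annulus z S S' ⊆ {x : ℂ | 0 < x.re} := by
  intro x hx
  have h1 := hx.2
  have h2 := Complex.abs_re_le_norm (x - z)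
  have h3 := Real.exp_le_exp.2 hS
  rw [Complex.sub_re] at h2
  have := (abs_le.1 h2).1
  show 0 < x.re
  linarith

/-- All vortices of the right half-plane lie in a single cluster. -/
theorem cluster (R : Pinched c a b β μ ℓ U L Λ N) {z y : ℂ} (hz : β ≤ |cw a b z|) (hy : β ≤ |cw a b y|)
    (hz0 : 0 < z.re) (hy0 : 0 < y.re) : ‖y - z‖ ≤ Real.exp (14 * U) := by
  by_contra! hD
  have hU := R.reg.U_pos
  have hUL := R.U_le
  have hUge := R.U_ge
  have hΛ := R.Λ_nonneg
  have hβ := R.reg.τ_pos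
  have hβ' := R.β_le
  have z1 := R.abs_re hz
  have y1 := R.abs_re hy
  rw [abs_of_pos hz0] at z1
  rw [abs_of_pos hy0] at y1
  set D := ‖y - z‖ with hDdef
  have D0 : 0 < D := (Real.exp_pos _).trans hD
  have hlog3 : Real.log 3 < 2 := by
    have := Real.log_lt_sub_one_of_pos (x := 3) (by norm_num) (by norm_num)
    linarith
  set t0 := Real.log (D / 3) with ht0
  have et0 : Real.exp t0 = D / 3 := Real.exp_log (by positivity)
  have t0_gt : 14 * U - 2 < t0 := by
    rw [ht0, Real.log_div D0.ne' (by norm_num)]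
    have := (Real.lt_log_iff_exp_lt D0).2 hD
    linarith
  set T := L - 3 * U with hT
  set t := min t0 T with ht
  have t_le : t ≤ T := min_le_right _ _
  have t_gt : 13 * U ≤ t := le_min (by linarith) (by linarith)
  have et : Real.exp t ≤ D / 3 := et0 ▸ Real.exp_le_exp.2 (min_le_left _ _)
  set t3 := min (t + 2) T with ht3
  have t3_le : t3 ≤ t + 2 := min_le_left _ _
  have t3_ge : t ≤ t3 := le_min (by linarith) t_le
  have l1 := R.annulus_lower hz le_rfl (show 2 * U ≤ t by linarith) t_le
  have l2 := R.annulus_lower hy le_rfl (show 2 * U ≤ t by linarith) t_le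
  have l3 := R.annulus_lower hz (show 2 * U ≤ t3 by linarith) (min_le_right _ _) le_rfl
  have hint := R.reg.int
  have d12 : Disjoint (annulus z (2 * U) t) (annulus y (2 * U) t) := by
    rw [Set.disjoint_left]
    intro x hx hx'
    have q1 := hx.2
    have q2 := hx'.2
    have : D ≤ ‖x - z‖ + ‖x - y‖ := by
      rw [hDdef, show y - z = (x - z) - (x - y) by ring]
      exact norm_sub_le _ _
    linarith
  have d3 : Disjoint (annulus z (2 * U) t ∪ annulus y (2 * U) t) (annulus z t3 T) := by
    rw [Set.disjoint_left]
    intro x hx hx'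
    have q3 := hx'.1
    have tT : t3 < T := Real.exp_lt_exp.1 (q3.trans_le hx'.2)
    have t3eq : t3 = t + 2 := by
      rcases min_choice (t + 2) T with h | h
      · exact h
      · rw [← ht3] at h; exact absurd h tT.ne
    have teq : t = t0 := by
      rcases min_choice t0 T with h | h
      · exact h
      · rw [← ht] at h; linarith
    have et2 : 4 * Real.exp t ≤ Real.exp t3 := by
      rw [t3eq, Real.exp_add]
      have : (4:ℝ) ≤ Real.exp 2 := by
        have := Real.add_one_le_exp (1:ℝ)
        rw [show (2:ℝ) = 1 + 1 by norm_num, Real.exp_add]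
        nlinarith
      have := Real.exp_pos t
      nlinarith
    have et' : Real.exp t = D / 3 := teq ▸ et0
    rcases hx with hx | hx
    · have := hx.2
      have := Real.exp_pos t
      linarith
    · have q2 := hx.2
      have : ‖x - z‖ ≤ ‖x - y‖ + D := by
        rw [hDdef, show x - z = (x - y) + (y - z) by ring]
        exact norm_add_le _ _
      linarith
  have sub : annulus z (2 * U) t ∪ annulus y (2 * U) t ∪ annulus z t3 T ⊆ {x : ℂ | 0 < x.re} :=
    Set.union_subset (Set.union_subset (annulus_subset z1 t_le) (annulus_subset y1 t_le)) (annulus_subset z1 le_rfl)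
  have tot : ∫ x in annulus z (2 * U) t ∪ annulus y (2 * U) t ∪ annulus z t3 T, ed a b x ≤ ∫ x in {x : ℂ | 0 < x.re}, ed a b x :=
    setIntegral_mono_set hint.integrableOn (Eventually.of_forall fun x => ed_nonneg x) (LE.le.eventuallyLE sub)
  rw [setIntegral_union d3 (measurableSet_annulus _ _ _) hint.integrableOn hint.integrableOn,
    setIntegral_union d12 (measurableSet_annulus _ _ _) hint.integrableOn hint.integrableOn] at tot
  have hr := R.right_le
  have hpi := Real.pi_gt_three
  have hpi' := Real.pi_le_four
  have hbL := R.U_eq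
  have f1 : (1 - β) * Real.pi * (t - 10 * U - 2 + L) ≤ Real.pi * L + Λ / 2 := by
    have q0 : 0 ≤ (1 - β) * Real.pi := mul_nonneg (by linarith) (by linarith)
    have : t - 10 * U - 2 + L ≤ (t - 2 * U - U) + (t - 2 * U - U) + (T - t3 - U) := by
      rw [hT]; linarith
    have := mul_le_mul_of_nonneg_left this q0
    linarith
  have f2 : (1 - β) * (t - 10 * U - 2 + L) ≤ L + Λ / 6 := by
    have : (1 - β) * (t - 10 * U - 2 + L) * Real.pi ≤ (L + Λ / 6) * Real.pi := by nlinarith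
    exact le_of_mul_le_mul_right this (by linarith)
  have f3 : (1 - β) * (3 * U - 2) ≤ (1 - β) * (t - 10 * U - 2) := by
    refine mul_le_mul_of_nonneg_left (by linarith) (by linarith)
  nlinarith

/-- The vortices lie in two symmetric clusters. -/
theorem bad_near (R : Pinched c a b β μ ℓ U L Λ N) {z v : ℂ} (hz : β ≤ |cw a b z|) (hz0 : 0 < z.re)
    (hv : β ≤ |cw a b v|) : (0 < v.re ∧ ‖v - z‖ ≤ Real.exp (14 * U)) ∨
      (v.re < 0 ∧ ‖v - reflect z‖ ≤ Real.exp (14 * U)) := by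
  have h1 := R.abs_re hv
  have h2 : v.re ≠ 0 := by
    intro h
    rw [h, abs_zero] at h1
    exact absurd h1 (not_lt.2 (Real.exp_pos _).le)
  rcases lt_or_gt_of_ne h2 with h | h
  · right
    refine ⟨h, ?_⟩
    have := R.cluster hz (y := reflect v) (by rwa [cw_reflect R.reg.even_a R.reg.even_b]) hz0
      (by rw [reflect_re]; linarith)
    rwa [← reflect.norm_map, map_sub, reflect_reflect] at this
  · exact Or.inl ⟨h, R.cluster hz hv hz0 h⟩

theorem exists_right (R : Pinched c a b β μ ℓ U L Λ N) {v : ℂ} (hv : β ≤ |cw a b v|) :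
    ∃ z, β ≤ |cw a b z| ∧ Real.exp (L - 3 * U) < z.re := by
  have h1 := R.abs_re hv
  rcases le_or_gt 0 v.re with h | h
  · exact ⟨v, hv, by rwa [abs_of_nonneg h] at h1⟩
  · exact ⟨reflect v, by rwa [cw_reflect R.reg.even_a R.reg.even_b], by
      rwa [reflect_re, ← abs_of_neg h]⟩

/-- Each cluster carries potential energy close to `π`. -/
theorem exists_pot_near (R : Pinched c a b β μ ℓ U L Λ N) {z : ℂ} (hz : β ≤ |cw a b z|)
    (hz1 : Real.exp (L - 3 * U) < z.re) :
    ∃ s, 15 * U < s ∧ s < L - 3 * U ∧ |pot a b z (Real.exp s) - Real.pi| ≤ 70 * β := by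
  have hz0 := (Real.exp_pos _).trans hz1
  have hU := R.reg.U_pos
  have hUL := R.U_le
  have hUge := R.U_ge
  have hΛ := R.Λ_nonneg
  have hβ := R.reg.τ_pos
  have hβ' := R.β_le
  have ha := R.reg.sol.smooth_a
  have hb := R.reg.sol.smooth_b
  have hcont := continuous_ringE ha hb z
  have hpi := Real.pi_gt_three
  have hpi' := Real.pi_lt_d2
  have clean : ∀ v, Real.exp (15 * U) < ‖v - z‖ → ‖v - z‖ < Real.exp (L - 3 * U) → |cw a b v| < β := by
    intro v h1 h2
    by_contra! hbad
    rcases R.bad_near hz hz0 hbad with ⟨_, h⟩ | ⟨h, _⟩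
    · have := Real.exp_le_exp.2 (show 14 * U ≤ 15 * U by linarith)
      linarith
    · have := (abs_le.1 (Complex.abs_re_le_norm (v - z))).1
      rw [Complex.sub_re] at this
      linarith
  obtain ⟨s, hs, hle⟩ : ∃ s ∈ Set.Ioo (15 * U) (L - 3 * U), ringE a b z s * (L - 18 * U) ≤ Real.pi * L + Λ / 2 := by
    by_contra! hcon
    have h1 : ∫ s in (15 * U)..(L - 3 * U), ringE a b z s ≤ Real.pi * L + Λ / 2 := by
      rw [integral_ringE ha hb z (by linarith)]
      refine le_trans ?_ R.right_le
      exact setIntegral_mono_set R.reg.int.integrableOn (Eventually.of_forall fun x => ed_nonneg x)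
        (LE.le.eventuallyLE (annulus_subset hz1 le_rfl))
    have hpos : 0 < L - 18 * U := by linarith
    have h2 : ∫ s in (15 * U)..(L - 3 * U), (Real.pi * L + Λ / 2) / (L - 18 * U) < ∫ s in (15 * U)..(L - 3 * U), ringE a b z s := by
      refine intervalIntegral.integral_lt_integral_of_continuousOn_of_le_of_exists_lt (by linarith)
        continuousOn_const hcont.continuousOn (fun s hs => ?_) ⟨(15 * U + (L - 3 * U)) / 2, ⟨by linarith, by linarith⟩, ?_⟩
      · have hcl : (Set.Icc (15 * U) (L - 3 * U)) = closure (Set.Ioo (15 * U) (L - 3 * U)) :=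
          (closure_Ioo (by linarith)).symm
        have : Set.Icc (15 * U) (L - 3 * U) ⊆ {s | (Real.pi * L + Λ / 2) / (L - 18 * U) ≤ ringE a b z s} := by
          rw [hcl]
          refine closure_minimal (fun s hs => ?_) (isClosed_le continuous_const hcont)
          exact (div_le_iff₀ hpos).2 (hcon s hs).le
        exact this ⟨hs.1.le, hs.2⟩
      · exact (div_lt_iff₀ hpos).2 (hcon _ ⟨by linarith, by linarith⟩)
    rw [intervalIntegral.integral_const, smul_eq_mul,
      show (L - 3 * U - 15 * U) = L - 18 * U by ring, mul_div_cancel₀ _ hpos.ne'] at h2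
    linarith
  refine ⟨s, hs.1, hs.2, ?_⟩
  obtain ⟨k1, k2⟩ := R.reg.ringE_lower (v := z) (by linarith) (by
      have := R.reg.cells
      have : ℓ ≤ (2 * N + 1) * ℓ := by
        have : 0 ≤ (N:ℝ) * ℓ := mul_nonneg (Nat.cast_nonneg _) R.reg.ℓ_pos.le
        linarith
      linarith) (by linarith) clean hz (by
        simp only [sub_self, norm_zero, zero_add]
        exact Real.one_le_exp (by linarith)) hs
  have k3 := ringA_le_ringE ha hb z s
  have k4 := abs_le.1 (R.reg.sol.pohozaev R.reg.c_nonneg R.reg.int z s)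
  have k5 : c * Real.exp s * ∫ x, ed a b x ≤ μ / 2 := by
    refine le_trans ?_ R.reg.drift
    have := R.reg.c_nonneg
    have : s ≤ L - U := by linarith [hs.2]
    have := ed_total_nonneg (a := a) (b := b)
    gcongr
  have k6 : μ ≤ β := by
    rw [R.reg.μ_eq]
    have : β ^ 4 ≤ β := by
      have := pow_le_pow_of_le_one hβ.le (by linarith) (show 1 ≤ 4 by norm_num)
      simpa using this
    linarith
  have k7 : ringE a b z s ≤ Real.pi + 60 * β := by
    have hpos : 0 < L - 18 * U := by linarith
    refine le_of_mul_le_mul_right (hle.trans ?_) hpos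
    have := R.U_eq
    have hL : 0 < L := by linarith
    have e1 : β * U ≤ U / 1000 := by nlinarith
    have e2 : Real.pi * U ≤ 3.15 * U := by nlinarith
    nlinarith
  have k8 : Real.pi * β ≤ 3.15 * β := by nlinarith
  rw [abs_le]
  constructor <;> nlinarith

/-- Far from the clusters the modulus is very close to one. -/
theorem abs_cw_far (R : Pinched c a b β μ ℓ U L Λ N) {z : ℂ} (hz : β ≤ |cw a b z|) (hz0 : 0 < z.re)
    {δ : ℝ} (hδ : 0 ≤ δ)
    (hfar : 100000 * (2 / (14 * U) * ((∫ x, ed a b x) * Real.exp (-(14 * U / 200))) +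
      c * Real.exp (14 * U) * ∫ x, ed a b x) ≤ δ ^ 4) {x : ℂ}
    (h1 : 2 * Real.exp (14 * U) < ‖x - z‖) (h2 : 2 * Real.exp (14 * U) < ‖x - reflect z‖) : |cw a b x| ≤ δ := by
  have hU := R.reg.U_pos
  have clean : ∀ v, ‖v - x‖ < Real.exp (14 * U) → |cw a b v| ≤ 1 / 8 := by
    intro v hv
    by_contra! hbad
    have tri : ∀ w : ℂ, ‖x - w‖ ≤ ‖v - x‖ + ‖v - w‖ := fun w => by
      rw [show x - w = (v - w) - (v - x) by ring, add_comm]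
      exact norm_sub_le _ _
    rcases R.bad_near hz hz0 (R.reg.τ_le.trans hbad.le) with ⟨_, h⟩ | ⟨_, h⟩
    · linarith [tri z]
    · linarith [tri (reflect z)]
  have h3 := R.reg.sol.pot_le_of_wind_zero R.reg.c_nonneg R.reg.c_le R.reg.int (z := x) (y := 14 * U) le_rfl
    (by linarith) (fun v _ hv => clean v hv) fun s hs => R.reg.sol.wind_zero_of_disc clean hs.2
  rw [Real.exp_zero, sub_zero] at h3
  have h4 := R.reg.sol.cw_pow_le_pot R.reg.c_nonneg (R.reg.c_le.trans (by norm_num)) x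
  refine le_of_pow_le_pow_left₀ (n := 4) (by norm_num) hδ ?_
  rw [Even.pow_abs (by decide)]
  linarith

/-- The total potential energy is close to `2π`. -/
theorem total_near (R : Pinched c a b β μ ℓ U L Λ N) {v : ℂ} (hv : β ≤ |cw a b v|) {δ C : ℝ}
    (hδ : 0 ≤ δ) (hδ' : δ ≤ 1 / 2)
    (hfar : 100000 * (2 / (14 * U) * ((∫ x, ed a b x) * Real.exp (-(14 * U / 200))) +
      c * Real.exp (14 * U) * ∫ x, ed a b x) ≤ δ ^ 4)
    (hC : 0 < C)
    (hext : ∀ {z₁ z₂ : ℂ} {r τ : ℝ}, 0 < r → 0 ≤ τ → τ ≤ 1 / 2 →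
      (∀ x, r < ‖x - z₁‖ → r < ‖x - z₂‖ → |cw a b x| ≤ τ) →
      ∫ x in {x | 2 * r < ‖x - z₁‖ ∧ 2 * r < ‖x - z₂‖}, cw a b x ^ 2 ≤ C * (τ + c + 1 / r) * ∫ x, ed a b x)
    (hsmall : C * (δ + c + 2 * Real.exp (-(15 * U))) * ∫ x, ed a b x ≤ β) :
    |(∫ x, 1 / 2 * cw a b x ^ 2) - 2 * Real.pi| ≤ 141 * β := by
  obtain ⟨z, hz, hz1⟩ := R.exists_right hv
  have hz0 := (Real.exp_pos _).trans hz1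
  have hU := R.reg.U_pos
  have hUge := R.U_ge
  have hΛ := R.Λ_nonneg
  have ha := R.reg.sol.smooth_a
  have hb := R.reg.sol.smooth_b
  have hE := ed_total_nonneg (a := a) (b := b)
  have hw := integrable_cw_sq ha hb R.reg.int
  obtain ⟨s, s1, s2, hpot⟩ := R.exists_pot_near hz hz1
  have hpot' := hpot
  rw [← pot_reflect R.reg.even_a R.reg.even_b] at hpot'
  have es : 4 * Real.exp (14 * U) ≤ Real.exp s := by
    have e1 : Real.exp (14 * U + 3) ≤ Real.exp s := Real.exp_le_exp.2 (by linarith)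
    rw [Real.exp_add] at e1
    have e2 := Real.add_one_le_exp (3:ℝ)
    have := Real.exp_pos (14 * U)
    nlinarith
  have sZ : Real.exp s < z.re := (Real.exp_lt_exp.2 s2).trans hz1
  have hdisj : Disjoint (closedBall z (Real.exp s)) (closedBall (reflect z) (Real.exp s)) := by
    refine closedBall_disjoint_closedBall ?_
    rw [dist_eq_norm]
    have := Complex.abs_re_le_norm (z - reflect z)
    rw [Complex.sub_re, reflect_re] at this
    linarith [le_abs_self (z.re - -z.re)]
  set K := closedBall z (Real.exp s) ∪ closedBall (reflect z) (Real.exp s) with hK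
  have hKm : MeasurableSet K := measurableSet_closedBall.union measurableSet_closedBall
  have hKc : Kᶜ = {x | 2 * (Real.exp s / 2) < ‖x - z‖ ∧ 2 * (Real.exp s / 2) < ‖x - reflect z‖} := by
    ext x
    simp only [hK, Set.mem_compl_iff, Set.mem_union, mem_closedBall, dist_eq_norm, not_or, not_le,
      Set.mem_ofPred_eq]
    rw [mul_div_cancel₀ _ (two_ne_zero)]
  have hsplit := integral_add_compl hKm hw
  rw [hK, setIntegral_union hdisj measurableSet_closedBall hw.integrableOn hw.integrableOn, ← hK] at hsplit
  have hout := hext (z₁ := z) (z₂ := reflect z) (r := Real.exp s / 2) (τ := δ) (by positivity) hδ hδ'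
    fun x h1 h2 => R.abs_cw_far hz hz0 hδ hfar (by linarith) (by linarith)
  rw [← hKc] at hout
  have hr : 1 / (Real.exp s / 2) ≤ 2 * Real.exp (-(15 * U)) := by
    rw [one_div_div, div_eq_mul_inv, ← Real.exp_neg]
    have : Real.exp (-s) ≤ Real.exp (-(15 * U)) := Real.exp_le_exp.2 (by linarith)
    linarith
  have hout2 : C * (δ + c + 1 / (Real.exp s / 2)) * ∫ x, ed a b x ≤ C * (δ + c + 2 * Real.exp (-(15 * U))) * ∫ x, ed a b x := by
    gcongr
  have hout3 : 0 ≤ ∫ x in Kᶜ, cw a b x ^ 2 := integral_nonneg fun x => sq_nonneg _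
  have hout4 : ∫ x in Kᶜ, 1 / 2 * cw a b x ^ 2 = 1 / 2 * ∫ x in Kᶜ, cw a b x ^ 2 := integral_const_mul _ _
  unfold pot at hpot hpot'
  rw [abs_le] at hpot hpot' ⊢
  constructor <;> linarith

end Pinched

theorem eventually_pow_mul_exp_lt (k : ℕ) {s η : ℝ} (hs : 0 < s) (hη : 0 < η) :
    ∀ᶠ L : ℝ in atTop, L ^ k * Real.exp (-(s * L)) < η := by
  have h := tendsto_rpow_mul_exp_neg_mul_atTop_nhds_zero k s hs
  filter_upwards [h.eventually (gt_mem_nhds hη)] with L hL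
  rwa [Real.rpow_natCast, neg_mul] at hL

section Bridge
variable {u : ℂ → ℂ} {c : ℝ}

theorem dd_re {f : ℂ → ℂ} (hf : Differentiable ℝ f) (v z : ℂ) :
    dd v (fun x => (f x).re) z = (fderiv ℝ f z v).re := by
  have := Complex.reCLM.hasFDerivAt.comp z (hf z).hasFDerivAt
  unfold dd
  rw [show (fun x => (f x).re) = Complex.reCLM ∘ f from rfl, this.fderiv]
  rfl

theorem dd_im {f : ℂ → ℂ} (hf : Differentiable ℝ f) (v z : ℂ) :
    dd v (fun x => (f x).im) z = (fderiv ℝ f z v).im := by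
  have := Complex.imCLM.hasFDerivAt.comp z (hf z).hasFDerivAt
  unfold dd
  rw [show (fun x => (f x).im) = Complex.imCLM ∘ f from rfl, this.fderiv]
  rfl

theorem contDiff_fderiv_apply (hu : ContDiff ℝ ∞ u) (v : ℂ) : ContDiff ℝ ∞ fun z => fderiv ℝ u z v :=
  (hu.fderiv_right (m := ∞) (by simp)).clm_apply contDiff_const

theorem dd_dd_re (hu : ContDiff ℝ ∞ u) (v z : ℂ) :
    dd v (dd v fun x => (u x).re) z = (fderiv ℝ (fun x => fderiv ℝ u x v) z v).re := by
  have h1 : Differentiable ℝ u := hu.differentiable (by simp)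
  rw [show (dd v fun x => (u x).re) = fun x => (fderiv ℝ u x v).re from funext fun x => dd_re h1 v x]
  exact dd_re ((contDiff_fderiv_apply hu v).differentiable (by simp)) v z

theorem dd_dd_im (hu : ContDiff ℝ ∞ u) (v z : ℂ) :
    dd v (dd v fun x => (u x).im) z = (fderiv ℝ (fun x => fderiv ℝ u x v) z v).im := by
  have h1 : Differentiable ℝ u := hu.differentiable (by simp)
  rw [show (dd v fun x => (u x).im) = fun x => (fderiv ℝ u x v).im from funext fun x => dd_im h1 v x]
  exact dd_im ((contDiff_fderiv_apply hu v).differentiable (by simp)) v z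

theorem norm_sq_eq (z : ℂ) : ‖z‖ ^ 2 = z.re ^ 2 + z.im ^ 2 := by
  rw [Complex.sq_norm, Complex.normSq_apply]; ring

theorem sol_of_TW (hu : ContDiff ℝ ∞ u) (h : TW c u) : Sol c (fun z => (u z).re) (fun z => (u z).im) where
  smooth_a := Complex.reCLM.contDiff.comp hu
  smooth_b := Complex.imCLM.contDiff.comp hu
  eq_a z := by
    have h1 : Differentiable ℝ u := hu.differentiable (by simp)
    have h2 := congrArg Complex.re (h z)
    rw [dd_dd_re hu, dd_dd_re hu, dd_im h1, ← norm_sq_eq]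
    simp [lap, pd2, -Complex.ofReal_sub, -Complex.ofReal_pow] at h2
    change (fderiv ℝ (pd1 u) z 1).re + (fderiv ℝ (pd2 u) z Complex.I).re = _
    linarith
  eq_b z := by
    have h1 : Differentiable ℝ u := hu.differentiable (by simp)
    have h2 := congrArg Complex.im (h z)
    rw [dd_dd_im hu, dd_dd_im hu, dd_re h1, ← norm_sq_eq]
    simp [lap, pd2, -Complex.ofReal_sub, -Complex.ofReal_pow] at h2
    change (fderiv ℝ (pd1 u) z 1).im + (fderiv ℝ (pd2 u) z Complex.I).im = _
    linarith

theorem ed_eq_energyDensity (hu : ContDiff ℝ ∞ u) (z : ℂ) :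
    ed (fun z => (u z).re) (fun z => (u z).im) z = energyDensity u z := by
  have h1 : Differentiable ℝ u := hu.differentiable (by simp)
  unfold ed cw energyDensity gradSq pd1 pd2
  rw [dd_re h1, dd_re h1, dd_im h1, dd_im h1, norm_sq_eq, norm_sq_eq, norm_sq_eq]
  ring

theorem md_eq_momDensity (hu : ContDiff ℝ ∞ u) (z : ℂ) :
    md (fun z => (u z).re) (fun z => (u z).im) Complex.I z = momDensity u z := by
  have h1 : Differentiable ℝ u := hu.differentiable (by simp)
  unfold md momDensity pd2
  rw [dd_re h1, dd_im h1]
  simp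
  ring

theorem integrable_ed_of_memE (hu : memE u) : Integrable (ed (fun z => (u z).re) (fun z => (u z).im)) ∧
    ∫ z, ed (fun z => (u z).re) (fun z => (u z).im) z = Efun u := by
  have hsm : ContDiff ℝ ∞ u := hu.1
  have hc := continuous_ed (a := fun z => (u z).re) (b := fun z => (u z).im)
    (Complex.reCLM.contDiff.comp hsm) (Complex.imCLM.contDiff.comp hsm)
  have heq : ed (fun z => (u z).re) (fun z => (u z).im) = energyDensity u := funext (ed_eq_energyDensity hsm)
  have hnn : 0 ≤ᵐ[volume] energyDensity u := Eventually.of_forall fun z => heq ▸ ed_nonneg z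
  rw [heq] at hc ⊢
  refine ⟨(lintegral_ofReal_ne_top_iff_integrable hc.aestronglyMeasurable hnn).1 hu.2.ne, ?_⟩
  rw [integral_eq_lintegral_of_nonneg_ae hnn hc.aestronglyMeasurable]
  rfl

end Bridge

section Asymptotics
variable {c L E β : ℝ}

/-- The error of the Pohozaev identity at scale `exp y`. -/
theorem drift_le (hcL : c ≤ 14 * L * Real.exp (-L)) (hE : 0 ≤ E) (hEL : E ≤ 7 * L) (y : ℝ) :
    c * Real.exp y * E ≤ 98 * (L ^ 2 * Real.exp (-(L - y))) := by
  have hL : 0 ≤ L := by linarith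
  have h1 : c * Real.exp y * E ≤ 14 * L * Real.exp (-L) * Real.exp y * (7 * L) := by gcongr
  refine h1.trans_eq ?_
  rw [show -(L - y) = -L + y by ring, Real.exp_add]
  ring

theorem regime_of_large {a b : ℂ → ℝ} {N : ℕ} {κ μ : ℝ} (h : Sol c a b) (hc : 0 ≤ c) (hI : Integrable (ed a b))
    (ea : ∀ z, a (-(starRingEnd ℂ z)) = a z) (eb : ∀ z, b (-(starRingEnd ℂ z)) = b z)
    (hcL : c ≤ 14 * L * Real.exp (-L)) (hEL : ∫ x, ed a b x ≤ 7 * L)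
    (hβ : 0 < β) (hβ' : β ≤ 1 / 1000) (hμ : μ = β ^ 4 / 100000) (hκ : 0 < κ) (hκN : (2 * N + 1) * κ ≤ β)
    (hN : 14 < (N + 1) * (μ * β)) (hL : 1 ≤ L)
    (k1 : L ^ 1 * Real.exp (-(1 * L)) < 1 / 500)
    (k2 : L ^ 2 * Real.exp (-(β * L)) < μ / 400)
    (k3 : L ^ 0 * Real.exp (-(κ / 200 * L)) < κ * μ / 56)
    (k4 : L ^ 0 * Real.exp (-(β * L)) < κ / 4) :
    Regime c a b β μ (κ * L) (β * L) (L - β * L) N where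
  sol := h
  c_nonneg := hc
  c_le := by
    rw [pow_one, one_mul] at k1
    linarith
  int := hI
  even_a := ea
  even_b := eb
  τ_pos := hβ
  τ_le := by linarith
  μ_eq := hμ
  ℓ_pos := by positivity
  U_pos := by positivity
  cells := by
    rw [← mul_assoc]
    gcongr
  gap := by
    rw [pow_zero, one_mul] at k4
    nlinarith
  le_Y := by nlinarith
  decay := by
    have h1 := drift_le hcL ed_total_nonneg hEL (L - β * L)
    rw [sub_sub_cancel] at h1
    rw [pow_zero, one_mul] at k3
    have h2 : 2 / (κ * L) * ((∫ x, ed a b x) * Real.exp (-(κ * L / 200))) ≤ 14 / κ * Real.exp (-(κ / 200 * L)) := by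
      have : 2 / (κ * L) * ((∫ x, ed a b x) * Real.exp (-(κ * L / 200))) ≤
          2 / (κ * L) * (7 * L * Real.exp (-(κ * L / 200))) := by gcongr
      refine this.trans_eq ?_
      rw [show κ * L / 200 = κ / 200 * L by ring]
      field_simp
      norm_num
    have h3 : 14 / κ * Real.exp (-(κ / 200 * L)) < μ / 4 := by
      have : 14 / κ * Real.exp (-(κ / 200 * L)) < 14 / κ * (κ * μ / 56) := by gcongr
      refine this.trans_eq ?_
      field_simp
      ring
    have : 0 < μ := by rw [hμ]; positivity
    linarith
  drift := by
    have h1 := drift_le hcL ed_total_nonneg hEL (L - β * L)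
    rw [sub_sub_cancel] at h1
    have : 0 < μ := by rw [hμ]; positivity
    linarith
  energy := by
    have : 14 * (L / 2) < (N + 1) * (μ * β) * (L / 2) := mul_lt_mul_of_pos_right hN (by linarith)
    linarith

/-- The travelling wave potential is asymptotically quantised. -/
theorem exists_large_scale {Λ ε : ℝ} (hΛ : 0 ≤ Λ) (hε : 0 < ε) : ∃ L₀ : ℝ, ∀ {c L : ℝ} {a b : ℂ → ℝ},
    Sol c a b → 0 ≤ c → Integrable (ed a b) → (∀ z, a (-(starRingEnd ℂ z)) = a z) →
    (∀ z, b (-(starRingEnd ℂ z)) = b z) → Integrable (md a b Complex.I) →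
    1 / 2 * ∫ x, md a b Complex.I x = Real.exp L → ∫ x, ed a b x ≤ 2 * Real.pi * L + Λ → L₀ ≤ L →
    |(∫ x, 1 / 2 * cw a b x ^ 2) - 2 * Real.pi| ≤ ε := by
  obtain ⟨C, hC, hext⟩ := exists_exterior_bound
  set β : ℝ := min (1 / 1000) (ε / 141) with hβdef
  have hβ : 0 < β := lt_min (by norm_num) (by positivity)
  have hβ' : β ≤ 1 / 1000 := min_le_left _ _
  have hβε : 141 * β ≤ ε := by
    have : β ≤ ε / 141 := min_le_right _ _
    linarith
  set μ : ℝ := β ^ 4 / 100000 with hμ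
  have μ0 : 0 < μ := by positivity
  obtain ⟨N, hN⟩ := exists_nat_gt (14 / (μ * β))
  rw [div_lt_iff₀ (by positivity)] at hN
  set κ : ℝ := β / (2 * N + 1) with hκdef
  have hκ : 0 < κ := by positivity
  have hκN : (2 * N + 1) * κ ≤ β := by
    rw [hκdef]; field_simp; exact le_rfl
  set η : ℝ := β / (140 * C) with hη
  have η0 : 0 < η := by positivity
  have ev : ∀ᶠ L : ℝ in atTop, ((1 ≤ L ∧ (3 + Λ) / β ≤ L) ∧ (L ^ 1 * Real.exp (-(1 * L)) < 1 / 500 ∧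
      L ^ 2 * Real.exp (-(β * L)) < μ / 400) ∧ (L ^ 0 * Real.exp (-(κ / 200 * L)) < κ * μ / 56 ∧
      L ^ 0 * Real.exp (-(β * L)) < κ / 4)) ∧ ((L ^ 0 * Real.exp (-(3 / 100 * β * L)) < β / 400000 ∧
      L ^ 2 * Real.exp (-(β * L)) < 1 / 10 ^ 9) ∧ L ^ 0 * Real.exp (-(β / 100 * L)) < 1 / 2) ∧
      (L ^ 1 * Real.exp (-(β / 100 * L)) < η ∧ L ^ 2 * Real.exp (-(β * L)) < η) := by
    refine (((eventually_ge_atTop _).and (eventually_ge_atTop _)).and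
      (((eventually_pow_mul_exp_lt _ ?_ ?_).and (eventually_pow_mul_exp_lt _ ?_ ?_)).and
      ((eventually_pow_mul_exp_lt _ ?_ ?_).and (eventually_pow_mul_exp_lt _ ?_ ?_)))).and
      ((((eventually_pow_mul_exp_lt _ ?_ ?_).and (eventually_pow_mul_exp_lt _ ?_ ?_)).and
        (eventually_pow_mul_exp_lt _ ?_ ?_)).and
      ((eventually_pow_mul_exp_lt _ ?_ ?_).and (eventually_pow_mul_exp_lt _ ?_ ?_))) <;> positivity
  obtain ⟨L₀, hL₀⟩ := eventually_atTop.1 ev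
  refine ⟨L₀, ?_⟩
  intro c L a b h hc hI ea eb hm hp hE hL
  obtain ⟨⟨⟨L1, LΛ⟩, ⟨k1, k2⟩, k3, k4⟩, ⟨⟨k5, k6⟩, k7⟩, k8, k9⟩ := hL₀ L hL
  have ha := h.smooth_a
  have hb := h.smooth_b
  have hpi := Real.pi_lt_d2
  have E0 : 0 ≤ ∫ x, ed a b x := ed_total_nonneg
  have hLΛ : 3 + Λ ≤ β * L := by rwa [div_le_iff₀ hβ, mul_comm] at LΛ
  have hEL : ∫ x, ed a b x ≤ 7 * L := by nlinarith
  have hcL : c ≤ 14 * L * Real.exp (-L) := by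
    have h1 := h.integral_cw_sq hI hm
    have h2 : ∫ x, 1 / 2 * cw a b x ^ 2 ≤ ∫ x, 2 * ed a b x :=
      integral_mono (integrable_cw_sq ha hb hI) (hI.const_mul 2) fun x => by
        have := cw_sq_le_ed (a := a) (b := b) x
        show 1 / 2 * cw a b x ^ 2 ≤ 2 * ed a b x
        linarith
    rw [h1, integral_const_mul] at h2
    have h3 : c * Real.exp L ≤ 14 * L := by
      rw [← hp]; linarith
    rw [Real.exp_neg, ← div_eq_mul_inv, le_div_iff₀ (Real.exp_pos L)]
    exact h3
  have bad : ∃ v, β ≤ |cw a b v| := by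
    by_contra! hcon
    have h1 := momentum_le_of_no_vortex ha hb hI hm fun z => (hcon z).le.trans (by linarith)
    have h2 : Real.exp L ≤ 7 * L := by
      rw [← hp]
      linarith [le_abs_self (∫ z, md a b Complex.I z)]
    have h3 : 1 ≤ 7 * L * Real.exp (-L) := by
      rw [Real.exp_neg, ← div_eq_mul_inv, one_le_div (Real.exp_pos L)]
      exact h2
    rw [pow_one, one_mul] at k1
    linarith
  obtain ⟨v, hv⟩ := bad
  have R : Pinched c a b β μ (κ * L) (β * L) L Λ N :=
    { reg := regime_of_large h hc hI ea eb hcL hEL hβ hβ' hμ hκ hκN (by nlinarith [mul_pos μ0 hβ]) L1 k1 k2 k3 k4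
      β_le := hβ'
      U_eq := rfl
      Λ_nonneg := hΛ
      U_ge := hLΛ
      energy_le := hE }
  rw [pow_zero, one_mul] at k5 k7
  rw [pow_one] at k8
  have hU : 1000 * (β * L) ≤ L := R.U_le
  have hU0 : 0 < β * L := by positivity
  refine (R.total_near hv (δ := Real.exp (-(β / 100 * L))) (C := C) (Real.exp_pos _).le k7.le ?_ hC
    (hext h hc hI) ?_).trans hβε
  · have e4 : Real.exp (-(β / 100 * L)) ^ 4 = Real.exp (-(4 / 100 * β * L)) := by
      rw [← Real.exp_nat_mul]; congr 1; push_cast; ring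
    have d1 := drift_le hcL E0 hEL (14 * (β * L))
    have d2 : Real.exp (-(L - 14 * (β * L))) ≤ Real.exp (-(β * L)) * Real.exp (-(4 / 100 * β * L)) := by
      rw [← Real.exp_add]
      refine Real.exp_le_exp.2 ?_
      linarith
    have d3 : L ^ 2 * Real.exp (-(L - 14 * (β * L))) ≤ 1 / 10 ^ 9 * Real.exp (-(4 / 100 * β * L)) := by
      calc L ^ 2 * Real.exp (-(L - 14 * (β * L)))
          ≤ L ^ 2 * (Real.exp (-(β * L)) * Real.exp (-(4 / 100 * β * L))) := by gcongr
        _ = L ^ 2 * Real.exp (-(β * L)) * Real.exp (-(4 / 100 * β * L)) := by ring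
        _ ≤ _ := by gcongr
    have d4 : 2 / (14 * (β * L)) * ((∫ x, ed a b x) * Real.exp (-(14 * (β * L) / 200))) ≤
        1 / 400000 * Real.exp (-(4 / 100 * β * L)) := by
      calc 2 / (14 * (β * L)) * ((∫ x, ed a b x) * Real.exp (-(14 * (β * L) / 200)))
          ≤ 2 / (14 * (β * L)) * (7 * L * Real.exp (-(14 * (β * L) / 200))) := by gcongr
        _ = 1 / β * Real.exp (-(3 / 100 * β * L)) * Real.exp (-(4 / 100 * β * L)) := by
            rw [mul_assoc (1 / β), ← Real.exp_add,
              show -(3 / 100 * β * L) + -(4 / 100 * β * L) = -(14 * (β * L) / 200) by ring]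
            field_simp
            norm_num
        _ ≤ 1 / β * (β / 400000) * Real.exp (-(4 / 100 * β * L)) := by gcongr
        _ = _ := by field_simp
    rw [e4]
    have := Real.exp_pos (-(4 / 100 * β * L))
    linarith
  · have f1 : L * c ≤ 14 * (L ^ 2 * Real.exp (-(β * L))) := by
      have : Real.exp (-L) ≤ Real.exp (-(β * L)) := Real.exp_le_exp.2 (by linarith)
      calc L * c ≤ L * (14 * L * Real.exp (-L)) := by gcongr
        _ ≤ L * (14 * L * Real.exp (-(β * L))) := by gcongr
        _ = _ := by ring
    have f2 : L * Real.exp (-(15 * (β * L))) ≤ L ^ 2 * Real.exp (-(β * L)) := by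
      have : Real.exp (-(15 * (β * L))) ≤ Real.exp (-(β * L)) := Real.exp_le_exp.2 (by linarith)
      have : L ≤ L ^ 2 := by nlinarith
      gcongr
    have f3 : C * (Real.exp (-(β / 100 * L)) + c + 2 * Real.exp (-(15 * (β * L)))) * ∫ x, ed a b x ≤
        C * (Real.exp (-(β / 100 * L)) + c + 2 * Real.exp (-(15 * (β * L)))) * (7 * L) := by gcongr
    refine f3.trans ?_
    have f4 : C * (Real.exp (-(β / 100 * L)) + c + 2 * Real.exp (-(15 * (β * L)))) * (7 * L) =
        7 * C * (L * Real.exp (-(β / 100 * L)) + L * c + 2 * (L * Real.exp (-(15 * (β * L))))) := by ring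
    have f5 : 7 * C * (L * Real.exp (-(β / 100 * L)) + L * c + 2 * (L * Real.exp (-(15 * (β * L))))) ≤ 7 * C * (20 * η) := by
      gcongr
      linarith
    have f6 : 7 * C * (20 * η) = β := by
      rw [hη]; field_simp; norm_num
    linarith

end Asymptotics

end GinzburgLandau

/-- asymptotic speed law `c·𝔭 → 2π`. -/
theorem asymptotic_speed_law (Λ₀ : ℝ) (hΛ₀ : 0 < Λ₀) (ε : ℝ) (hε : 0 < ε) :
    ∃ p₀ : ℝ, 0 < p₀ ∧ ∀ (u : ℂ → ℂ) (p c : ℝ), QuasiMin Λ₀ u p c → p₀ ≤ p →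
      |c * p - 2 * Real.pi| ≤ ε ∧
      |(1 / 2) * (∫ z : ℂ, (1 - ‖u z‖ ^ 2) ^ 2) - 2 * Real.pi| ≤ ε := by
  obtain ⟨L₀, hL₀⟩ := GinzburgLandau.exists_large_scale hΛ₀.le hε
  refine ⟨Real.exp L₀, Real.exp_pos _, ?_⟩
  rintro u p c ⟨hu, hev, hc, hTW, hm, hp, hE⟩ hpL
  have p0 : 0 < p := (Real.exp_pos _).trans_le hpL
  have hsol := GinzburgLandau.sol_of_TW hu.1 hTW
  obtain ⟨hI, hEI⟩ := GinzburgLandau.integrable_ed_of_memE hu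
  have hmd : GinzburgLandau.md (fun z => (u z).re) (fun z => (u z).im) Complex.I = momDensity u :=
    funext (GinzburgLandau.md_eq_momDensity hu.1)
  have hm' : Integrable (GinzburgLandau.md (fun z => (u z).re) (fun z => (u z).im) Complex.I) := hmd ▸ hm
  have hp' : 1 / 2 * ∫ x, GinzburgLandau.md (fun z => (u z).re) (fun z => (u z).im) Complex.I x = p := by
    rw [hmd]; exact hp
  have key := hL₀ (L := Real.log p) hsol hc.le hI (fun z => by simp only [hev z]) (fun z => by simp only [hev z]) hm'
    (by rw [Real.exp_log p0]; exact hp') (hEI.trans_le hE) ((Real.le_log_iff_exp_le p0).2 hpL)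
  have hV := hsol.integral_cw_sq hI hm'
  have hcp : c / 2 * ∫ x, GinzburgLandau.md (fun z => (u z).re) (fun z => (u z).im) Complex.I x = c * p := by
    rw [← hp']; ring
  have hw : ∫ z, 1 / 2 * GinzburgLandau.cw (fun z => (u z).re) (fun z => (u z).im) z ^ 2 =
      1 / 2 * ∫ z : ℂ, (1 - ‖u z‖ ^ 2) ^ 2 := by
    rw [integral_const_mul]
    simp only [GinzburgLandau.cw, GinzburgLandau.norm_sq_eq]
  refine ⟨?_, by rwa [hw] at key⟩
  rwa [hV, hcp] at key
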